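/- arXiv:1408.5647 — 4 statements merged into one kernel-verified Lean document; each statement's English description precedes it below -/
import Mathlib

section
/- Let K ⊂ ℝ³ be a smooth, strictly convex body and α > 0. Suppose that for every p ∈ bd K there are two planes H₁, H₂, each containing the diametral line of K through p, forming an angle at least α with each other, such that bd K ∩ H₁ and bd K ∩ H₂ are ellipses. Then bd K is an ellipsoid. -/
open scoped RealInnerProductSpace
open MeasureTheory

noncomputable section

/-- Euclidean 3-space. -/
abbrev E3 : Type := EuclideanSpace ℝ (Fin 3)

/-- The line through `p` with direction vector `v`. -/
def lineThrough (p v : E3) : Set E3 := {x : E3 | ∃ t : ℝ, x = p + t • v}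

/-- A line in `ℝ³`. -/
def IsLine (L : Set E3) : Prop := ∃ p v : E3, v ≠ 0 ∧ L = lineThrough p v

/-- A plane in `ℝ³` with prescribed unit normal `n`. -/
def IsPlaneWithNormal (H : Set E3) (n : E3) : Prop :=
  ‖n‖ = 1 ∧ ∃ c : ℝ, H = {x : E3 | ⟪n, x⟫ = c}

/-- A plane in `ℝ³`. -/
def IsPlane (H : Set E3) : Prop := ∃ n : E3, IsPlaneWithNormal H n

/-- The unit circle `{(cos t, sin t, 0)}` in the plane `z = 0`. -/
def unitCircle3 : Set E3 := {x : E3 | x 0 ^ 2 + x 1 ^ 2 = 1 ∧ x 2 = 0}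

/-- An ellipse in `ℝ³`: the image of the unit circle under an invertible affine map. -/
def IsEllipse (E : Set E3) : Prop := ∃ f : E3 ≃ᵃ[ℝ] E3, E = f '' unitCircle3

/-- An ellipsoid in `ℝ³`: the image of the unit sphere under an invertible affine map. -/
def IsEllipsoid (S : Set E3) : Prop := ∃ f : E3 ≃ᵃ[ℝ] E3, S = f '' Metric.sphere (0 : E3) 1

/-- A circle in `ℝ³`: the points of some plane at fixed positive distance from a
center lying in that plane. -/
def IsCircle (C : Set E3) : Prop :=
  ∃ (H : Set E3) (c : E3) (r : ℝ), IsPlane H ∧ c ∈ H ∧ 0 < r ∧ C = {x ∈ H | dist x c = r}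

/-- A sphere in `ℝ³`. -/
def IsSphere (S : Set E3) : Prop := ∃ (c : E3) (r : ℝ), 0 < r ∧ S = Metric.sphere c r

/-- A convex body: compact, convex, with nonempty interior. -/
def IsConvexBody (K : Set E3) : Prop := IsCompact K ∧ Convex ℝ K ∧ (interior K).Nonempty

/-- A line `L` is tangent to `bd K` if it meets `K` but not the interior of `K`. -/
def IsTangentLine (K L : Set E3) : Prop := (L ∩ K).Nonempty ∧ L ∩ interior K = ∅

/-- An outward function on the boundary of a convex body `K`. -/
def IsOutwardFunction (K : Set E3) (Ψ : E3 → E3) : Prop :=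
  ContinuousOn Ψ (frontier K) ∧
  ∀ p ∈ frontier K, ‖Ψ p‖ = 1 ∧
    ¬ IsTangentLine K (lineThrough p (Ψ p)) ∧
    (∀ t : ℝ, 0 < t → p + t • Ψ p ∉ K) ∧
    ∃ q ∈ frontier K, q ∉ lineThrough p (Ψ p) ∧
      (lineThrough p (Ψ p) ∩ lineThrough q (Ψ q) ∩ interior K).Nonempty

/-- `L` is a line parallel to the direction `u`. -/
def LineParallel (L : Set E3) (u : E3) : Prop := ∃ p : E3, L = lineThrough p u

/-- A system of lines: for every direction `u ∈ S²` exactly one member line parallel to `u`. -/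
def IsLineSystem (𝓛 : Set (Set E3)) : Prop :=
  (∀ L ∈ 𝓛, IsLine L) ∧ ∀ u : E3, ‖u‖ = 1 → ∃! L, L ∈ 𝓛 ∧ LineParallel L u

/-- A continuous system of lines: the map `δ` sending each direction `u ∈ S²` to the point
of `L_u` closest to the origin is continuous. -/
def IsContinuousLineSystem (𝓛 : Set (Set E3)) : Prop :=
  IsLineSystem 𝓛 ∧ ∃ δ : E3 → E3, ContinuousOn δ (Metric.sphere (0 : E3) 1) ∧
    ∀ u : E3, ‖u‖ = 1 → ∀ L ∈ 𝓛, LineParallel L u →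
      δ u ∈ L ∧ ∀ x ∈ L, ‖δ u‖ ≤ ‖x‖

/-- The center of a system of lines: points lying on at least two distinct lines. -/
def lineSystemCenter (𝓛 : Set (Set E3)) : Set E3 :=
  {x : E3 | ∃ L₁ ∈ 𝓛, ∃ L₂ ∈ 𝓛, L₁ ≠ L₂ ∧ x ∈ L₁ ∧ x ∈ L₂}

/-- A smooth convex body: each boundary point has a unique (unit outer normal of a)
support plane. -/
def IsSmoothBody (K : Set E3) : Prop :=
  ∀ p ∈ frontier K, ∃! n : E3, ‖n‖ = 1 ∧ ∀ x ∈ K, ⟪n, x⟫ ≤ ⟪n, p⟫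

/-- A strictly convex body: the boundary contains no line segment. -/
def IsStrictlyConvexBody (K : Set E3) : Prop :=
  ∀ x ∈ frontier K, ∀ y ∈ frontier K, x ≠ y → ¬ segment ℝ x y ⊆ frontier K

/-- `η` is an outer unit normal field of `K` on its boundary. -/
def IsOuterNormal (K : Set E3) (η : E3 → E3) : Prop :=
  ∀ p ∈ frontier K, ‖η p‖ = 1 ∧ ∀ x ∈ K, ⟪η p, x⟫ ≤ ⟪η p, p⟫

/-- The boundary of `K` is a `C^k` surface: locally, after a rigid motion, it is the graph
of a `C^k` function of two variables. -/
def HasContDiffBoundary (K : Set E3) (k : ℕ) : Prop :=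
  ∀ p ∈ frontier K, ∃ (e : E3 ≃ᵃⁱ[ℝ] E3) (g : ℝ × ℝ → ℝ) (U : Set E3),
    IsOpen U ∧ p ∈ U ∧ ContDiff ℝ k g ∧
    frontier K ∩ U = {x ∈ U | e x 2 = g (e x 0, e x 1)}

end

/-- The polynomial function of degree at most two on `E3` with the given ten coefficients. -/
def quad (c : Fin 10 → ℝ) (x : E3) : ℝ :=
  c 0 * x 0 ^ 2 + c 1 * x 1 ^ 2 + c 2 * x 2 ^ 2 + c 3 * (x 0 * x 1) + c 4 * (x 0 * x 2) +
    c 5 * (x 1 * x 2) + c 6 * x 0 + c 7 * x 1 + c 8 * x 2 + c 9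

/-- The polar form of the homogeneous quadratic part of `quad c`. -/
def quadPolar (c : Fin 10 → ℝ) (v w : E3) : ℝ :=
  2 * c 0 * (v 0 * w 0) + 2 * c 1 * (v 1 * w 1) + 2 * c 2 * (v 2 * w 2) +
    c 3 * (v 0 * w 1 + v 1 * w 0) + c 4 * (v 0 * w 2 + v 2 * w 0) +
    c 5 * (v 1 * w 2 + v 2 * w 1)

/-- The derivative of `quad c` at `x` in the direction `v`. -/
def quadDeriv (c : Fin 10 → ℝ) (x v : E3) : ℝ :=
  quadPolar c x v + c 6 * v 0 + c 7 * v 1 + c 8 * v 2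

lemma quad_add_smul (c : Fin 10 → ℝ) (x v : E3) (t : ℝ) :
    quad c (x + t • v) = quad c x + t * quadDeriv c x v + t ^ 2 * (quadPolar c v v / 2) := by
  simp only [quad, quadDeriv, quadPolar, PiLp.add_apply, PiLp.smul_apply, smul_eq_mul]
  ring

lemma quad_add_smul_add_smul (c : Fin 10 → ℝ) (o a b : E3) (s t : ℝ) :
    quad c (o + s • a + t • b) = quad c o + quadDeriv c o a * s + quadDeriv c o b * t +
      quadPolar c a a / 2 * s ^ 2 + quadPolar c a b * (s * t) + quadPolar c b b / 2 * t ^ 2 := by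
  simp only [quad, quadDeriv, quadPolar, PiLp.add_apply, PiLp.smul_apply, smul_eq_mul]
  ring

lemma quadDeriv_add_smul_add_smul (c : Fin 10 → ℝ) (o a b : E3) (s t : ℝ) :
    quadDeriv c (o + s • a + t • b) (s • b - t • a) =
      -quadDeriv c o a * t + quadDeriv c o b * s - 2 * (quadPolar c a a / 2) * (s * t) +
      quadPolar c a b * (s ^ 2 - t ^ 2) + 2 * (quadPolar c b b / 2) * (s * t) := by
  simp only [quadDeriv, quadPolar, PiLp.add_apply, PiLp.sub_apply, PiLp.smul_apply, smul_eq_mul]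
  ring

lemma quadDeriv_smul_add_smul (c : Fin 10 → ℝ) (x a b : E3) (s t : ℝ) :
    quadDeriv c x (s • a + t • b) = s * quadDeriv c x a + t * quadDeriv c x b := by
  simp only [quadDeriv, quadPolar, PiLp.add_apply, PiLp.smul_apply, smul_eq_mul]
  ring

lemma quad_smul_sub_smul (c d : Fin 10 → ℝ) (s t : ℝ) (x : E3) :
    quad (s • c - t • d) x = s * quad c x - t * quad d x := by
  simp only [quad, Pi.sub_apply, Pi.smul_apply, smul_eq_mul]
  ring

lemma exists_quad_ne_zero {c : Fin 10 → ℝ} (hc : c ≠ 0) : ∃ x, quad c x ≠ 0 := by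
  by_contra! H
  apply hc
  have h0 := H !₂[0, 0, 0]
  have h1 := H !₂[1, 0, 0]
  have h2 := H !₂[-1, 0, 0]
  have h3 := H !₂[0, 1, 0]
  have h4 := H !₂[0, -1, 0]
  have h5 := H !₂[0, 0, 1]
  have h6 := H !₂[0, 0, -1]
  have h7 := H !₂[1, 1, 0]
  have h8 := H !₂[1, 0, 1]
  have h9 := H !₂[0, 1, 1]
  simp [quad] at h0 h1 h2 h3 h4 h5 h6 h7 h8 h9
  funext i
  fin_cases i <;> simp <;> linarith

/-- Through any nine points passes a quadric. -/
lemma exists_quad_of_card_le {s : Finset E3} (hs : s.card ≤ 9) :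
    ∃ c : Fin 10 → ℝ, c ≠ 0 ∧ ∀ x ∈ s, quad c x = 0 := by
  let f : (Fin 10 → ℝ) →ₗ[ℝ] (s → ℝ) :=
    { toFun := fun c x => quad c x
      map_add' := by
        intro c d
        funext x
        simp only [quad, Pi.add_apply]
        ring
      map_smul' := by
        intro r c
        funext x
        simp only [quad, Pi.smul_apply, smul_eq_mul, RingHom.id_apply]
        ring }
  have hk : LinearMap.ker f ≠ ⊥ := by
    apply LinearMap.ker_ne_bot_of_finrank_lt
    simp
    omega
  obtain ⟨c, hc, hc0⟩ := Submodule.exists_mem_ne_zero_of_ne_bot hk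
  exact ⟨c, hc0, fun x hx => congrFun hc ⟨x, hx⟩⟩

/-- A quadratic polynomial on a line with three zeros vanishes identically. -/
lemma quadratic_eq_zero_of_three_zeros {A B C t₁ t₂ t₃ : ℝ} (h12 : t₁ ≠ t₂) (h13 : t₁ ≠ t₃)
    (h23 : t₂ ≠ t₃) (h1 : C + t₁ * B + t₁ ^ 2 * A = 0) (h2 : C + t₂ * B + t₂ ^ 2 * A = 0)
    (h3 : C + t₃ * B + t₃ ^ 2 * A = 0) : A = 0 ∧ B = 0 ∧ C = 0 := by
  have e1 : B + (t₁ + t₂) * A = 0 := by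
    apply mul_left_cancel₀ (sub_ne_zero.2 h12)
    linear_combination h1 - h2
  have e2 : B + (t₁ + t₃) * A = 0 := by
    apply mul_left_cancel₀ (sub_ne_zero.2 h13)
    linear_combination h1 - h3
  have hA : A = 0 := by
    apply mul_left_cancel₀ (sub_ne_zero.2 h23)
    linear_combination e1 - e2
  subst hA
  have hB : B = 0 := by linarith
  subst hB
  exact ⟨rfl, rfl, by linarith⟩

open Polynomial in
/-- A trigonometric polynomial of degree at most two with five zeros on the unit circle, counted
with multiplicity, vanishes identically. -/
lemma trigPoly_eq_zero (k₀ k₁ k₂ k₃ k₄ k₅ : ℝ) {S D : Finset ℂ} (hDS : D ⊆ S)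
    (hS1 : ∀ z ∈ S, z.re ^ 2 + z.im ^ 2 = 1)
    (hS : ∀ z ∈ S, k₀ + k₁ * z.re + k₂ * z.im + k₃ * z.re ^ 2 + k₄ * (z.re * z.im) +
      k₅ * z.im ^ 2 = 0)
    (hD : ∀ z ∈ D, -k₁ * z.im + k₂ * z.re - 2 * k₃ * (z.re * z.im) +
      k₄ * (z.re ^ 2 - z.im ^ 2) + 2 * k₅ * (z.re * z.im) = 0)
    (hcard : 5 ≤ S.card + D.card) (z : ℂ) (hz : z.re ^ 2 + z.im ^ 2 = 1) :
    k₀ + k₁ * z.re + k₂ * z.im + k₃ * z.re ^ 2 + k₄ * (z.re * z.im) + k₅ * z.im ^ 2 = 0 := by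
  let P : ℂ[X] := C (k₀ : ℂ) * X ^ 2 + C (k₁ / 2 : ℂ) * (X ^ 3 + X) +
    C (-k₂ * Complex.I / 2) * (X ^ 3 - X) + C (k₃ / 4 : ℂ) * (X ^ 4 + C 2 * X ^ 2 + C 1) +
    C (-k₄ * Complex.I / 4) * (X ^ 4 - C 1) + C (-k₅ / 4 : ℂ) * (X ^ 4 - C 2 * X ^ 2 + C 1)
  have hdeg : P.natDegree ≤ 4 := by
    simp only [P]
    compute_degree
  have key : ∀ c s : ℂ, c ^ 2 + s ^ 2 = 1 →
      P.eval (c + s * Complex.I) = (c + s * Complex.I) ^ 2 *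
        (k₀ + k₁ * c + k₂ * s + k₃ * c ^ 2 + k₄ * (c * s) + k₅ * s ^ 2) ∧
      (c + s * Complex.I) * P.derivative.eval (c + s * Complex.I) =
        2 * P.eval (c + s * Complex.I) - Complex.I * (c + s * Complex.I) ^ 2 *
        (-k₁ * s + k₂ * c - 2 * k₃ * (c * s) + k₄ * (c ^ 2 - s ^ 2) + 2 * k₅ * (c * s)) ∧
      c + s * Complex.I ≠ 0 := by
    intro c s hcs
    have hI := Complex.I_sq
    obtain ⟨z, hz⟩ : ∃ z, z = c + s * Complex.I := ⟨_, rfl⟩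
    obtain ⟨w, hw⟩ : ∃ w, w = c - s * Complex.I := ⟨_, rfl⟩
    have hzw : z * w = 1 := by
      rw [hz, hw]; linear_combination hcs - s ^ 2 * hI
    have hc : c = (z + w) / 2 := by rw [hz, hw]; ring
    have hs : s = -Complex.I * (z - w) / 2 := by
      rw [hz, hw]; linear_combination s * hI
    rw [← hz, hc, hs]
    refine ⟨?_, ?_, left_ne_zero_of_mul_eq_one hzw⟩
    · simp only [P, eval_add, eval_sub, eval_mul, eval_C, eval_pow, eval_X]
      linear_combination (-k₁ * z / 2 - k₂ * Complex.I / 2 * z - k₃ / 4 * (2 * z ^ 2 + 1 + z * w) -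
        k₄ * Complex.I / 4 * (z * w + 1) - k₅ / 4 * (2 * z ^ 2 - 1 - z * w)) * hzw -
        k₅ / 4 * (z ^ 2 - z * w) ^ 2 * hI
    · simp only [P, eval_add, eval_sub, eval_mul, eval_C, eval_pow, eval_X, derivative_add,
        derivative_sub, derivative_mul, derivative_C, derivative_X_pow, derivative_X, eval_zero,
        eval_one, Nat.cast_ofNat]
      linear_combination (k₁ / 2 * z + Complex.I * k₂ / 2 * z + k₃ / 2 * (z * w + 1) +
        Complex.I / 2 * (z * w + 1) * k₄ - k₅ / 2 * (z * w + 1)) * hzw +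
        (k₁ / 2 * (z ^ 3 - z ^ 2 * w) + k₃ / 2 * (z ^ 4 - z ^ 2 * w ^ 2) -
        Complex.I / 4 * (z ^ 2 - z * w) ^ 2 * k₄ - k₅ / 2 * (z ^ 4 - z ^ 2 * w ^ 2)) * hI
  have key' : ∀ z : ℂ, z.re ^ 2 + z.im ^ 2 = 1 → _ := fun z hz =>
    key z.re z.im (by exact_mod_cast hz)
  simp only [Complex.re_add_im] at key'
  have hroot : ∀ z ∈ S, P.IsRoot z := by
    intro z hzS
    have h1 := (key' z (hS1 z hzS)).1
    have h2 := congrArg (fun r : ℝ => (r : ℂ)) (hS z hzS)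
    push_cast at h2
    rw [h2, mul_zero] at h1
    exact h1
  have hroot' : ∀ z ∈ D, P.derivative.IsRoot z := by
    intro z hzD
    have hzS := hDS hzD
    obtain ⟨-, h1, h0⟩ := key' z (hS1 z hzS)
    have h2 := congrArg (fun r : ℝ => (r : ℂ)) (hD z hzD)
    push_cast at h2
    rw [h2, (hroot z hzS), mul_zero, mul_zero, sub_zero] at h1
    exact (mul_eq_zero.1 h1).resolve_left h0
  have hP : P = 0 := by
    by_contra hP
    have hle : S.val + D.val ≤ P.roots := by
      rw [Multiset.le_iff_count]
      intro a
      rw [Multiset.count_add, count_roots]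
      by_cases haS : a ∈ S
      · rw [Multiset.count_eq_one_of_mem S.nodup haS]
        by_cases haD : a ∈ D
        · rw [Multiset.count_eq_one_of_mem D.nodup haD]
          exact (one_lt_rootMultiplicity_iff_isRoot hP).2 ⟨hroot a haS, hroot' a haD⟩
        · rw [Multiset.count_eq_zero_of_notMem (by simpa using haD)]
          exact (rootMultiplicity_pos hP).2 (hroot a haS)
      · rw [Multiset.count_eq_zero_of_notMem (by simpa using haS),
          Multiset.count_eq_zero_of_notMem (by simpa using fun h => haS (hDS h))]
        exact Nat.zero_le _
    have h1 := Multiset.card_le_card hle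
    have h2 := P.card_roots'
    rw [Multiset.card_add] at h1
    simp only [Finset.card_val] at h1
    omega
  obtain ⟨h1, -, h0⟩ := key' z hz
  rw [hP, eval_zero] at h1
  have h2 := (mul_eq_zero.1 h1.symm).resolve_left (pow_ne_zero 2 h0)
  exact_mod_cast h2

/-- `E` is the ellipse with center `o` and conjugate half-diameters `a` and `b`. -/
structure EllipseParam (E : Set E3) (o a b : E3) : Prop where
  mem_iff : ∀ x, x ∈ E ↔ ∃ s t : ℝ, s ^ 2 + t ^ 2 = 1 ∧ x = o + s • a + t • b
  indep : ∀ s t : ℝ, s • a + t • b = 0 → s = 0 ∧ t = 0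

lemma IsEllipse.exists_param {E : Set E3} (hE : IsEllipse E) : ∃ o a b, EllipseParam E o a b := by
  obtain ⟨f, rfl⟩ := hE
  have hf : ∀ x, f x = f 0 + f.linear x := by
    intro x
    have := f.map_vadd 0 x
    simpa [add_comm] using this
  refine ⟨f 0, f.linear !₂[1, 0, 0], f.linear !₂[0, 1, 0], fun x => ⟨?_, ?_⟩, ?_⟩
  · rintro ⟨y, ⟨h1, h2⟩, rfl⟩
    refine ⟨y 0, y 1, h1, ?_⟩
    rw [hf, add_assoc, ← map_smul, ← map_smul, ← map_add]
    congr 2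
    ext i
    fin_cases i <;> simp [h2]
  · rintro ⟨s, t, h, rfl⟩
    refine ⟨!₂[s, t, 0], ⟨by simpa using h, by simp⟩, ?_⟩
    rw [hf, add_assoc, ← map_smul, ← map_smul, ← map_add]
    congr 2
    ext i
    fin_cases i <;> simp
  · intro s t h
    rw [← map_smul, ← map_smul, ← map_add, LinearEquiv.map_eq_zero_iff] at h
    have h0 := congrArg (fun v : E3 => v 0) h
    have h1 := congrArg (fun v : E3 => v 1) h
    simp at h0 h1
    exact ⟨h0, h1⟩

namespace EllipseParam

variable {E : Set E3} {o a b : E3}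

lemma coeff_injective (h : EllipseParam E o a b) {s t s' t' : ℝ}
    (he : o + s • a + t • b = o + s' • a + t' • b) : s = s' ∧ t = t' := by
  have := h.indep (s - s') (t - t') (by
    rw [← sub_eq_zero] at he
    rw [← he]
    module)
  exact ⟨sub_eq_zero.1 this.1, sub_eq_zero.1 this.2⟩

/-- The tangent vector of an ellipse at a point is parallel to every support plane there. -/
lemma inner_tangent (h : EllipseParam E o a b) {s t : ℝ} (hst : s ^ 2 + t ^ 2 = 1) {N : E3}
    (hN : ∀ y ∈ E, ⟪N, y⟫ ≤ ⟪N, o + s • a + t • b⟫) : ⟪N, s • b - t • a⟫ = 0 := by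
  have key : ∀ s' t' : ℝ, s' ^ 2 + t' ^ 2 = 1 →
      s' * ⟪N, a⟫ + t' * ⟪N, b⟫ ≤ s * ⟪N, a⟫ + t * ⟪N, b⟫ := by
    intro s' t' h'
    have := hN _ ((h.mem_iff _).2 ⟨s', t', h', rfl⟩)
    simp only [inner_add_right, real_inner_smul_right] at this
    linarith
  rw [inner_sub_right, real_inner_smul_right, real_inner_smul_right]
  generalize (⟪N, a⟫ : ℝ) = A at *
  generalize (⟪N, b⟫ : ℝ) = B at *
  set R := Real.sqrt (A ^ 2 + B ^ 2) with hR
  have hR2 : R ^ 2 = A ^ 2 + B ^ 2 := Real.sq_sqrt (by positivity)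
  by_cases h0 : R = 0
  · have hA : A = 0 := by nlinarith [sq_nonneg A, sq_nonneg B]
    have hB : B = 0 := by nlinarith [sq_nonneg A, sq_nonneg B]
    simp [hA, hB]
  · have hpos : 0 < R := lt_of_le_of_ne (Real.sqrt_nonneg _) (Ne.symm h0)
    have h1 := key (A / R) (B / R) (by field_simp; linarith)
    have h2 : A / R * A + B / R * B = R := by field_simp; linarith
    rw [h2] at h1
    have h3 : (s * A + t * B) ^ 2 + (s * B - t * A) ^ 2 = R ^ 2 := by
      rw [hR2]; linear_combination (A ^ 2 + B ^ 2) * hst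
    have h4 : (s * B - t * A) ^ 2 ≤ 0 := by nlinarith
    exact pow_eq_zero_iff two_ne_zero |>.1 (le_antisymm h4 (sq_nonneg _))

lemma quadDeriv_tangent (h : EllipseParam E o a b) {c : Fin 10 → ℝ} (hc : ∀ x ∈ E, quad c x = 0)
    {s t : ℝ} :
    quadDeriv c (o + s • a + t • b) (s • b - t • a) = 0 := by
  have key : ∀ s t : ℝ, s ^ 2 + t ^ 2 = 1 → _ := fun s t h' =>
    (quad_add_smul_add_smul c o a b s t).symm.trans (hc _ ((h.mem_iff _).2 ⟨s, t, h', rfl⟩))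
  have e1 := key 1 0 (by norm_num)
  have e2 := key (-1) 0 (by norm_num)
  have e3 := key 0 1 (by norm_num)
  have e4 := key 0 (-1) (by norm_num)
  have e5 := key (3 / 5) (4 / 5) (by norm_num)
  rw [quadDeriv_add_smul_add_smul]
  generalize quad c o = k₀ at *
  generalize quadDeriv c o a = k₁ at *
  generalize quadDeriv c o b = k₂ at *
  generalize quadPolar c a a / 2 = k₃ at *
  generalize quadPolar c a b = k₄ at *
  generalize quadPolar c b b / 2 = k₅ at *
  have f1 : k₁ = 0 := by linarith
  have f2 : k₂ = 0 := by linarith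
  have f3 : k₅ = k₃ := by linarith
  have f4 : k₄ = 0 := by linarith
  rw [f1, f2, f3, f4]
  ring

/-- A quadric meeting an ellipse in five points, counted with multiplicity, contains it. -/
lemma quad_eq_zero (h : EllipseParam E o a b) {c : Fin 10 → ℝ} {S D : Finset E3} (hDS : D ⊆ S)
    (hSE : ∀ x ∈ S, x ∈ E) (hS : ∀ x ∈ S, quad c x = 0)
    (hD : ∀ x ∈ D, ∃ N : E3, (∀ y ∈ E, ⟪N, y⟫ ≤ ⟪N, x⟫) ∧ ∀ v, ⟪N, v⟫ = 0 → quadDeriv c x v = 0)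
    (hcard : 5 ≤ S.card + D.card) : ∀ x ∈ E, quad c x = 0 := by
  classical
  choose! s t hst hx using fun x => (h.mem_iff x).1
  let g : E3 → ℂ := fun x => ⟨s x, t x⟩
  have hg : Set.InjOn g E := by
    intro x hxE y hyE hxy
    have h1 : s x = s y := congrArg Complex.re hxy
    have h2 : t x = t y := congrArg Complex.im hxy
    rw [hx x hxE, hx y hyE, h1, h2]
  have hgS : Set.InjOn g S := hg.mono fun x hx => hSE x hx
  have hgD : Set.InjOn g D := hgS.mono fun x hx => hDS hx
  have key := trigPoly_eq_zero (quad c o) (quadDeriv c o a) (quadDeriv c o b)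
    (quadPolar c a a / 2) (quadPolar c a b) (quadPolar c b b / 2)
    (S := S.image g) (D := D.image g) (Finset.image_subset_image hDS) ?_ ?_ ?_
    (by rwa [Finset.card_image_of_injOn hgS, Finset.card_image_of_injOn hgD])
  · intro x hxE
    rw [hx x hxE, quad_add_smul_add_smul]
    exact key (g x) (hst x hxE)
  · intro z hz
    obtain ⟨x, hxS, rfl⟩ := Finset.mem_image.1 hz
    exact hst x (hSE x hxS)
  · intro z hz
    obtain ⟨x, hxS, rfl⟩ := Finset.mem_image.1 hz
    have := hS x hxS
    rw [hx x (hSE x hxS), quad_add_smul_add_smul] at this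
    exact this
  · intro z hz
    obtain ⟨x, hxD, rfl⟩ := Finset.mem_image.1 hz
    have hxE := hSE x (hDS hxD)
    obtain ⟨N, hN, hv⟩ := hD x hxD
    have h1 := hv (s x • b - t x • a) (h.inner_tangent (hst x hxE) (by rwa [← hx x hxE]))
    nth_rewrite 1 [hx x hxE] at h1
    rw [quadDeriv_add_smul_add_smul] at h1
    exact h1

lemma infinite_inter_nhds (h : EllipseParam E o a b) {x : E3} (hxE : x ∈ E) {U : Set E3}
    (hU : U ∈ nhds x) : (E ∩ U).Infinite := by
  obtain ⟨s, t, hst, rfl⟩ := (h.mem_iff x).1 hxE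
  let f : ℝ → E3 := fun θ => o + (s * Real.cos θ - t * Real.sin θ) • a +
    (t * Real.cos θ + s * Real.sin θ) • b
  have hf : Continuous f := by fun_prop
  have hf0 : f 0 = o + s • a + t • b := by simp [f]
  have hU' : f ⁻¹' U ∈ nhds 0 := hf.continuousAt.preimage_mem_nhds (by rwa [hf0])
  obtain ⟨ε, hε, hball⟩ := Metric.mem_nhds_iff.1 hU'
  have hinj : Set.InjOn f (Set.Ioo 0 (min ε Real.pi)) := by
    intro θ hθ φ hφ hfe
    obtain ⟨h1, h2⟩ := h.coeff_injective hfe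
    apply Real.injOn_cos
    · exact ⟨hθ.1.le, hθ.2.le.trans (min_le_right _ _)⟩
    · exact ⟨hφ.1.le, hφ.2.le.trans (min_le_right _ _)⟩
    · linear_combination s * h1 + t * h2 - (Real.cos θ - Real.cos φ) * hst
  have hinf := (Set.Ioo_infinite (lt_min hε Real.pi_pos)).image hinj
  refine hinf.mono ?_
  rintro _ ⟨θ, hθ, rfl⟩
  refine ⟨(h.mem_iff _).2 ⟨_, _, ?_, rfl⟩, hball ?_⟩
  · linear_combination (Real.cos θ ^ 2 + Real.sin θ ^ 2) * hst + Real.cos_sq_add_sin_sq θ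
  · rw [Metric.mem_ball, Real.dist_eq, sub_zero, abs_of_pos hθ.1]
    exact hθ.2.trans_le (min_le_left _ _)

lemma nonempty (h : EllipseParam E o a b) : E.Nonempty :=
  ⟨o + (1 : ℝ) • a + (0 : ℝ) • b, (h.mem_iff _).2 ⟨1, 0, by norm_num, rfl⟩⟩

lemma infinite (h : EllipseParam E o a b) : E.Infinite := by
  obtain ⟨x, hx⟩ := h.nonempty
  simpa using h.infinite_inter_nhds hx Filter.univ_mem

lemma two_smul_center_sub_mem (h : EllipseParam E o a b) {x : E3} (hx : x ∈ E) :
    (2 : ℝ) • o - x ∈ E := by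
  obtain ⟨s, t, hst, rfl⟩ := (h.mem_iff x).1 hx
  exact (h.mem_iff _).2 ⟨-s, -t, by linarith, by module⟩

end EllipseParam

/-- The cross product in `ℝ³`; its vanishing expresses linear dependence. -/
noncomputable def vcross (u v : E3) : E3 :=
  !₂[u 1 * v 2 - u 2 * v 1, u 2 * v 0 - u 0 * v 2, u 0 * v 1 - u 1 * v 0]

lemma inner_eq_coords (u v : E3) : ⟪u, v⟫ = u 0 * v 0 + u 1 * v 1 + u 2 * v 2 := by
  simp [PiLp.inner_apply, Fin.sum_univ_three, mul_comm]

lemma vcross_zero_coord (u v : E3) : vcross u v 0 = u 1 * v 2 - u 2 * v 1 := rfl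
lemma vcross_one_coord (u v : E3) : vcross u v 1 = u 2 * v 0 - u 0 * v 2 := rfl
lemma vcross_two_coord (u v : E3) : vcross u v 2 = u 0 * v 1 - u 1 * v 0 := rfl

lemma E3.ext_coords {u v : E3} (h0 : u 0 = v 0) (h1 : u 1 = v 1) (h2 : u 2 = v 2) : u = v := by
  ext i
  fin_cases i
  exacts [h0, h1, h2]

lemma continuous_vcross {X : Type*} [TopologicalSpace X] {f g : X → E3} (hf : Continuous f)
    (hg : Continuous g) : Continuous fun x => vcross (f x) (g x) := by
  have : Continuous fun x => WithLp.toLp 2 ![f x 1 * g x 2 - f x 2 * g x 1,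
      f x 2 * g x 0 - f x 0 * g x 2, f x 0 * g x 1 - f x 1 * g x 0] := by
    refine (PiLp.continuous_toLp 2 _).comp (continuous_pi fun i => ?_)
    fin_cases i <;> simp <;> fun_prop
  exact this

@[simp] lemma vcross_self (u : E3) : vcross u u = 0 := by
  apply E3.ext_coords <;> simp [vcross] <;> ring

lemma vcross_comm (u v : E3) : vcross u v = -vcross v u := by
  apply E3.ext_coords <;> simp [vcross] <;> ring

lemma vcross_ne_zero_symm {u v : E3} (h : vcross u v ≠ 0) : vcross v u ≠ 0 := by
  rwa [vcross_comm, neg_ne_zero]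

@[simp] lemma vcross_smul_left (s : ℝ) (u v : E3) : vcross (s • u) v = s • vcross u v := by
  apply E3.ext_coords <;> simp [vcross] <;> ring

@[simp] lemma vcross_smul_right (s : ℝ) (u v : E3) : vcross u (s • v) = s • vcross u v := by
  apply E3.ext_coords <;> simp [vcross] <;> ring

lemma vcross_add_right (u v w : E3) : vcross u (v + w) = vcross u v + vcross u w := by
  apply E3.ext_coords <;> simp [vcross] <;> ring

@[simp] lemma inner_vcross_self_left (u v : E3) : ⟪u, vcross u v⟫ = 0 := by
  rw [inner_eq_coords, vcross_zero_coord, vcross_one_coord, vcross_two_coord]; ring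

@[simp] lemma inner_vcross_self_right (u v : E3) : ⟪v, vcross u v⟫ = 0 := by
  rw [inner_eq_coords, vcross_zero_coord, vcross_one_coord, vcross_two_coord]; ring

lemma inner_vcross_cyclic (u v w : E3) : ⟪vcross u v, w⟫ = ⟪u, vcross v w⟫ := by
  simp only [inner_eq_coords, vcross_zero_coord, vcross_one_coord, vcross_two_coord]; ring

lemma inner_vcross_vcross (u v : E3) :
    ⟪vcross u v, vcross u v⟫ = ⟪u, u⟫ * ⟪v, v⟫ - ⟪u, v⟫ ^ 2 := by
  simp only [inner_eq_coords, vcross_zero_coord, vcross_one_coord, vcross_two_coord]; ring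

lemma eq_smul_vcross {n m e : E3} (h : vcross n m ≠ 0) (hn : ⟪n, e⟫ = 0) (hm : ⟪m, e⟫ = 0) :
    e = (⟪vcross n m, e⟫ / ⟪vcross n m, vcross n m⟫) • vcross n m := by
  have hpos : ⟪vcross n m, vcross n m⟫ ≠ 0 := (real_inner_self_pos.2 h).ne'
  rw [div_eq_inv_mul, mul_smul, eq_inv_smul_iff₀ hpos]
  rw [inner_eq_coords] at hn hm
  apply E3.ext_coords <;>
    simp only [PiLp.smul_apply, smul_eq_mul, inner_eq_coords, vcross_zero_coord, vcross_one_coord,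
      vcross_two_coord]
  · linear_combination
      (m 1 * (n 0 * m 1 - n 1 * m 0) - m 2 * (n 2 * m 0 - n 0 * m 2)) * hn -
      (n 1 * (n 0 * m 1 - n 1 * m 0) - n 2 * (n 2 * m 0 - n 0 * m 2)) * hm
  · linear_combination
      (m 2 * (n 1 * m 2 - n 2 * m 1) - m 0 * (n 0 * m 1 - n 1 * m 0)) * hn -
      (n 2 * (n 1 * m 2 - n 2 * m 1) - n 0 * (n 0 * m 1 - n 1 * m 0)) * hm
  · linear_combination
      (m 0 * (n 2 * m 0 - n 0 * m 2) - m 1 * (n 1 * m 2 - n 2 * m 1)) * hn -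
      (n 0 * (n 2 * m 0 - n 0 * m 2) - n 1 * (n 1 * m 2 - n 2 * m 1)) * hm

lemma exists_eq_smul_add_smul {a b x : E3} (h : vcross a b ≠ 0) (hx : ⟪vcross a b, x⟫ = 0) :
    ∃ s t : ℝ, x = s • a + t • b := by
  have hpos : ⟪vcross a b, vcross a b⟫ ≠ 0 := (real_inner_self_pos.2 h).ne'
  refine ⟨⟪vcross a b, vcross a b⟫⁻¹ * ⟪vcross b (vcross a b), x⟫,
    ⟪vcross a b, vcross a b⟫⁻¹ * ⟪vcross (vcross a b) a, x⟫, ?_⟩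
  rw [mul_smul, mul_smul, ← smul_add, eq_inv_smul_iff₀ hpos]
  rw [inner_eq_coords] at hx
  simp only [vcross_zero_coord, vcross_one_coord, vcross_two_coord] at hx
  apply E3.ext_coords <;>
    simp only [PiLp.smul_apply, PiLp.add_apply, smul_eq_mul, inner_eq_coords, vcross_zero_coord,
      vcross_one_coord, vcross_two_coord]
  · linear_combination (a 1 * b 2 - a 2 * b 1) * hx
  · linear_combination (a 2 * b 0 - a 0 * b 2) * hx
  · linear_combination (a 0 * b 1 - a 1 * b 0) * hx

lemma exists_eq_smul_of_vcross_eq_zero {a b : E3} (ha : a ≠ 0) (h : vcross a b = 0) :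
    ∃ s : ℝ, b = s • a := by
  have hpos : ⟪a, a⟫ ≠ 0 := (real_inner_self_pos.2 ha).ne'
  refine ⟨⟪a, a⟫⁻¹ * ⟪a, b⟫, ?_⟩
  rw [mul_smul, eq_inv_smul_iff₀ hpos]
  have h0 : a 1 * b 2 - a 2 * b 1 = 0 := congrArg (fun v : E3 => v 0) h
  have h1 : a 2 * b 0 - a 0 * b 2 = 0 := congrArg (fun v : E3 => v 1) h
  have h2 : a 0 * b 1 - a 1 * b 0 = 0 := congrArg (fun v : E3 => v 2) h
  apply E3.ext_coords <;> simp only [PiLp.smul_apply, smul_eq_mul, inner_eq_coords]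
  · linear_combination a 2 * h1 - a 1 * h2
  · linear_combination a 0 * h2 - a 2 * h0
  · linear_combination a 1 * h0 - a 0 * h1

/-- Two vectors spanning the plane orthogonal to `N`. -/
lemma exists_eq_smul_add_smul_of_orthogonal {N a b v : E3} (hN : N ≠ 0) (h : vcross a b ≠ 0)
    (ha : ⟪N, a⟫ = 0) (hb : ⟪N, b⟫ = 0) (hv : ⟪N, v⟫ = 0) : ∃ s t : ℝ, v = s • a + t • b := by
  apply exists_eq_smul_add_smul h
  have e := eq_smul_vcross h (e := N) (by rwa [real_inner_comm]) (by rwa [real_inner_comm])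
  have hc : ⟪vcross a b, N⟫ / ⟪vcross a b, vcross a b⟫ ≠ 0 := by
    intro h0
    rw [h0, zero_smul] at e
    exact hN e
  rw [e, real_inner_smul_left] at hv
  exact (mul_eq_zero.1 hv).resolve_left hc

/-- A smooth strictly convex body `K` with outer unit normal `η` and antipodal map `A`, having
two elliptic sections through each diametral line. -/
structure DiametralBody (K : Set E3) (η A : E3 → E3) : Prop where
  body : IsConvexBody K
  smooth : IsSmoothBody K
  strict : IsStrictlyConvexBody K
  normal : IsOuterNormal K η
  antipode_mem : ∀ p ∈ frontier K, A p ∈ frontier K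
  antipode_ne : ∀ p ∈ frontier K, A p ≠ p
  normal_antipode : ∀ p ∈ frontier K, η (A p) = -η p
  elliptic : ∀ p ∈ frontier K, ∃ n₁ n₂ : E3, ‖n₁‖ = 1 ∧ ‖n₂‖ = 1 ∧
    vcross n₁ n₂ ≠ 0 ∧ ⟪n₁, p - A p⟫ = 0 ∧ ⟪n₂, p - A p⟫ = 0 ∧
    IsEllipse (frontier K ∩ {x | ⟪n₁, x⟫ = ⟪n₁, p⟫}) ∧
    IsEllipse (frontier K ∩ {x | ⟪n₂, x⟫ = ⟪n₂, p⟫})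

lemma inner_lt_of_mem_interior {K : Set E3} {N y : E3} {m : ℝ} (hN : N ≠ 0)
    (hK : ∀ x ∈ K, ⟪N, x⟫ ≤ m) (hy : y ∈ interior K) : ⟪N, y⟫ < m := by
  have hc : Filter.Tendsto (fun t : ℝ => y + t • N) (nhds 0) (nhds y) := by
    have : Continuous fun t : ℝ => y + t • N := by fun_prop
    simpa using this.tendsto 0
  have h1 := hc.eventually (mem_interior_iff_mem_nhds.1 hy)
  obtain ⟨t, ht, ht0⟩ := ((h1.filter_mono nhdsWithin_le_nhds).and
    (self_mem_nhdsWithin : Set.Ioi (0 : ℝ) ∈ nhdsWithin 0 (Set.Ioi 0))).exists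
  have h2 := hK _ ht
  rw [inner_add_right, real_inner_smul_right] at h2
  have h3 : 0 < t * ⟪N, N⟫ := mul_pos ht0 (real_inner_self_pos.2 hN)
  linarith

/-- The point where the ray from `o` in direction `v` leaves `K`. -/
noncomputable def radial (K : Set E3) (o v : E3) : E3 :=
  o + (gauge {x | o + x ∈ K} v)⁻¹ • v

namespace DiametralBody

variable {K : Set E3} {η A : E3 → E3}

lemma frontier_subset (h : DiametralBody K η A) : frontier K ⊆ K :=
  h.body.1.isClosed.frontier_subset

lemma isCompact_frontier (h : DiametralBody K η A) : IsCompact (frontier K) :=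
  h.body.1.of_isClosed_subset isClosed_frontier h.frontier_subset

lemma normal_ne_zero (h : DiametralBody K η A) {p : E3} (hp : p ∈ frontier K) : η p ≠ 0 := by
  intro h0
  have := (h.normal p hp).1
  simp [h0] at this

lemma inner_lt_of_interior (h : DiametralBody K η A) {p y : E3} (hp : p ∈ frontier K)
    (hy : y ∈ interior K) : ⟪η p, y⟫ < ⟪η p, p⟫ :=
  inner_lt_of_mem_interior (h.normal_ne_zero hp) (h.normal p hp).2 hy

lemma notMem_interior {p : E3} (hp : p ∈ frontier K) : p ∉ interior K := hp.2

lemma mem_frontier (h : DiametralBody K η A) {p : E3} (hp : p ∈ K) (hp' : p ∉ interior K) :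
    p ∈ frontier K := by
  rw [h.body.1.isClosed.frontier_eq]
  exact ⟨hp, hp'⟩

lemma strictConvex (h : DiametralBody K η A) : StrictConvex ℝ K := by
  rw [strictConvex_iff_openSegment_subset]
  intro x hx y hy hxy z hz
  by_contra hzi
  have hzK : z ∈ K := h.body.2.1.openSegment_subset hx hy hz
  have hzf := h.mem_frontier hzK hzi
  obtain ⟨a, b, ha, hb, hab, rfl⟩ := hz
  obtain ⟨-, hle⟩ := h.normal _ hzf
  set N := η (a • x + b • y)
  have hx1 := hle x hx
  have hy1 := hle y hy
  have e : ⟪N, a • x + b • y⟫ = a * ⟪N, x⟫ + b * ⟪N, y⟫ := by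
    rw [inner_add_right, real_inner_smul_right, real_inner_smul_right]
  have e' : a * (⟪N, a • x + b • y⟫ - ⟪N, x⟫) + b * (⟪N, a • x + b • y⟫ - ⟪N, y⟫) = 0 := by
    linear_combination ⟪N, a • x + b • y⟫ * hab + e
  have hx3 := mul_nonneg ha.le (sub_nonneg.2 hx1)
  have hy3 := mul_nonneg hb.le (sub_nonneg.2 hy1)
  have hx2 : ⟪N, x⟫ = ⟪N, a • x + b • y⟫ := by
    have := (mul_eq_zero.1 (le_antisymm (by linarith) hx3)).resolve_left ha.ne'
    linarith
  have hy2 : ⟪N, y⟫ = ⟪N, a • x + b • y⟫ := by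
    have := (mul_eq_zero.1 (le_antisymm (by linarith) hy3)).resolve_left hb.ne'
    linarith
  have hseg : segment ℝ x y ⊆ frontier K := by
    intro w hw
    refine h.mem_frontier (h.body.2.1.segment_subset hx hy hw) fun hwi => ?_
    have h1 := h.inner_lt_of_interior hzf hwi
    obtain ⟨s, t, hs, ht, hst, rfl⟩ := hw
    rw [inner_add_right, real_inner_smul_right, real_inner_smul_right] at h1
    change s * ⟪N, x⟫ + t * ⟪N, y⟫ < ⟪N, a • x + b • y⟫ at h1
    rw [hx2, hy2, ← add_mul, hst, one_mul] at h1
    exact lt_irrefl _ h1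
  exact h.strict x (hseg (left_mem_segment ℝ x y)) y (hseg (right_mem_segment ℝ x y)) hxy hseg

lemma add_smul_mem_interior (h : DiametralBody K η A) {p q : E3} (hp : p ∈ K) (hq : q ∈ K)
    (hpq : p ≠ q) {s : ℝ} (hs0 : 0 < s) (hs1 : s < 1) : p + s • (q - p) ∈ interior K := by
  have := h.strictConvex hp hq hpq (show 0 < 1 - s by linarith) hs0 (by ring)
  convert this using 1
  module

lemma eq_of_inner_eq (h : DiametralBody K η A) {p y : E3} (hp : p ∈ frontier K) (hy : y ∈ K)
    (he : ⟪η p, p⟫ ≤ ⟪η p, y⟫) : y = p := by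
  by_contra hne
  have h1 := h.inner_lt_of_interior hp (h.add_smul_mem_interior (h.frontier_subset hp) hy
    (Ne.symm hne) (show (0 : ℝ) < 1 / 2 by norm_num) (by norm_num))
  rw [inner_add_right, real_inner_smul_right, inner_sub_right] at h1
  linarith

lemma inner_lt_of_ne (h : DiametralBody K η A) {p y : E3} (hp : p ∈ frontier K) (hy : y ∈ K)
    (hne : y ≠ p) : ⟪η p, y⟫ < ⟪η p, p⟫ :=
  lt_of_not_ge fun he => hne (h.eq_of_inner_eq hp hy he)

lemma normal_injOn (h : DiametralBody K η A) {p q : E3} (hp : p ∈ frontier K)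
    (hq : q ∈ frontier K) (he : η p = η q) : p = q := by
  apply h.eq_of_inner_eq hq (h.frontier_subset hp)
  rw [← he]
  exact (h.normal p hp).2 q (h.frontier_subset hq)

lemma antipode_antipode (h : DiametralBody K η A) {p : E3} (hp : p ∈ frontier K) :
    A (A p) = p := by
  have h1 := h.antipode_mem p hp
  apply h.normal_injOn (h.antipode_mem _ h1) hp
  rw [h.normal_antipode _ h1, h.normal_antipode _ hp, neg_neg]

lemma inner_antipode_lt (h : DiametralBody K η A) {p y : E3} (hp : p ∈ frontier K) (hy : y ∈ K)
    (hne : y ≠ A p) : ⟪η p, A p⟫ < ⟪η p, y⟫ := by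
  have := h.inner_lt_of_ne (h.antipode_mem p hp) hy hne
  rw [h.normal_antipode p hp, inner_neg_left, inner_neg_left] at this
  linarith

lemma diam_ne_zero (h : DiametralBody K η A) {p : E3} (hp : p ∈ frontier K) : p - A p ≠ 0 :=
  sub_ne_zero.2 (h.antipode_ne p hp).symm

lemma midpoint_mem_interior (h : DiametralBody K η A) {p : E3} (hp : p ∈ frontier K) :
    p + (1 / 2 : ℝ) • (A p - p) ∈ interior K :=
  h.add_smul_mem_interior (h.frontier_subset hp) (h.frontier_subset (h.antipode_mem p hp))
    (h.antipode_ne p hp).symm (by norm_num) (by norm_num)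

lemma continuousOn_normal (h : DiametralBody K η A) : ContinuousOn η (frontier K) := by
  intro p hp
  refine (isCompact_sphere (0 : E3) 1).tendsto_nhds_of_unique_mapClusterPt ?_ ?_
  · filter_upwards [self_mem_nhdsWithin] with q hq
    simpa using (h.normal q hq).1
  · intro n hn hcl
    obtain ⟨U, hU, hUn⟩ := mapClusterPt_iff_ultrafilter.1 hcl
    have hUp : Filter.Tendsto id (U : Filter E3) (nhds p) := fun s hs => hU (nhdsWithin_le_nhds hs)
    refine (h.smooth p hp).unique ⟨by simpa using hn, fun x hx => ?_⟩ (h.normal p hp)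
    refine le_of_tendsto_of_tendsto (hUn.inner (tendsto_const_nhds (x := x))) (hUn.inner hUp) ?_
    filter_upwards [hU self_mem_nhdsWithin] with q hq
    exact (h.normal q hq).2 x hx

lemma continuousOn_antipode (h : DiametralBody K η A) : ContinuousOn A (frontier K) := by
  intro p hp
  refine h.isCompact_frontier.tendsto_nhds_of_unique_mapClusterPt ?_ ?_
  · filter_upwards [self_mem_nhdsWithin] with q hq using h.antipode_mem q hq
  · intro y hy hcl
    obtain ⟨U, hU, hUn⟩ := mapClusterPt_iff_ultrafilter.1 hcl
    have hη : Filter.Tendsto η (U : Filter E3) (nhds (η p)) :=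
      (h.continuousOn_normal p hp).mono_left hU
    by_contra hne
    have h1 := h.inner_antipode_lt hp (h.frontier_subset hy) hne
    refine absurd h1 (not_lt.2 ?_)
    refine le_of_tendsto_of_tendsto (hη.inner hUn) (hη.inner (tendsto_const_nhds (x := A p))) ?_
    filter_upwards [hU self_mem_nhdsWithin] with q hq
    by_cases he : A p = A q
    · rw [he]
    · exact (h.inner_antipode_lt hq (h.frontier_subset (h.antipode_mem p hp)) he).le

lemma isConnected_frontier (h : DiametralBody K η A) : IsConnected (frontier K) := by
  obtain ⟨e, -, -, he⟩ := exists_homeomorph_image_interior_closure_frontier_eq_unitBall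
    h.body.2.1 h.body.2.2 h.body.1.isBounded
  rw [← e.isConnected_image, he]
  apply isConnected_sphere _ _ zero_le_one
  rw [← Module.finrank_eq_rank]
  simp [E3]

section Radial

variable {o : E3}

lemma convex_translate (h : DiametralBody K η A) : Convex ℝ {x | o + x ∈ K} :=
  h.body.2.1.translate_preimage_right o

lemma translate_mem_nhds (ho : o ∈ interior K) : {x | o + x ∈ K} ∈ nhds (0 : E3) := by
  have : Filter.Tendsto (fun x : E3 => o + x) (nhds 0) (nhds o) := by
    have : Continuous fun x : E3 => o + x := by fun_prop
    simpa using this.tendsto 0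
  exact this (mem_interior_iff_mem_nhds.1 ho)

lemma mem_frontier_translate {x : E3} : x ∈ frontier {x | o + x ∈ K} ↔ o + x ∈ frontier K := by
  have := (Homeomorph.addLeft o).preimage_frontier K
  exact (Set.ext_iff.1 this x).symm

lemma gauge_pos (h : DiametralBody K η A) (ho : o ∈ interior K) {v : E3} (hv : v ≠ 0) :
    0 < gauge {x | o + x ∈ K} v := by
  rw [_root_.gauge_pos (absorbent_nhds_zero (translate_mem_nhds ho))]
  · exact hv
  · rw [NormedSpace.isVonNBounded_iff]
    have := h.body.1.isBounded.vadd (-o)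
    refine this.subset fun x hx => ⟨o + x, hx, by simp⟩

lemma radial_mem (h : DiametralBody K η A) (ho : o ∈ interior K) {v : E3} (hv : v ≠ 0) :
    radial K o v ∈ frontier K := by
  have hg := h.gauge_pos ho hv
  apply mem_frontier_translate.1
  rw [← gauge_eq_one_iff_mem_frontier h.convex_translate (translate_mem_nhds ho),
    gauge_smul_of_nonneg (inv_nonneg.2 hg.le), smul_eq_mul, inv_mul_cancel₀ hg.ne']

lemma radial_eq (h : DiametralBody K η A) (ho : o ∈ interior K) {v : E3} {t : ℝ}
    (ht : 0 < t) (hmem : o + t • v ∈ frontier K) : radial K o v = o + t • v := by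
  have h1 := (gauge_eq_one_iff_mem_frontier h.convex_translate (translate_mem_nhds ho)).2
    (mem_frontier_translate.2 hmem)
  rw [gauge_smul_of_nonneg ht.le, smul_eq_mul] at h1
  rw [radial, inv_eq_of_mul_eq_one_left h1]

lemma continuousAt_radial (h : DiametralBody K η A) (ho : o ∈ interior K) {v : E3} (hv : v ≠ 0) :
    ContinuousAt (radial K o) v := by
  have h1 := continuous_gauge h.convex_translate (translate_mem_nhds ho)
  exact continuousAt_const.add ((h1.continuousAt.inv₀ (h.gauge_pos ho hv).ne').smul continuousAt_id)

lemma exists_pos_mem_frontier (h : DiametralBody K η A) (ho : o ∈ interior K) {v : E3}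
    (hv : v ≠ 0) : ∃ t : ℝ, 0 < t ∧ o + t • v ∈ frontier K :=
  ⟨_, inv_pos.2 (h.gauge_pos ho hv), h.radial_mem ho hv⟩

lemma exists_neg_mem_frontier (h : DiametralBody K η A) (ho : o ∈ interior K) {v : E3}
    (hv : v ≠ 0) : ∃ t : ℝ, t < 0 ∧ o + t • v ∈ frontier K := by
  obtain ⟨t, ht, hm⟩ := h.exists_pos_mem_frontier ho (neg_ne_zero.2 hv)
  exact ⟨-t, by linarith, by simpa using hm⟩

end Radial

end DiametralBody

lemma exists_vcross_ne_zero {a : E3} (ha : a ≠ 0) : ∃ w, vcross a w ≠ 0 := by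
  by_contra! H
  apply ha
  have h1 := H !₂[1, 0, 0]
  have h2 := H !₂[0, 1, 0]
  have e1 := congrArg (fun v : E3 => v 1) h1
  have e2 := congrArg (fun v : E3 => v 2) h1
  have e0 := congrArg (fun v : E3 => v 2) h2
  simp [vcross] at e0 e1 e2
  exact E3.ext_coords (by simpa using e0) (by simpa using e2) (by simpa using e1)

lemma pos_of_mutual_bounds {X Y α β : ℝ} (hα : |α| < 1) (hβ : |β| < 1)
    (h1 : 0 < X + (1 - Y) * α) (h2 : 0 < X - Y * α)
    (h3 : 0 < Y - X * β) (h4 : Y - X * β < 1) : 0 < X := by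
  by_contra! hX
  have key : ∀ Z : ℝ, -X < |Z| * |α| → |Z| ≤ |X| * |β| → False := by
    intro Z hZ1 hZ2
    rw [abs_of_nonpos hX] at hZ2
    nlinarith [abs_nonneg α, abs_nonneg β, abs_nonneg Z]
  rcases lt_trichotomy α 0 with hα0 | hα0 | hα0
  · have hY : 1 < Y := by nlinarith
    refine key (Y - 1) ?_ ?_
    · rw [abs_of_neg hα0, abs_of_pos (by linarith)]
      nlinarith
    · rw [← abs_mul, abs_of_pos (by linarith)]
      exact le_trans (by linarith) (le_abs_self _)
  · subst hα0
    linarith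
  · have hY : Y < 0 := by nlinarith
    refine key Y ?_ ?_
    · rw [abs_of_pos hα0, abs_of_neg hY]
      nlinarith
    · rw [← abs_mul, abs_of_neg hY]
      exact le_trans (by linarith) (neg_le_abs _)

namespace DiametralBody

variable {K : Set E3} {η A : E3 → E3}

lemma sub_antipode_antipode (h : DiametralBody K η A) {p : E3} (hp : p ∈ frontier K) :
    A p - A (A p) = -(p - A p) := by
  rw [h.antipode_antipode hp, neg_sub]

lemma width_pos (h : DiametralBody K η A) {p : E3} (hp : p ∈ frontier K) :
    0 < ⟪η p, p - A p⟫ := by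
  have := h.inner_lt_of_ne hp (h.frontier_subset (h.antipode_mem p hp)) (h.antipode_ne p hp)
  rw [inner_sub_right]
  linarith

lemma le_width (h : DiametralBody K η A) {p x y : E3} (hp : p ∈ frontier K) (hx : x ∈ K)
    (hy : y ∈ K) : ⟪η p, x - y⟫ ≤ ⟪η p, p - A p⟫ := by
  have h1 := (h.normal p hp).2 x hx
  have h2 := (h.normal _ (h.antipode_mem p hp)).2 y hy
  rw [h.normal_antipode p hp, inner_neg_left, inner_neg_left] at h2
  rw [inner_sub_right, inner_sub_right]
  linarith

lemma lt_width (h : DiametralBody K η A) {p x y : E3} (hp : p ∈ frontier K) (hx : x ∈ K)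
    (hy : y ∈ K) (hxp : x ≠ p) : ⟪η p, x - y⟫ < ⟪η p, p - A p⟫ := by
  have h1 := h.inner_lt_of_ne hp hx hxp
  have h2 := (h.normal _ (h.antipode_mem p hp)).2 y hy
  rw [h.normal_antipode p hp, inner_neg_left, inner_neg_left] at h2
  rw [inner_sub_right, inner_sub_right]
  linarith

lemma eq_of_diam_pos_parallel (h : DiametralBody K η A) {p q : E3} (hp : p ∈ frontier K)
    (hq : q ∈ frontier K) {s : ℝ} (hs : 0 < s) (he : q - A q = s • (p - A p)) : q = p := by
  have hp1 := h.width_pos hp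
  have hq1 := h.width_pos hq
  by_contra hne
  have h1 := h.lt_width hp (h.frontier_subset hq) (h.frontier_subset (h.antipode_mem q hq)) hne
  have h2 := h.le_width hq (h.frontier_subset hp) (h.frontier_subset (h.antipode_mem p hp))
  rw [he, real_inner_smul_right] at h1 h2 hq1
  have hs1 : s < 1 := by nlinarith
  nlinarith [pos_of_mul_pos_right hq1 hs.le]

lemma eq_or_eq_antipode_of_parallel (h : DiametralBody K η A) {p q : E3} (hp : p ∈ frontier K)
    (hq : q ∈ frontier K) (he : vcross (p - A p) (q - A q) = 0) : q = p ∨ q = A p := by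
  obtain ⟨s, hs⟩ := exists_eq_smul_of_vcross_eq_zero (h.diam_ne_zero hp) he
  rcases lt_trichotomy s 0 with h0 | h0 | h0
  · right
    have h1 := h.eq_of_diam_pos_parallel hp (h.antipode_mem q hq) (neg_pos.2 h0)
      (by rw [h.sub_antipode_antipode hq, hs, neg_smul])
    rw [← h1, h.antipode_antipode hq]
  · rw [h0, zero_smul] at hs
    exact absurd hs (h.diam_ne_zero hq)
  · exact Or.inl (h.eq_of_diam_pos_parallel hp hq h0 hs)

/-- Two coplanar diametral lines meet inside the body. -/
lemma exists_mem_interior_of_coplanar (h : DiametralBody K η A) {p q : E3} (hp : p ∈ frontier K)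
    (hq : q ∈ frontier K) (hqp : q ≠ p) (hqAp : q ≠ A p)
    (hcop : ⟪vcross (p - A p) (q - A q), q - p⟫ = 0) :
    ∃ o ∈ interior K, ∃ X Y : ℝ, o = A p + X • (p - A p) ∧ o = A q + Y • (q - A q) := by
  have hc : vcross (p - A p) (q - A q) ≠ 0 := fun h0 =>
    (h.eq_or_eq_antipode_of_parallel hp hq h0).elim hqp hqAp
  obtain ⟨s, t, hst⟩ := exists_eq_smul_add_smul hc hcop
  obtain ⟨X, hX⟩ : ∃ X, X = 1 + s := ⟨_, rfl⟩
  obtain ⟨Y, hY⟩ : ∃ Y, Y = 1 - t := ⟨_, rfl⟩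
  have hmeet : A p + X • (p - A p) = A q + Y • (q - A q) := by
    have : A p + X • (p - A p) - (A q + Y • (q - A q)) =
        s • (p - A p) + t • (q - A q) - (q - p) := by
      rw [hX, hY]; module
    rw [← sub_eq_zero, this, hst, sub_self]
  have hAp := h.antipode_mem p hp
  have hAq := h.antipode_mem q hq
  have hAqp : A q ≠ p := fun e => hqAp (by rw [← e, h.antipode_antipode hq])
  have hAqAp : A q ≠ A p := fun e => hqp (by
    rw [← h.antipode_antipode hq, e, h.antipode_antipode hp])
  have hp1 := h.width_pos hp
  have hq1 := h.width_pos hq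
  obtain ⟨α, hα⟩ : ∃ α, α = ⟪η p, q - A q⟫ / ⟪η p, p - A p⟫ := ⟨_, rfl⟩
  obtain ⟨β, hβ⟩ : ∃ β, β = ⟪η q, p - A p⟫ / ⟪η q, q - A q⟫ := ⟨_, rfl⟩
  have eα : ⟪η p, q - A q⟫ = α * ⟪η p, p - A p⟫ := by rw [hα]; field_simp
  have eβ : ⟪η q, p - A p⟫ = β * ⟪η q, q - A q⟫ := by rw [hβ]; field_simp
  have hmp := congrArg (fun x => (⟪η p, x⟫ : ℝ)) hmeet
  have hmq := congrArg (fun x => (⟪η q, x⟫ : ℝ)) hmeet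
  simp only [inner_add_right, real_inner_smul_right] at hmp hmq
  have u1 := h.inner_lt_of_ne hp (h.frontier_subset hq) hqp
  have u2 := h.inner_antipode_lt hp (h.frontier_subset hq) hqAp
  have u3 := h.inner_lt_of_ne hp (h.frontier_subset hAq) hAqp
  have u4 := h.inner_antipode_lt hp (h.frontier_subset hAq) hAqAp
  have v1 := h.inner_lt_of_ne hq (h.frontier_subset hp) hqp.symm
  have v2 := h.inner_antipode_lt hq (h.frontier_subset hp) hAqp.symm
  have v3 := h.inner_lt_of_ne hq (h.frontier_subset hAp) hqAp.symm
  have v4 := h.inner_antipode_lt hq (h.frontier_subset hAp) hAqAp.symm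
  rw [eα] at hmp
  rw [eβ] at hmq
  rw [inner_sub_right] at hp1 hq1 eα eβ
  obtain ⟨P, hP⟩ : ∃ P : ℝ, P = ⟪η p, p - A p⟫ := ⟨_, rfl⟩
  obtain ⟨Q, hQ⟩ : ∃ Q : ℝ, Q = ⟪η q, q - A q⟫ := ⟨_, rfl⟩
  rw [← hP] at hmp eα
  rw [← hQ] at hmq eβ
  rw [inner_sub_right] at hP hQ
  rw [← hP] at hp1
  rw [← hQ] at hq1
  have pos : ∀ {x c : ℝ}, 0 < c → 0 < x * c → 0 < x := fun hc hx => pos_of_mul_pos_left hx hc.le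
  have w1 : 0 < X + (1 - Y) * α := pos hp1 (by linarith)
  have w2 : X + (1 - Y) * α < 1 := by
    have : 0 < 1 - (X + (1 - Y) * α) := pos hp1 (by linarith)
    linarith
  have w3 : 0 < X - Y * α := pos hp1 (by linarith)
  have w4 : X - Y * α < 1 := by
    have : 0 < 1 - (X - Y * α) := pos hp1 (by linarith)
    linarith
  have z1 : 0 < Y + (1 - X) * β := pos hq1 (by linarith)
  have z2 : Y + (1 - X) * β < 1 := by
    have : 0 < 1 - (Y + (1 - X) * β) := pos hq1 (by linarith)
    linarith
  have z3 : 0 < Y - X * β := pos hq1 (by linarith)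
  have z4 : Y - X * β < 1 := by
    have : 0 < 1 - (Y - X * β) := pos hq1 (by linarith)
    linarith
  have hα1 : |α| < 1 := by rw [abs_lt]; constructor <;> linarith
  have hβ1 : |β| < 1 := by rw [abs_lt]; constructor <;> linarith
  have hX0 : 0 < X := pos_of_mutual_bounds hα1 hβ1 w1 w3 z3 z4
  have hX1 : 0 < 1 - X := pos_of_mutual_bounds (X := 1 - X) (Y := Y) (α := -α) (β := -β)
    (by rwa [abs_neg]) (by rwa [abs_neg]) (by linarith) (by linarith) (by linarith) (by linarith)
  exact ⟨_, h.add_smul_mem_interior (h.frontier_subset hAp) (h.frontier_subset hp)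
    (h.antipode_ne p hp) hX0 (by linarith), X, Y, rfl, hmeet⟩

lemma infinite_frontier (h : DiametralBody K η A) : (frontier K).Infinite := by
  obtain ⟨p, hp⟩ := h.isConnected_frontier.nonempty
  obtain ⟨n, -, -, -, -, -, -, hE, -⟩ := h.elliptic p hp
  obtain ⟨o, a, b, hE⟩ := hE.exists_param
  exact hE.infinite.mono Set.inter_subset_left

/-- Infinitely many diametral lines are coplanar with a given one. -/
lemma infinite_coplanar (h : DiametralBody K η A) {p : E3} :
    {q ∈ frontier K | ⟪vcross (p - A p) (q - A q), q - p⟫ = 0}.Infinite := by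
  set f : E3 → ℝ := fun q => ⟪vcross (p - A p) (q - A q), q - p⟫ with hf
  by_cases hall : ∀ r ∈ frontier K, f r = 0
  · exact h.infinite_frontier.mono fun r hr => ⟨hr, hall r hr⟩
  push Not at hall
  obtain ⟨r, hr, hfr⟩ := hall
  have hfA : f (A r) = -f r := by
    simp only [hf, h.sub_antipode_antipode hr]
    have e : A r - p = r - p - (r - A r) := by abel
    rw [e, ← neg_one_smul ℝ (r - A r), vcross_smul_right, real_inner_smul_left, inner_sub_right,
      real_inner_comm (r - A r), inner_vcross_self_right]
    ring
  have hfc : ContinuousOn f (frontier K) := by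
    have hA := h.continuousOn_antipode
    rw [continuousOn_iff_continuous_domRestrict] at hA ⊢
    have hA' : Continuous fun x : frontier K => A x := hA
    change Continuous fun x : frontier K => f x
    exact (continuous_vcross continuous_const (continuous_subtype_val.sub hA')).inner
      (continuous_subtype_val.sub continuous_const)
  obtain ⟨o, ho, hoi⟩ : ∃ o, o = r + (1 / 2 : ℝ) • (A r - r) ∧ o ∈ interior K :=
    ⟨_, rfl, h.midpoint_mem_interior hr⟩
  set a := r - A r with ha
  have ha0 : a ≠ 0 := h.diam_ne_zero hr
  obtain ⟨w₀, hw₀⟩ := exists_vcross_ne_zero ha0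
  set w₁ := vcross a w₀ with hw₁
  set m := vcross w₁ a with hm
  have m1 : ⟪m, a⟫ = 0 := by rw [real_inner_comm]; simp [hm]
  have m2 : ⟪m, w₁⟫ = 0 := by rw [real_inner_comm]; simp [hm]
  have m3 : ⟪m, w₀⟫ = ⟪w₁, w₁⟫ := by rw [hm, inner_vcross_cyclic]
  have l1 : ⟪w₁, a⟫ = 0 := by rw [real_inner_comm]; simp [hw₁]
  have l2 : ⟪w₁, w₀⟫ = 0 := by rw [real_inner_comm]; simp [hw₁]
  have hpos : 0 < ⟪w₁, w₁⟫ := real_inner_self_pos.2 hw₀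
  have key : ∀ k : ℕ, ∃ x ∈ frontier K, f x = 0 ∧ ⟪w₁, x - o⟫ = k * ⟪m, x - o⟫ ∧
      0 < ⟪m, x - o⟫ := by
    intro k
    let v : ℝ → E3 := fun θ => Real.cos θ • a + Real.sin θ • (w₀ + (k : ℝ) • w₁)
    have mv : ∀ θ, ⟪m, v θ⟫ = Real.sin θ * ⟪w₁, w₁⟫ := fun θ => by
      simp only [v, inner_add_right, real_inner_smul_right, m1, m2, m3]; ring
    have lv : ∀ θ, ⟪w₁, v θ⟫ = k * (Real.sin θ * ⟪w₁, w₁⟫) := fun θ => by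
      simp only [v, inner_add_right, real_inner_smul_right, l1, l2]; ring
    have hv : ∀ θ, v θ ≠ 0 := by
      intro θ h0
      have e := mv θ
      rw [h0, inner_zero_right] at e
      have hs : Real.sin θ = 0 := (mul_eq_zero.1 e.symm).resolve_right hpos.ne'
      simp only [v, hs, zero_smul, add_zero] at h0
      have hcos := (smul_eq_zero.1 h0).resolve_right ha0
      have := Real.sin_sq_add_cos_sq θ
      rw [hs, hcos] at this
      norm_num at this
    have hvc : Continuous v := by fun_prop
    have hγ : Continuous fun θ => radial K o (v θ) := continuous_iff_continuousAt.2 fun θ =>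
      (h.continuousAt_radial hoi (hv θ)).comp hvc.continuousAt
    have hγf : Continuous fun θ => f (radial K o (v θ)) :=
      hfc.comp_continuous hγ fun θ => h.radial_mem hoi (hv θ)
    have e0 : radial K o (v 0) = r := by
      have e : o + (1 / 2 : ℝ) • v 0 = r := by simp only [v, ho, ha]; simp; module
      rw [h.radial_eq hoi (t := 1 / 2) (by norm_num) (by rwa [e]), e]
    have eπ : radial K o (v Real.pi) = A r := by
      have e : o + (1 / 2 : ℝ) • v Real.pi = A r := by simp only [v, ho, ha]; simp; module
      rw [h.radial_eq hoi (t := 1 / 2) (by norm_num) (by rw [e]; exact h.antipode_mem r hr), e]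
    obtain ⟨θ, hθ, hfθ⟩ : ∃ θ ∈ Set.Icc 0 Real.pi, f (radial K o (v θ)) = 0 := by
      have hz : (0 : ℝ) ∈ Set.uIcc (f (radial K o (v 0))) (f (radial K o (v Real.pi))) := by
        rw [e0, eπ, hfA, Set.mem_uIcc]
        rcases le_total (f r) 0 with h0 | h0
        · left; constructor <;> linarith
        · right; constructor <;> linarith
      have := intermediate_value_uIcc (a := 0) (b := Real.pi) hγf.continuousOn hz
      rwa [Set.uIcc_of_le Real.pi_pos.le] at this
    have hθ0 : θ ≠ 0 := by rintro rfl; rw [e0] at hfθ; exact hfr hfθ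
    have hθπ : θ ≠ Real.pi := by rintro rfl; rw [eπ, hfA] at hfθ; exact hfr (by linarith)
    have hsin : 0 < Real.sin θ := Real.sin_pos_of_pos_of_lt_pi (hθ.1.lt_of_ne' hθ0)
      (hθ.2.lt_of_ne hθπ)
    have hg := inv_pos.2 (h.gauge_pos hoi (hv θ))
    refine ⟨_, h.radial_mem hoi (hv θ), hfθ, ?_, ?_⟩
    · simp only [radial, add_sub_cancel_left, real_inner_smul_right, mv, lv]
      ring
    · simp only [radial, add_sub_cancel_left, real_inner_smul_right, mv]
      positivity
  choose x hx1 hx2 hx3 hx4 using key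
  refine (Set.infinite_range_of_injective (f := x) ?_).mono ?_
  · intro i j hij
    have hi := hx3 i
    rw [hij, hx3 j] at hi
    exact_mod_cast (mul_right_cancel₀ (hx4 j).ne' hi).symm
  · rintro _ ⟨k, rfl⟩
    exact ⟨hx1 k, hx2 k⟩

end DiametralBody

/-- The plane through `o` with unit normal `n` meets the boundary of `K` in an ellipse. -/
structure IsEllipticNormal (K : Set E3) (o n : E3) : Prop where
  norm_eq : ‖n‖ = 1
  isEllipse : IsEllipse (frontier K ∩ {x | ⟪n, x⟫ = ⟪n, o⟫})

lemma IsEllipticNormal.congr {K : Set E3} {o o' n : E3} (h : IsEllipticNormal K o n)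
    (he : ⟪n, o⟫ = ⟪n, o'⟫) : IsEllipticNormal K o' n :=
  ⟨h.1, he ▸ h.2⟩

lemma IsEllipticNormal.ne_zero {K : Set E3} {o n : E3} (h : IsEllipticNormal K o n) : n ≠ 0 := by
  rintro rfl
  simpa using h.1

lemma vcross_eq_zero_of_orthogonal {n m u v : E3} (h : vcross n m ≠ 0) (hu₁ : ⟪n, u⟫ = 0)
    (hu₂ : ⟪m, u⟫ = 0) (hv₁ : ⟪n, v⟫ = 0) (hv₂ : ⟪m, v⟫ = 0) : vcross u v = 0 := by
  rw [eq_smul_vcross h hu₁ hu₂, eq_smul_vcross h hv₁ hv₂]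
  simp

lemma inner_eq_zero_of_vcross_eq_zero {n m u : E3} (hn : n ≠ 0) (h : vcross n m = 0)
    (hu : ⟪n, u⟫ = 0) : ⟪m, u⟫ = 0 := by
  obtain ⟨s, rfl⟩ := exists_eq_smul_of_vcross_eq_zero hn h
  rw [real_inner_smul_left, hu, mul_zero]

lemma vcross_eq_zero_trans {u v w : E3} (hv : v ≠ 0) (h₁ : vcross u v = 0) (h₂ : vcross v w = 0) :
    vcross u w = 0 := by
  obtain ⟨s, rfl⟩ := exists_eq_smul_of_vcross_eq_zero hv h₂
  rw [vcross_smul_right, h₁, smul_zero]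

namespace DiametralBody

variable {K : Set E3} {η A : E3 → E3}

lemma exists_ellipticNormal (h : DiametralBody K η A) {p : E3} (hp : p ∈ frontier K) :
    ∃ n₁ n₂ : E3, vcross n₁ n₂ ≠ 0 ∧ ⟪n₁, p - A p⟫ = 0 ∧ ⟪n₂, p - A p⟫ = 0 ∧
      IsEllipticNormal K p n₁ ∧ IsEllipticNormal K p n₂ := by
  obtain ⟨n₁, n₂, h1, h2, h12, ho1, ho2, e1, e2⟩ := h.elliptic p hp
  exact ⟨n₁, n₂, h12, ho1, ho2, ⟨h1, e1⟩, ⟨h2, e2⟩⟩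

lemma inner_eq_of_mem_line {p n o : E3} {X : ℝ} (hn : ⟪n, p - A p⟫ = 0)
    (ho : o = A p + X • (p - A p)) : ⟪n, p⟫ = ⟪n, o⟫ := by
  rw [ho, inner_add_right, real_inner_smul_right, hn]
  rw [inner_sub_right] at hn
  linarith

/-- A diametral chord of an elliptic section passes through the center of the ellipse. -/
lemma eq_two_smul_center_sub (h : DiametralBody K η A) {E : Set E3} {c a b x : E3}
    (hE : EllipseParam E c a b) (hEK : E ⊆ frontier K) (hx : x ∈ E) (hAx : A x ∈ E) :
    x = (2 : ℝ) • c - A x := by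
  have h1 := hEK (hE.two_smul_center_sub_mem hAx)
  have h2 := hEK (hE.two_smul_center_sub_mem hx)
  symm
  apply h.eq_of_inner_eq (hEK hx) (h.frontier_subset h1)
  have h3 := (h.normal _ (hEK hAx)).2 _ (h.frontier_subset h2)
  rw [h.normal_antipode x (hEK hx)] at h3
  simp only [inner_neg_left, inner_sub_right, real_inner_smul_right] at h3 ⊢
  linarith

lemma inner_diam_eq_zero {q n o : E3} {Y : ℝ} (hq : q ∈ frontier K)
    (ho : o ∈ interior K) (hoY : o = A q + Y • (q - A q)) (hn : ⟪n, q⟫ = ⟪n, o⟫) :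
    ⟪n, q - A q⟫ = 0 := by
  have hY : Y ≠ 1 := by
    rintro rfl
    rw [one_smul, add_sub_cancel] at hoY
    exact notMem_interior hq (hoY ▸ ho)
  rw [hoY, inner_add_right, real_inner_smul_right] at hn
  have : (1 - Y) * ⟪n, q - A q⟫ = 0 := by
    rw [inner_sub_right] at hn ⊢
    linarith
  exact (mul_eq_zero.1 this).resolve_left (sub_ne_zero.2 hY.symm)

lemma exists_config_of_notMem (h : DiametralBody K η A) {p q n₁ n₂ : E3} (hp : p ∈ frontier K)
    (hq : q ∈ frontier K) (hqp : q ≠ p) (hqAp : q ≠ A p)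
    (hcop : ⟪vcross (p - A p) (q - A q), q - p⟫ = 0) (h12 : vcross n₁ n₂ ≠ 0)
    (ho₁ : ⟪n₁, p - A p⟫ = 0) (ho₂ : ⟪n₂, p - A p⟫ = 0) (e₁ : IsEllipticNormal K p n₁)
    (e₂ : IsEllipticNormal K p n₂) (hq₁ : ⟪n₁, q⟫ ≠ ⟪n₁, p⟫) (hq₂ : ⟪n₂, q⟫ ≠ ⟪n₂, p⟫) :
    ∃ o ∈ interior K, (∃ X : ℝ, o = A p + X • (p - A p)) ∧ ∃ k₁ k₂ : E3,
      IsEllipticNormal K o n₁ ∧ IsEllipticNormal K o n₂ ∧ IsEllipticNormal K o k₁ ∧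
      IsEllipticNormal K o k₂ ∧ vcross n₁ n₂ ≠ 0 ∧ vcross n₁ k₁ ≠ 0 ∧ vcross n₁ k₂ ≠ 0 ∧
      vcross n₂ k₁ ≠ 0 ∧ vcross n₂ k₂ ≠ 0 ∧ vcross k₁ k₂ ≠ 0 ∧ ⟪k₁, p - A p⟫ ≠ 0 := by
  obtain ⟨o, ho, X, Y, hX, hY⟩ := h.exists_mem_interior_of_coplanar hp hq hqp hqAp hcop
  have hne : ∀ n k : E3, n ≠ 0 → k ≠ 0 → ⟪n, p - A p⟫ = 0 → ⟪k, q - A q⟫ = 0 → ⟪n, q⟫ ≠ ⟪n, p⟫ →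
      vcross n k ≠ 0 := by
    intro n k hn hk hnp hkq hnq h0
    apply hnq
    have h1 := inner_eq_zero_of_vcross_eq_zero hk (by rw [vcross_comm, h0, neg_zero]) hkq
    rw [inner_eq_of_mem_line hnp hX, inner_eq_of_mem_line h1 hY]
  obtain ⟨k₁, k₂, hk, hk₁, hk₂, f₁, f₂⟩ := h.exists_ellipticNormal hq
  by_cases hk₁p : ⟪k₁, p - A p⟫ = 0
  · have hk₂p : ⟪k₂, p - A p⟫ ≠ 0 := fun h0 =>
      (h.eq_or_eq_antipode_of_parallel hp hq
        (vcross_eq_zero_of_orthogonal hk hk₁p h0 hk₁ hk₂)).elim hqp hqAp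
    exact ⟨o, ho, ⟨X, hX⟩, k₂, k₁, e₁.congr (inner_eq_of_mem_line ho₁ hX),
      e₂.congr (inner_eq_of_mem_line ho₂ hX), f₂.congr (inner_eq_of_mem_line hk₂ hY),
      f₁.congr (inner_eq_of_mem_line hk₁ hY), h12, hne _ _ e₁.ne_zero f₂.ne_zero ho₁ hk₂ hq₁,
      hne _ _ e₁.ne_zero f₁.ne_zero ho₁ hk₁ hq₁, hne _ _ e₂.ne_zero f₂.ne_zero ho₂ hk₂ hq₂,
      hne _ _ e₂.ne_zero f₁.ne_zero ho₂ hk₁ hq₂, vcross_ne_zero_symm hk, hk₂p⟩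
  · exact ⟨o, ho, ⟨X, hX⟩, k₁, k₂, e₁.congr (inner_eq_of_mem_line ho₁ hX),
      e₂.congr (inner_eq_of_mem_line ho₂ hX), f₁.congr (inner_eq_of_mem_line hk₁ hY),
      f₂.congr (inner_eq_of_mem_line hk₂ hY), h12, hne _ _ e₁.ne_zero f₁.ne_zero ho₁ hk₁ hq₁,
      hne _ _ e₁.ne_zero f₂.ne_zero ho₁ hk₂ hq₁, hne _ _ e₂.ne_zero f₁.ne_zero ho₂ hk₁ hq₂,
      hne _ _ e₂.ne_zero f₂.ne_zero ho₂ hk₂ hq₂, hk, hk₁p⟩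

lemma exists_config_of_infinite (h : DiametralBody K η A) {p n₁ n₂ : E3} (hp : p ∈ frontier K)
    (h12 : vcross n₁ n₂ ≠ 0) (ho₁ : ⟪n₁, p - A p⟫ = 0) (ho₂ : ⟪n₂, p - A p⟫ = 0)
    (e₁ : IsEllipticNormal K p n₁) (e₂ : IsEllipticNormal K p n₂)
    (hinf : {q ∈ frontier K | ⟪vcross (p - A p) (q - A q), q - p⟫ = 0 ∧
      ⟪n₁, q⟫ = ⟪n₁, p⟫}.Infinite) :
    ∃ o ∈ interior K, (∃ X : ℝ, o = A p + X • (p - A p)) ∧ ∃ k₁ k₂ : E3,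
      IsEllipticNormal K o n₁ ∧ IsEllipticNormal K o n₂ ∧ IsEllipticNormal K o k₁ ∧
      IsEllipticNormal K o k₂ ∧ vcross n₁ n₂ ≠ 0 ∧ vcross n₁ k₁ ≠ 0 ∧ vcross n₁ k₂ ≠ 0 ∧
      vcross n₂ k₁ ≠ 0 ∧ vcross n₂ k₂ ≠ 0 ∧ vcross k₁ k₂ ≠ 0 ∧ ⟪k₁, p - A p⟫ ≠ 0 := by
  obtain ⟨c, a, b, hE⟩ := e₁.isEllipse.exists_param
  have hpc : p = (2 : ℝ) • c - A p := by
    apply h.eq_two_smul_center_sub hE Set.inter_subset_left ⟨hp, rfl⟩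
    refine ⟨h.antipode_mem p hp, ?_⟩
    rw [inner_sub_right] at ho₁
    exact (sub_eq_zero.1 ho₁).symm
  have hc : ∀ q, q = (2 : ℝ) • c - A q → c = A q + (1 / 2 : ℝ) • (q - A q) := by
    intro q hq
    have : c = (1 / 2 : ℝ) • (q + A q) := by
      rw [eq_sub_iff_add_eq.1 hq, smul_smul]; norm_num
    rw [this]; module
  have hci : c ∈ interior K := by
    have := h.midpoint_mem_interior hp
    rwa [hc p hpc, show A p + (1 / 2 : ℝ) • (p - A p) = p + (1 / 2 : ℝ) • (A p - p) by module]
  have key : ∀ q ∈ {q ∈ frontier K | ⟪vcross (p - A p) (q - A q), q - p⟫ = 0 ∧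
      ⟪n₁, q⟫ = ⟪n₁, p⟫}, q ≠ p → q ≠ A p → ⟪n₁, q - A q⟫ = 0 ∧
      c = A q + (1 / 2 : ℝ) • (q - A q) ∧ ∃ k, ⟪k, q - A q⟫ = 0 ∧ vcross n₁ k ≠ 0 ∧
      IsEllipticNormal K q k := by
    rintro q ⟨hq, hcop, hqn⟩ hqp hqAp
    obtain ⟨o, ho, X, Y, hX, hY⟩ := h.exists_mem_interior_of_coplanar hp hq hqp hqAp hcop
    have h1 : ⟪n₁, q - A q⟫ = 0 :=
      inner_diam_eq_zero hq ho hY (hqn.trans (inner_eq_of_mem_line ho₁ hX))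
    refine ⟨h1, hc q ?_, ?_⟩
    · apply h.eq_two_smul_center_sub hE Set.inter_subset_left ⟨hq, hqn⟩
      refine ⟨h.antipode_mem q hq, ?_⟩
      rw [inner_sub_right] at h1
      exact (sub_eq_zero.1 h1).symm.trans hqn
    · obtain ⟨k₁, k₂, hk, hk₁, hk₂, f₁, f₂⟩ := h.exists_ellipticNormal hq
      by_cases h0 : vcross n₁ k₁ = 0
      · refine ⟨k₂, hk₂, fun h0' => hk ?_, f₂⟩
        exact vcross_eq_zero_trans e₁.ne_zero (by rw [vcross_comm, h0, neg_zero]) h0'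
      · exact ⟨k₁, hk₁, h0, f₁⟩
  obtain ⟨q₁, hq₁, hq₁'⟩ := (hinf.sdiff (Set.toFinite {p, A p})).nonempty
  simp only [Set.mem_insert_iff, Set.mem_singleton_iff, not_or] at hq₁'
  obtain ⟨q₂, hq₂, hq₂'⟩ := (hinf.sdiff (Set.toFinite {p, A p, q₁, A q₁})).nonempty
  simp only [Set.mem_insert_iff, Set.mem_singleton_iff, not_or] at hq₂'
  obtain ⟨a₁, c₁, k₁, b₁, d₁, f₁⟩ := key q₁ hq₁ hq₁'.1 hq₁'.2
  obtain ⟨a₂, c₂, k₂, b₂, d₂, f₂⟩ := key q₂ hq₂ hq₂'.1 hq₂'.2.1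
  have hn : ∀ {x y m k : E3}, x ∈ frontier K → y ∈ frontier K → m ≠ 0 → vcross n₁ k ≠ 0 →
      ⟪n₁, x - A x⟫ = 0 → ⟪n₁, y - A y⟫ = 0 → ⟪m, x - A x⟫ = 0 → ⟪k, y - A y⟫ = 0 →
      y ≠ x → y ≠ A x → vcross m k ≠ 0 := by
    intro x y m k hx hy hm hk h1 h2 h3 h4 h5 h6 h0
    have := inner_eq_zero_of_vcross_eq_zero hm h0 h3
    exact (h.eq_or_eq_antipode_of_parallel hx hy
      (vcross_eq_zero_of_orthogonal hk h1 this h2 h4)).elim h5 h6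
  refine ⟨c, hci, ⟨_, hc p hpc⟩, k₁, k₂, e₁.congr (inner_eq_of_mem_line ho₁ (hc p hpc)),
    e₂.congr (inner_eq_of_mem_line ho₂ (hc p hpc)), f₁.congr (inner_eq_of_mem_line b₁ c₁),
    f₂.congr (inner_eq_of_mem_line b₂ c₂), h12, d₁, d₂,
    hn hp hq₁.1 e₂.ne_zero d₁ ho₁ a₁ ho₂ b₁ hq₁'.1 hq₁'.2,
    hn hp hq₂.1 e₂.ne_zero d₂ ho₁ a₂ ho₂ b₂ hq₂'.1 hq₂'.2.1,
    hn hq₁.1 hq₂.1 f₁.ne_zero d₂ a₁ a₂ b₁ b₂ hq₂'.2.2.1 hq₂'.2.2.2, fun h0 => ?_⟩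
  exact (h.eq_or_eq_antipode_of_parallel hp hq₁.1
    (vcross_eq_zero_of_orthogonal d₁ ho₁ h0 a₁ b₁)).elim hq₁'.1 hq₁'.2

/-- On each diametral line there is an interior point through which pass four elliptic sections,
two of them containing the line and one of them not. -/
lemma exists_config (h : DiametralBody K η A) {p : E3} (hp : p ∈ frontier K) :
    ∃ o ∈ interior K, (∃ X : ℝ, o = A p + X • (p - A p)) ∧ ∃ n₁ n₂ k₁ k₂ : E3,
      ⟪n₁, p - A p⟫ = 0 ∧ ⟪n₂, p - A p⟫ = 0 ∧
      IsEllipticNormal K o n₁ ∧ IsEllipticNormal K o n₂ ∧ IsEllipticNormal K o k₁ ∧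
      IsEllipticNormal K o k₂ ∧ vcross n₁ n₂ ≠ 0 ∧ vcross n₁ k₁ ≠ 0 ∧ vcross n₁ k₂ ≠ 0 ∧
      vcross n₂ k₁ ≠ 0 ∧ vcross n₂ k₂ ≠ 0 ∧ vcross k₁ k₂ ≠ 0 ∧ ⟪k₁, p - A p⟫ ≠ 0 := by
  obtain ⟨n₁, n₂, h12, ho₁, ho₂, e₁, e₂⟩ := h.exists_ellipticNormal hp
  by_cases H : ∃ q ∈ frontier K, q ≠ p ∧ q ≠ A p ∧ ⟪vcross (p - A p) (q - A q), q - p⟫ = 0 ∧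
      ⟪n₁, q⟫ ≠ ⟪n₁, p⟫ ∧ ⟪n₂, q⟫ ≠ ⟪n₂, p⟫
  · obtain ⟨q, hq, hqp, hqAp, hcop, hq₁, hq₂⟩ := H
    obtain ⟨o, ho, hX, k₁, k₂, H⟩ :=
      h.exists_config_of_notMem hp hq hqp hqAp hcop h12 ho₁ ho₂ e₁ e₂ hq₁ hq₂
    exact ⟨o, ho, hX, n₁, n₂, k₁, k₂, ho₁, ho₂, H⟩
  · push Not at H
    have hcover : {q ∈ frontier K | ⟪vcross (p - A p) (q - A q), q - p⟫ = 0} ⊆ ({p, A p} ∪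
        {q ∈ frontier K | ⟪vcross (p - A p) (q - A q), q - p⟫ = 0 ∧ ⟪n₁, q⟫ = ⟪n₁, p⟫}) ∪
        {q ∈ frontier K | ⟪vcross (p - A p) (q - A q), q - p⟫ = 0 ∧ ⟪n₂, q⟫ = ⟪n₂, p⟫} := by
      rintro q ⟨hq, hcop⟩
      by_cases h1 : q = p
      · simp [h1]
      by_cases h2 : q = A p
      · simp [h2]
      by_cases h3 : ⟪n₁, q⟫ = ⟪n₁, p⟫
      · exact Or.inl (Or.inr ⟨hq, hcop, h3⟩)
      · exact Or.inr ⟨hq, hcop, H q hq h1 h2 hcop h3⟩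
    have hinf := h.infinite_coplanar.mono hcover
    rw [Set.infinite_union, Set.infinite_union] at hinf
    rcases hinf with (hinf | hinf) | hinf
    · exact absurd (Set.toFinite _) hinf
    · obtain ⟨o, ho, hX, k₁, k₂, H⟩ := h.exists_config_of_infinite hp h12 ho₁ ho₂ e₁ e₂ hinf
      exact ⟨o, ho, hX, n₁, n₂, k₁, k₂, ho₁, ho₂, H⟩
    · obtain ⟨o, ho, hX, k₁, k₂, H⟩ :=
        h.exists_config_of_infinite hp (vcross_ne_zero_symm h12) ho₂ ho₁ e₂ e₁ hinf
      exact ⟨o, ho, hX, n₂, n₁, k₁, k₂, ho₂, ho₁, H⟩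

end DiametralBody

/-- The section of the boundary of `K` by the plane through `o` with normal `n`. -/
def planeSection (K : Set E3) (o n : E3) : Set E3 := frontier K ∩ {x | ⟪n, x⟫ = ⟪n, o⟫}

lemma card_union_add_card_multiple {α : Type*} [DecidableEq α] (A B C : Finset α) :
    (A ∪ B ∪ C).card + (A ∩ B ∪ (A ∪ B) ∩ C).card + (A ∩ B ∩ C).card =
      A.card + B.card + C.card := by
  have h1 := Finset.card_union_add_card_inter A B
  have h2 := Finset.card_union_add_card_inter (A ∪ B) C
  have h3 := Finset.card_union_add_card_inter (A ∩ B) ((A ∪ B) ∩ C)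
  have h4 : A ∩ B ∩ ((A ∪ B) ∩ C) = A ∩ B ∩ C := by
    ext x; simp only [Finset.mem_inter, Finset.mem_union]; tauto
  rw [h4] at h3
  omega

namespace EllipseParam

variable {E : Set E3} {o a b : E3}

lemma inner_eq_zero (h : EllipseParam E o a b) {n : E3} {m : ℝ} (hn : ∀ x ∈ E, ⟪n, x⟫ = m) :
    ⟪n, a⟫ = 0 ∧ ⟪n, b⟫ = 0 := by
  have h1 := hn _ ((h.mem_iff _).2 ⟨1, 0, by norm_num, rfl⟩)
  have h2 := hn _ ((h.mem_iff _).2 ⟨-1, 0, by norm_num, rfl⟩)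
  have h3 := hn _ ((h.mem_iff _).2 ⟨0, 1, by norm_num, rfl⟩)
  have h4 := hn _ ((h.mem_iff _).2 ⟨0, -1, by norm_num, rfl⟩)
  simp only [inner_add_right, real_inner_smul_right] at h1 h2 h3 h4
  constructor <;> linarith

lemma exists_tangent (h : EllipseParam E o a b) {n : E3} {m : ℝ} (hn : ∀ x ∈ E, ⟪n, x⟫ = m)
    {c : Fin 10 → ℝ} (hc : ∀ x ∈ E, quad c x = 0) {x N : E3} (hx : x ∈ E)
    (hN : ∀ y ∈ E, ⟪N, y⟫ ≤ ⟪N, x⟫) :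
    ∃ τ, τ ≠ 0 ∧ ⟪n, τ⟫ = 0 ∧ ⟪N, τ⟫ = 0 ∧ quadDeriv c x τ = 0 := by
  obtain ⟨s, t, hst, rfl⟩ := (h.mem_iff x).1 hx
  refine ⟨s • b - t • a, fun h0 => ?_, ?_, h.inner_tangent hst hN, h.quadDeriv_tangent hc⟩
  · obtain ⟨h1, h2⟩ := h.indep (-t) s (by rw [← h0]; module)
    rw [neg_eq_zero] at h1
    rw [h1, h2] at hst
    norm_num at hst
  · obtain ⟨h1, h2⟩ := h.inner_eq_zero hn
    rw [inner_sub_right, real_inner_smul_right, real_inner_smul_right, h1, h2]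
    ring

end EllipseParam

namespace DiametralBody

variable {K : Set E3} {η A : E3 → E3}

/-- A quadric containing two elliptic sections is tangent to `K` at their common points. -/
lemma quadDeriv_eq_zero (h : DiametralBody K η A) {o n m x v : E3} {c : Fin 10 → ℝ}
    (ho : o ∈ interior K) (hnm : vcross n m ≠ 0) (hn : IsEllipticNormal K o n)
    (hm : IsEllipticNormal K o m) (hcn : ∀ y ∈ planeSection K o n, quad c y = 0)
    (hcm : ∀ y ∈ planeSection K o m, quad c y = 0) (hxn : x ∈ planeSection K o n)
    (hxm : x ∈ planeSection K o m) (hv : ⟪η x, v⟫ = 0) : quadDeriv c x v = 0 := by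
  have hx := hxn.1
  obtain ⟨_, _, _, hE₁⟩ := hn.isEllipse.exists_param
  obtain ⟨_, _, _, hE₂⟩ := hm.isEllipse.exists_param
  obtain ⟨τ₁, h1, h2, h3, h4⟩ := hE₁.exists_tangent (fun y hy => hy.2) hcn hxn
    (fun y hy => (h.normal x hx).2 y (h.frontier_subset hy.1))
  obtain ⟨τ₂, k1, k2, k3, k4⟩ := hE₂.exists_tangent (fun y hy => hy.2) hcm hxm
    (fun y hy => (h.normal x hx).2 y (h.frontier_subset hy.1))
  have hind : vcross τ₁ τ₂ ≠ 0 := by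
    intro h0
    have h5 : ⟪m, τ₁⟫ = 0 := by
      obtain ⟨s, hs⟩ := exists_eq_smul_of_vcross_eq_zero k1 (b := τ₁)
        (by rw [vcross_comm, h0, neg_zero])
      rw [hs, real_inner_smul_right, k2, mul_zero]
    have e1 : ⟪n, x - o⟫ = 0 := by rw [inner_sub_right]; exact sub_eq_zero.2 hxn.2
    have e2 : ⟪m, x - o⟫ = 0 := by rw [inner_sub_right]; exact sub_eq_zero.2 hxm.2
    obtain ⟨s, hs⟩ := exists_eq_smul_of_vcross_eq_zero h1
      (vcross_eq_zero_of_orthogonal hnm h2 h5 e1 e2)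
    have h6 := h.inner_lt_of_interior hx ho
    have h7 : ⟪η x, x - o⟫ = 0 := by rw [hs, real_inner_smul_right, h3, mul_zero]
    rw [inner_sub_right] at h7
    linarith
  obtain ⟨s, t, rfl⟩ := exists_eq_smul_add_smul_of_orthogonal (h.normal_ne_zero hx) hind h3 k3 hv
  rw [quadDeriv_smul_add_smul, h4, k4]
  ring

/-- A line through an interior point meets the boundary in two points. -/
lemma exists_pair (h : DiametralBody K η A) {o w : E3} (ho : o ∈ interior K) (hw : w ≠ 0) :
    ∃ T : Finset E3, T.card = 2 ∧ ∀ x ∈ T, x ∈ frontier K ∧ ∃ t : ℝ, x = o + t • w := by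
  classical
  obtain ⟨s, hs, hs'⟩ := h.exists_pos_mem_frontier ho hw
  obtain ⟨t, ht, ht'⟩ := h.exists_neg_mem_frontier ho hw
  refine ⟨{o + s • w, o + t • w}, Finset.card_pair fun he => ?_, ?_⟩
  · have : s = t := smul_left_injective ℝ hw (add_left_cancel he)
    linarith
  · intro x hx
    rcases Finset.mem_insert.1 hx with rfl | hx
    · exact ⟨hs', _, rfl⟩
    · rw [Finset.mem_singleton.1 hx]
      exact ⟨ht', _, rfl⟩

lemma exists_pair_inter (h : DiametralBody K η A) {o o' r n g : E3} (ho' : o' ∈ interior K)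
    (hng : vcross n g ≠ 0) (hn : ⟪n, o'⟫ = ⟪n, o⟫) (hg : ⟪g, o'⟫ = ⟪g, r⟫) :
    ∃ T : Finset E3, T.card = 2 ∧ ∀ x ∈ T, x ∈ planeSection K o n ∧ x ∈ planeSection K r g := by
  obtain ⟨T, hT, hT'⟩ := h.exists_pair ho' hng
  refine ⟨T, hT, fun x hx => ?_⟩
  obtain ⟨hxS, t, rfl⟩ := hT' x hx
  refine ⟨⟨hxS, ?_⟩, ⟨hxS, ?_⟩⟩
  · simp [inner_add_right, real_inner_smul_right, hn]
  · simp [inner_add_right, real_inner_smul_right, hg]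

/-- A quadric containing three elliptic sections contains each further elliptic section which
meets their planes inside the body. -/
lemma quad_eq_zero_of_three (h : DiametralBody K η A) {o r n₁ n₂ n₃ g : E3} {c : Fin 10 → ℝ}
    (ho : o ∈ interior K) (e₁ : IsEllipticNormal K o n₁) (e₂ : IsEllipticNormal K o n₂)
    (e₃ : IsEllipticNormal K o n₃) (eg : IsEllipticNormal K r g)
    (h12 : vcross n₁ n₂ ≠ 0) (h13 : vcross n₁ n₃ ≠ 0) (h23 : vcross n₂ n₃ ≠ 0)
    (h1g : vcross n₁ g ≠ 0) (h2g : vcross n₂ g ≠ 0) (h3g : vcross n₃ g ≠ 0)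
    (hind : ⟪vcross n₁ n₂, n₃⟫ ≠ 0 ∨ ⟪vcross n₁ n₂, g⟫ ≠ 0)
    (c₁ : ∀ y ∈ planeSection K o n₁, quad c y = 0) (c₂ : ∀ y ∈ planeSection K o n₂, quad c y = 0)
    (c₃ : ∀ y ∈ planeSection K o n₃, quad c y = 0)
    (i₁ : ∃ o' ∈ interior K, ⟪n₁, o'⟫ = ⟪n₁, o⟫ ∧ ⟪g, o'⟫ = ⟪g, r⟫)
    (i₂ : ∃ o' ∈ interior K, ⟪n₂, o'⟫ = ⟪n₂, o⟫ ∧ ⟪g, o'⟫ = ⟪g, r⟫)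
    (i₃ : ∃ o' ∈ interior K, ⟪n₃, o'⟫ = ⟪n₃, o⟫ ∧ ⟪g, o'⟫ = ⟪g, r⟫) :
    ∀ y ∈ planeSection K r g, quad c y = 0 := by
  classical
  obtain ⟨o₁, ho₁, i₁, j₁⟩ := i₁
  obtain ⟨o₂, ho₂, i₂, j₂⟩ := i₂
  obtain ⟨o₃, ho₃, i₃, j₃⟩ := i₃
  obtain ⟨A₁, k₁, hA₁⟩ := h.exists_pair_inter ho₁ h1g i₁ j₁
  obtain ⟨A₂, k₂, hA₂⟩ := h.exists_pair_inter ho₂ h2g i₂ j₂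
  obtain ⟨A₃, k₃, hA₃⟩ := h.exists_pair_inter ho₃ h3g i₃ j₃
  have hcard := card_union_add_card_multiple A₁ A₂ A₃
  have hle : (A₁ ∩ A₂ ∩ A₃).card ≤ 1 := by
    rw [Finset.card_le_one]
    intro x hx y hy
    simp only [Finset.mem_inter] at hx hy
    have hd : ∀ n, ⟪n, x⟫ = ⟪n, y⟫ → ⟪n, x - y⟫ = 0 := fun n e => by
      rw [inner_sub_right, e, sub_self]
    have d1 := hd n₁ ((hA₁ x hx.1.1).1.2.trans (hA₁ y hy.1.1).1.2.symm)
    have d2 := hd n₂ ((hA₂ x hx.1.2).1.2.trans (hA₂ y hy.1.2).1.2.symm)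
    have d3 := hd n₃ ((hA₃ x hx.2).1.2.trans (hA₃ y hy.2).1.2.symm)
    have dg := hd g ((hA₁ x hx.1.1).2.2.trans (hA₁ y hy.1.1).2.2.symm)
    have e := eq_smul_vcross h12 d1 d2
    have fin : ∀ n, ⟪vcross n₁ n₂, n⟫ ≠ 0 → ⟪n, x - y⟫ = 0 → x = y := by
      intro n hn h0
      rw [e, real_inner_smul_right] at h0
      rw [(mul_eq_zero.1 h0).resolve_right (by rwa [real_inner_comm]), zero_smul] at e
      exact sub_eq_zero.1 e
    exact hind.elim (fun hn => fin _ hn d3) (fun hn => fin _ hn dg)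
  obtain ⟨_, _, _, hE⟩ := eg.isEllipse.exists_param
  refine hE.quad_eq_zero (S := A₁ ∪ A₂ ∪ A₃) (D := A₁ ∩ A₂ ∪ (A₁ ∪ A₂) ∩ A₃) ?_ ?_ ?_ ?_ (by omega)
  · intro x
    simp only [Finset.mem_union, Finset.mem_inter]
    tauto
  · intro x hx
    simp only [Finset.mem_union] at hx
    rcases hx with (hx | hx) | hx
    exacts [(hA₁ x hx).2, (hA₂ x hx).2, (hA₃ x hx).2]
  · intro x hx
    simp only [Finset.mem_union] at hx
    rcases hx with (hx | hx) | hx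
    exacts [c₁ _ (hA₁ x hx).1, c₂ _ (hA₂ x hx).1, c₃ _ (hA₃ x hx).1]
  · intro x hx
    simp only [Finset.mem_union, Finset.mem_inter] at hx
    have hxS : x ∈ frontier K := by
      rcases hx with ⟨hx, -⟩ | ⟨-, hx⟩
      exacts [(hA₁ x hx).1.1, (hA₃ x hx).1.1]
    refine ⟨η x, fun y hy => (h.normal x hxS).2 y (h.frontier_subset hy.1), fun v hv => ?_⟩
    rcases hx with ⟨hx, hx'⟩ | ⟨hx | hx, hx'⟩
    · exact h.quadDeriv_eq_zero ho h12 e₁ e₂ c₁ c₂ (hA₁ x hx).1 (hA₂ x hx').1 hv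
    · exact h.quadDeriv_eq_zero ho h13 e₁ e₃ c₁ c₃ (hA₁ x hx).1 (hA₃ x hx').1 hv
    · exact h.quadDeriv_eq_zero ho h23 e₂ e₃ c₂ c₃ (hA₂ x hx).1 (hA₃ x hx').1 hv

lemma _root_.EllipseParam.quad_eq_zero_of_card {E : Set E3} {o a b : E3}
    (hE : EllipseParam E o a b) {c : Fin 10 → ℝ} {T : Finset E3} (hT : ∀ x ∈ T, x ∈ E)
    (hc : ∀ x ∈ T, quad c x = 0) (hcard : 5 ≤ T.card) : ∀ x ∈ E, quad c x = 0 :=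
  hE.quad_eq_zero (D := ∅) (Finset.empty_subset T) hT hc (by simp) (by simpa using hcard)

/-- A quadric through three elliptic sections having just one common interior point. -/
lemma exists_quad_of_three (h : DiametralBody K η A) {o n₁ n₂ n₃ : E3} (ho : o ∈ interior K)
    (e₁ : IsEllipticNormal K o n₁) (e₂ : IsEllipticNormal K o n₂) (e₃ : IsEllipticNormal K o n₃)
    (h12 : vcross n₁ n₂ ≠ 0) (h13 : vcross n₁ n₃ ≠ 0) (h23 : vcross n₂ n₃ ≠ 0)
    (hind : ⟪vcross n₁ n₂, n₃⟫ ≠ 0) : ∃ c : Fin 10 → ℝ, c ≠ 0 ∧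
      (∀ y ∈ planeSection K o n₁, quad c y = 0) ∧ (∀ y ∈ planeSection K o n₂, quad c y = 0) ∧
      ∀ y ∈ planeSection K o n₃, quad c y = 0 := by
  classical
  obtain ⟨A₁₂, k₁₂, m₁₂⟩ := h.exists_pair_inter (o := o) (r := o) ho h12 rfl rfl
  obtain ⟨A₁₃, k₁₃, m₁₃⟩ := h.exists_pair_inter (o := o) (r := o) ho h13 rfl rfl
  obtain ⟨A₂₃, k₂₃, m₂₃⟩ := h.exists_pair_inter (o := o) (r := o) ho h23 rfl rfl
  have hdisj : Disjoint A₁₃ A₂₃ := by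
    rw [Finset.disjoint_left]
    intro x hx hx'
    have hd : ∀ n, x ∈ planeSection K o n → ⟪n, x - o⟫ = 0 := fun n e => by
      rw [inner_sub_right]; exact sub_eq_zero.2 e.2
    have e := eq_smul_vcross h12 (hd _ (m₁₃ x hx).1) (hd _ (m₂₃ x hx').1)
    have h0 := hd _ (m₁₃ x hx).2
    rw [e, real_inner_smul_right] at h0
    rw [(mul_eq_zero.1 h0).resolve_right (by rwa [real_inner_comm]), zero_smul] at e
    exact notMem_interior (m₁₃ x hx).1.1 (sub_eq_zero.1 e ▸ ho)
  obtain ⟨_, _, _, p₁⟩ := e₁.isEllipse.exists_param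
  obtain ⟨_, _, _, p₂⟩ := e₂.isEllipse.exists_param
  obtain ⟨_, _, _, p₃⟩ := e₃.isEllipse.exists_param
  obtain ⟨B₁, b₁, b₁'⟩ := (p₁.infinite.sdiff A₁₂.finite_toSet).exists_subset_card_eq 3
  obtain ⟨B₂, b₂, b₂'⟩ := (p₂.infinite.sdiff A₁₂.finite_toSet).exists_subset_card_eq 3
  obtain ⟨z, hz⟩ := (p₃.infinite.sdiff (A₁₃ ∪ A₂₃).finite_toSet).nonempty
  have d₁ : Disjoint A₁₂ B₁ := Finset.disjoint_left.2 fun x hx hx' => (b₁ hx').2 hx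
  have d₂ : Disjoint A₁₂ B₂ := Finset.disjoint_left.2 fun x hx hx' => (b₂ hx').2 hx
  obtain ⟨c, hc0, hc⟩ := exists_quad_of_card_le (s := insert z (A₁₂ ∪ B₁ ∪ B₂)) (by
    have := Finset.card_insert_le z (A₁₂ ∪ B₁ ∪ B₂)
    have := Finset.card_union_le (A₁₂ ∪ B₁) B₂
    have := Finset.card_union_le A₁₂ B₁
    omega)
  have c₁ : ∀ y ∈ planeSection K o n₁, quad c y = 0 := by
    refine p₁.quad_eq_zero_of_card (T := A₁₂ ∪ B₁) (fun x hx => ?_) (fun x hx => hc x ?_) ?_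
    · rcases Finset.mem_union.1 hx with hx | hx
      exacts [(m₁₂ x hx).1, (b₁ hx).1]
    · exact Finset.mem_insert_of_mem (Finset.mem_union_left _ hx)
    · rw [Finset.card_union_of_disjoint d₁]; omega
  have c₂ : ∀ y ∈ planeSection K o n₂, quad c y = 0 := by
    refine p₂.quad_eq_zero_of_card (T := A₁₂ ∪ B₂) (fun x hx => ?_) (fun x hx => hc x ?_) ?_
    · rcases Finset.mem_union.1 hx with hx | hx
      exacts [(m₁₂ x hx).2, (b₂ hx).1]
    · simp only [Finset.mem_insert, Finset.mem_union] at hx ⊢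
      tauto
    · rw [Finset.card_union_of_disjoint d₂]; omega
  refine ⟨c, hc0, c₁, c₂, ?_⟩
  refine p₃.quad_eq_zero_of_card (T := insert z (A₁₃ ∪ A₂₃)) (fun x hx => ?_) (fun x hx => ?_) ?_
  · simp only [Finset.mem_insert, Finset.mem_union] at hx
    rcases hx with rfl | hx | hx
    exacts [hz.1, (m₁₃ x hx).2, (m₂₃ x hx).2]
  · simp only [Finset.mem_insert, Finset.mem_union] at hx
    rcases hx with rfl | hx | hx
    exacts [hc _ (Finset.mem_insert_self _ _), c₁ _ (m₁₃ x hx).1, c₂ _ (m₂₃ x hx).1]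
  · rw [Finset.card_insert_of_notMem (fun hz' => hz.2 hz'), Finset.card_union_of_disjoint hdisj]
    omega

end DiametralBody

lemma tendsto_vcross {X : Type*} {l : Filter X} {f : X → E3} {u v : E3}
    (hf : Filter.Tendsto f l (nhds v)) :
    Filter.Tendsto (fun x => vcross u (f x)) l (nhds (vcross u v)) :=
  ((continuous_vcross continuous_const continuous_id).tendsto v).comp hf

lemma eventually_exists_mem_interior_inter {K : Set E3} {o p M ν₀ : E3} {ν : E3 → E3}
    {l : Filter E3} (ho : o ∈ interior K) (hl : Filter.Tendsto id l (nhds p))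
    (hν : Filter.Tendsto ν l (nhds ν₀)) (hp : ⟪ν₀, p - o⟫ = 0) (hM : vcross M ν₀ ≠ 0) :
    ∀ᶠ r in l, ∃ o' ∈ interior K, ⟪M, o'⟫ = ⟪M, o⟫ ∧ ⟪ν r, o'⟫ = ⟪ν r, r⟫ := by
  set w := vcross (vcross M ν₀) M with hw
  have hMw : ⟪M, w⟫ = 0 := inner_vcross_self_right _ _
  have hνw : ⟪ν₀, w⟫ ≠ 0 := by
    rw [real_inner_comm, hw, inner_vcross_cyclic]
    exact (real_inner_self_pos.2 hM).ne'
  have h1 : Filter.Tendsto (fun r => ⟪ν r, w⟫) l (nhds ⟪ν₀, w⟫) := hν.inner tendsto_const_nhds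
  have h2 : Filter.Tendsto (fun r => ⟪ν r, r - o⟫ / ⟪ν r, w⟫) l (nhds 0) := by
    have := (hν.inner (hl.sub_const o)).div h1 hνw
    rwa [hp, zero_div] at this
  have h3 : Filter.Tendsto (fun r => o + (⟪ν r, r - o⟫ / ⟪ν r, w⟫ : ℝ) • w) l (nhds o) := by
    simpa using (h2.smul_const w).const_add o
  filter_upwards [h3.eventually (isOpen_interior.mem_nhds ho), h1.eventually_ne hνw] with r hr hr'
  refine ⟨_, hr, ?_, ?_⟩
  · rw [inner_add_right, real_inner_smul_right, hMw, mul_zero, add_zero]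
  · rw [inner_add_right, real_inner_smul_right, div_mul_cancel₀ _ hr', inner_sub_right]
    ring

namespace DiametralBody

variable {K : Set E3} {η A : E3 → E3}

lemma eventually_quad_eq_zero (h : DiametralBody K η A) {o p n₁ n₂ n₃ ν₀ : E3} {ν : E3 → E3}
    {c : Fin 10 → ℝ} {l : Filter E3} (ho : o ∈ interior K) (hl : Filter.Tendsto id l (nhds p))
    (hlS : ∀ᶠ r in l, r ∈ frontier K)
    (hν : Filter.Tendsto ν l (nhds ν₀)) (hp : ⟪ν₀, p - o⟫ = 0)
    (hνe : ∀ r ∈ frontier K, IsEllipticNormal K r (ν r))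
    (e₁ : IsEllipticNormal K o n₁) (e₂ : IsEllipticNormal K o n₂) (e₃ : IsEllipticNormal K o n₃)
    (h12 : vcross n₁ n₂ ≠ 0) (h13 : vcross n₁ n₃ ≠ 0) (h23 : vcross n₂ n₃ ≠ 0)
    (h1 : vcross n₁ ν₀ ≠ 0) (h2 : vcross n₂ ν₀ ≠ 0) (h3 : vcross n₃ ν₀ ≠ 0)
    (hind : ⟪vcross n₁ n₂, ν₀⟫ ≠ 0) (c₁ : ∀ y ∈ planeSection K o n₁, quad c y = 0)
    (c₂ : ∀ y ∈ planeSection K o n₂, quad c y = 0)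
    (c₃ : ∀ y ∈ planeSection K o n₃, quad c y = 0) : ∀ᶠ r in l, quad c r = 0 := by
  have hi : Filter.Tendsto (fun r => ⟪vcross n₁ n₂, ν r⟫) l (nhds ⟪vcross n₁ n₂, ν₀⟫) :=
    tendsto_const_nhds.inner hν
  filter_upwards [hlS, hi.eventually_ne hind, (tendsto_vcross hν).eventually_ne h1,
    (tendsto_vcross hν).eventually_ne h2, (tendsto_vcross hν).eventually_ne h3,
    eventually_exists_mem_interior_inter ho hl hν hp h1,
    eventually_exists_mem_interior_inter ho hl hν hp h2,
    eventually_exists_mem_interior_inter ho hl hν hp h3] with r hr f0 f1 f2 f3 i1 i2 i3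
  exact h.quad_eq_zero_of_three ho e₁ e₂ e₃ (hνe r hr) h12 h13 h23 f1 f2 f3 (Or.inr f0) c₁ c₂ c₃
    i1 i2 i3 r ⟨hr, rfl⟩

/-- The boundary is locally a quadric. -/
lemma exists_local_quad (h : DiametralBody K η A) {p : E3} (hp : p ∈ frontier K) :
    ∃ c : Fin 10 → ℝ, c ≠ 0 ∧ ∀ᶠ r in nhdsWithin p (frontier K), quad c r = 0 := by
  obtain ⟨o, ho, ⟨X, hX⟩, n₁, n₂, k₁, k₂, a₁, a₂, e₁, e₂, f₁, f₂, h12, g11, g12, g21, g22, hk, ak⟩ :=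
    h.exists_config hp
  have hind : ⟪vcross n₁ n₂, k₁⟫ ≠ 0 := by
    intro h0
    rw [eq_smul_vcross h12 a₁ a₂, real_inner_smul_right] at ak
    exact ak (by rw [real_inner_comm _ k₁, h0, mul_zero])
  obtain ⟨c, hc0, c₁, c₂, d₁⟩ := h.exists_quad_of_three ho e₁ e₂ f₁ h12 g11 g21 hind
  have d₂ := h.quad_eq_zero_of_three ho e₁ e₂ f₁ f₂ h12 g11 g21 g12 g22 hk (Or.inl hind) c₁ c₂ d₁
    ⟨o, ho, rfl, rfl⟩ ⟨o, ho, rfl, rfl⟩ ⟨o, ho, rfl, rfl⟩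
  refine ⟨c, hc0, ?_⟩
  have hν : ∀ r ∈ frontier K, ∃ ν, ⟪ν, r - A r⟫ = 0 ∧ IsEllipticNormal K r ν := fun r hr => by
    obtain ⟨n, -, -, hn, -, he, -⟩ := h.exists_ellipticNormal hr
    exact ⟨n, hn, he⟩
  choose! ν hνo hνe using hν
  refine Filter.mem_iff_ultrafilter.2 fun U hU => ?_
  have hUS : ∀ᶠ r in (U : Filter E3), r ∈ frontier K := hU self_mem_nhdsWithin
  have hUp : Filter.Tendsto id (U : Filter E3) (nhds p) := fun s hs => hU (nhdsWithin_le_nhds hs)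
  obtain ⟨ν₀, hν₀, hUν⟩ := (isCompact_sphere (0 : E3) 1).ultrafilter_le_nhds' (U.map ν) (by
    change ∀ᶠ r in (U : Filter E3), ν r ∈ Metric.sphere (0 : E3) 1
    filter_upwards [hUS] with r hr
    simpa using (hνe r hr).norm_eq)
  have hUν : Filter.Tendsto ν (U : Filter E3) (nhds ν₀) := hUν
  have hν0 : ν₀ ≠ 0 := by
    rintro rfl
    simp at hν₀
  have haν : ⟪ν₀, p - A p⟫ = 0 := by
    have hA : Filter.Tendsto A (U : Filter E3) (nhds (A p)) :=
      (h.continuousOn_antipode p hp).mono_left hU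
    have h1 : Filter.Tendsto (fun r => ⟪ν r, r - A r⟫) (U : Filter E3) (nhds ⟪ν₀, p - A p⟫) :=
      hUν.inner (hUp.sub hA)
    refine tendsto_nhds_unique (h1.congr' ?_) tendsto_const_nhds
    filter_upwards [hUS] with r hr using hνo r hr
  have hpo : ⟪ν₀, p - o⟫ = 0 := by
    rw [inner_sub_right, inner_eq_of_mem_line haν hX, sub_self]
  have hkν : vcross k₁ ν₀ ≠ 0 := fun h0 =>
    ak (inner_eq_zero_of_vcross_eq_zero hν0 (by rw [vcross_comm, h0, neg_zero]) haν)
  have hd : ∀ n, vcross n k₁ ≠ 0 → vcross n ν₀ ≠ 0 → ⟪n, p - A p⟫ = 0 →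
      ⟪vcross n k₁, ν₀⟫ ≠ 0 := by
    intro n hnk hnν hn h0
    obtain ⟨s, t, rfl⟩ := exists_eq_smul_add_smul hnk h0
    rw [inner_add_left, real_inner_smul_left, real_inner_smul_left, hn, mul_zero, zero_add] at haν
    rw [(mul_eq_zero.1 haν).resolve_right ak] at hnν
    simp at hnν
  have tr : ∀ n m, vcross n ν₀ = 0 → vcross n m ≠ 0 → vcross m ν₀ ≠ 0 := by
    intro n m h1 h2 h3
    exact h2 (vcross_eq_zero_trans hν0 h1 (by rw [vcross_comm, h3, neg_zero]))
  change ∀ᶠ r in (U : Filter E3), quad c r = 0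
  by_cases hn₁ : vcross n₁ ν₀ = 0
  · have i2 := tr n₁ n₂ hn₁ h12
    exact h.eventually_quad_eq_zero ho hUp hUS hUν hpo hνe e₂ f₁ f₂ g21 g22 hk i2 hkν
      (tr n₁ k₂ hn₁ g12) (hd _ g21 i2 a₂) c₂ d₁ d₂
  by_cases hn₂ : vcross n₂ ν₀ = 0
  · exact h.eventually_quad_eq_zero ho hUp hUS hUν hpo hνe e₁ f₁ f₂ g11 g12 hk hn₁ hkν
      (tr n₂ k₂ hn₂ g22) (hd _ g11 hn₁ a₁) c₁ d₁ d₂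
  · exact h.eventually_quad_eq_zero ho hUp hUS hUν hpo hνe e₁ f₁ e₂ g11 h12
      (vcross_ne_zero_symm g21) hn₁ hkν hn₂ (hd _ g11 hn₁ a₁) c₁ d₁ c₂

end DiametralBody

/-- A quadric containing two planes and a point off these planes is trivial. -/
lemma quad_eq_zero_of_two_planes {c : Fin 10 → ℝ} {n m o x : E3} (hnm : vcross n m ≠ 0)
    (hn : ∀ y, ⟪n, y⟫ = ⟪n, o⟫ → quad c y = 0) (hm : ∀ y, ⟪m, y⟫ = ⟪m, o⟫ → quad c y = 0)
    (hxn : ⟪n, x⟫ ≠ ⟪n, o⟫) (hxm : ⟪m, x⟫ ≠ ⟪m, o⟫) (hx : quad c x = 0) (y : E3) :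
    quad c y = 0 := by
  set e := vcross n m with he
  have hee : ⟪e, e⟫ ≠ 0 := (real_inner_self_pos.2 hnm).ne'
  set u := vcross m e
  set v := vcross n e
  have hmu : ⟪m, u⟫ = 0 := inner_vcross_self_left _ _
  have hnv : ⟪n, v⟫ = 0 := inner_vcross_self_left _ _
  have hnu : ⟪n, u⟫ = ⟪e, e⟫ := (inner_vcross_cyclic _ _ _).symm
  have hmv : ⟪m, v⟫ = -⟪e, e⟫ := by
    rw [← inner_vcross_cyclic, vcross_comm, inner_neg_left]
  have key : ∀ z : E3, quad c z =
      quadPolar c u v * ((⟪n, z - o⟫ / ⟪e, e⟫) * (-⟪m, z - o⟫ / ⟪e, e⟫)) := by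
    intro z
    set a := ⟪n, z - o⟫ / ⟪e, e⟫ with ha
    set b := -⟪m, z - o⟫ / ⟪e, e⟫ with hb
    have ha' : a * ⟪e, e⟫ = ⟪n, z⟫ - ⟪n, o⟫ := by
      rw [ha, div_mul_cancel₀ _ hee, inner_sub_right]
    have hb' : b * ⟪e, e⟫ = -(⟪m, z⟫ - ⟪m, o⟫) := by
      rw [hb, div_mul_cancel₀ _ hee, inner_sub_right]
    set q := z - a • u - b • v with hq
    have hz : z = q + a • u + b • v := by rw [hq]; module
    have h1 := quad_add_smul_add_smul c q u v a b
    have h2 := quad_add_smul_add_smul c q u v a 0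
    have h3 := quad_add_smul_add_smul c q u v 0 b
    rw [hm] at h2
    · rw [hn] at h3
      · have h4 : quad c q = 0 := by
          apply hn
          rw [hq, inner_sub_right, inner_sub_right, real_inner_smul_right, real_inner_smul_right,
            hnu, hnv]
          linarith
        rw [hz, h1]
        linarith
      · rw [hq, inner_add_right, inner_add_right, inner_sub_right, inner_sub_right]
        simp only [real_inner_smul_right, hnu, hnv]
        linarith
    · rw [hq, inner_add_right, inner_add_right, inner_sub_right, inner_sub_right]
      simp only [real_inner_smul_right, hmu, hmv]
      linarith
  have hk : quadPolar c u v = 0 := by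
    have := key x
    rw [hx, eq_comm, mul_eq_zero] at this
    refine this.resolve_right (mul_ne_zero (div_ne_zero ?_ hee) (div_ne_zero ?_ hee))
    · rw [inner_sub_right]
      exact sub_ne_zero.2 hxn
    · rw [inner_sub_right]
      exact neg_ne_zero.2 (sub_ne_zero.2 hxm)
  rw [key, hk, zero_mul]

namespace DiametralBody

variable {K : Set E3} {η A : E3 → E3}

lemma quad_add_eq_zero (h : DiametralBody K η A) {o : E3} {c : Fin 10 → ℝ}
    (ho : o ∈ interior K) {v : E3} (hv : v ≠ 0) (h0 : quad c o = 0)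
    (hc : ∀ t : ℝ, o + t • v ∈ frontier K → quad c (o + t • v) = 0) : quad c (o + v) = 0 := by
  obtain ⟨s, hs, hs'⟩ := h.exists_pos_mem_frontier ho hv
  obtain ⟨t, ht, ht'⟩ := h.exists_neg_mem_frontier ho hv
  have h1 := hc s hs'
  have h2 := hc t ht'
  rw [quad_add_smul] at h1 h2
  obtain ⟨h3, h4, h5⟩ := quadratic_eq_zero_of_three_zeros hs.ne' (ht.trans hs).ne' ht.ne'
    (t₁ := s) (t₂ := 0) (t₃ := t) (A := quadPolar c v v / 2) (B := quadDeriv c o v) (C := quad c o)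
    (by linarith) (by simpa using h0) (by linarith)
  have := quad_add_smul c o v 1
  rw [one_smul, h3, h4, h5] at this
  simpa using this

/-- A quadric containing a neighbourhood of a boundary point and an interior point of
the diametral chord is trivial. -/
lemma quad_eq_zero_of_eventually (h : DiametralBody K η A) {s : E3} (hs : s ∈ frontier K)
    {c : Fin 10 → ℝ} (hc : ∀ᶠ r in nhdsWithin s (frontier K), quad c r = 0)
    (h0 : quad c (s + (1 / 2 : ℝ) • (A s - s)) = 0) (y : E3) : quad c y = 0 := by
  set o := s + (1 / 2 : ℝ) • (A s - s) with hod
  have ho : o ∈ interior K := h.midpoint_mem_interior hs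
  obtain ⟨n, m, hnm, hn, hm, en, em⟩ := h.exists_ellipticNormal hs
  obtain ⟨U, hU, hUc⟩ := mem_nhdsWithin_iff_exists_mem_nhds_inter.1 hc
  have hline : ∀ n : E3, ⟪n, s - A s⟫ = 0 → ⟪n, s⟫ = ⟪n, o⟫ := by
    intro n hn
    rw [hod, inner_add_right, real_inner_smul_right, ← neg_sub s (A s), inner_neg_right, hn]
    simp
  have plane : ∀ n : E3, ⟪n, s - A s⟫ = 0 → IsEllipticNormal K s n →
      ∀ y, ⟪n, y⟫ = ⟪n, o⟫ → quad c y = 0 := by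
    intro n hn en y hy
    obtain ⟨_, _, _, hE⟩ := en.isEllipse.exists_param
    obtain ⟨T, hT, hT5⟩ := (hE.infinite_inter_nhds ⟨hs, rfl⟩ hU).exists_subset_card_eq 5
    have hE0 := hE.quad_eq_zero_of_card (c := c) (T := T) (fun x hx => (hT hx).1)
      (fun x hx => hUc ⟨(hT hx).2, (hT hx).1.1⟩) hT5.ge
    by_cases hyo : y = o
    · rw [hyo, h0]
    have := h.quad_add_eq_zero ho (sub_ne_zero.2 hyo) h0 fun t ht => hE0 _ ⟨ht, by
      show ⟪n, o + t • (y - o)⟫ = ⟪n, s⟫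
      rw [inner_add_right, real_inner_smul_right, inner_sub_right, hy, hline n hn]
      ring⟩
    rwa [add_sub_cancel] at this
  have hso : s - o ≠ 0 := by
    intro h'
    exact notMem_interior hs (sub_eq_zero.1 h' ▸ ho)
  set w := vcross (m + n) (vcross n m) with hw
  have hee : ⟪vcross n m, vcross n m⟫ ≠ 0 := (real_inner_self_pos.2 hnm).ne'
  have hnw : ⟪n, w⟫ ≠ 0 := by
    rw [hw, ← inner_vcross_cyclic, vcross_add_right, vcross_self, add_zero]
    exact hee
  have hmw : ⟪m, w⟫ ≠ 0 := by
    rw [hw, ← inner_vcross_cyclic, vcross_add_right, vcross_self, zero_add, vcross_comm,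
      inner_neg_left]
    exact neg_ne_zero.2 hee
  have hcont : Filter.Tendsto (fun ε : ℝ => radial K o (s - o + ε • w)) (nhds 0) (nhds s) := by
    have h1 : Filter.Tendsto (fun ε : ℝ => s - o + ε • w) (nhds 0) (nhds (s - o)) := by
      have : Continuous fun ε : ℝ => s - o + ε • w := by fun_prop
      simpa using this.tendsto 0
    have h2 := (h.continuousAt_radial ho hso).tendsto.comp h1
    have h3 : radial K o (s - o) = s := by
      rw [h.radial_eq ho one_pos (by simpa using hs)]
      simp
    rwa [h3] at h2
  have hne : ∀ᶠ ε : ℝ in nhds 0, s - o + ε • w ≠ 0 := by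
    have : Continuous fun ε : ℝ => s - o + ε • w := by fun_prop
    apply (this.tendsto 0).eventually_ne
    simpa using hso
  obtain ⟨ε, ⟨hεU, hεne⟩, hε0⟩ := (((hcont.eventually hU).and hne).filter_mono
    nhdsWithin_le_nhds |>.and (self_mem_nhdsWithin (s := ({0}ᶜ : Set ℝ)))).exists
  have hx := h.radial_mem ho hεne
  have hoff : ∀ n : E3, ⟪n, s - A s⟫ = 0 → ⟪n, w⟫ ≠ 0 →
      ⟪n, radial K o (s - o + ε • w)⟫ ≠ ⟪n, o⟫ := by
    intro n hn hnw he
    rw [radial, inner_add_right, real_inner_smul_right, inner_add_right (y := s - o),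
      inner_sub_right (y := s),
      hline n hn, real_inner_smul_right, sub_self, zero_add, add_eq_left] at he
    exact mul_ne_zero (inv_ne_zero (h.gauge_pos ho hεne).ne') (mul_ne_zero hε0 hnw) he
  exact quad_eq_zero_of_two_planes hnm (plane n hn en) (plane m hm em) (hoff n hn hnw)
    (hoff m hm hmw) (hUc ⟨hεU, hx⟩) y

lemma quad_eq_zero_of_eventually_of_eventually (h : DiametralBody K η A) {s : E3}
    (hs : s ∈ frontier K) {c d : Fin 10 → ℝ} (hd0 : d ≠ 0)
    (hc : ∀ᶠ r in nhdsWithin s (frontier K), quad c r = 0)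
    (hd : ∀ᶠ r in nhdsWithin s (frontier K), quad d r = 0) {x : E3} (hx : quad d x = 0) :
    quad c x = 0 := by
  set o := s + (1 / 2 : ℝ) • (A s - s) with hod
  have hdo : quad d o ≠ 0 := by
    intro h0
    obtain ⟨y, hy⟩ := exists_quad_ne_zero hd0
    exact hy (h.quad_eq_zero_of_eventually hs hd h0 y)
  have := h.quad_eq_zero_of_eventually hs (c := quad d o • c - quad c o • d) (by
    filter_upwards [hc, hd] with r h1 h2
    rw [quad_smul_sub_smul, h1, h2]
    ring) (by
    rw [quad_smul_sub_smul]
    ring) x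
  rw [quad_smul_sub_smul, hx, mul_zero, sub_zero, mul_eq_zero] at this
  exact this.resolve_left hdo

/-- The boundary lies on a quadric. -/
lemma exists_quad (h : DiametralBody K η A) :
    ∃ c : Fin 10 → ℝ, c ≠ 0 ∧ ∀ x ∈ frontier K, quad c x = 0 := by
  obtain ⟨p, hp⟩ := h.isConnected_frontier.nonempty
  obtain ⟨c, hc0, hc⟩ := h.exists_local_quad hp
  refine ⟨c, hc0, ?_⟩
  have hpre := Subtype.preconnectedSpace h.isConnected_frontier.isPreconnected
  let W : Set (frontier K) := {r | ∀ᶠ x in nhdsWithin (r : E3) (frontier K), quad c x = 0}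
  have hopen : IsOpen W := by
    rw [isOpen_iff_mem_nhds]
    intro r hr
    exact preimage_coe_mem_nhds_subtype.2 (eventually_eventually_nhdsWithin.2 hr)
  have hclosed : IsClosed W := by
    refine isClosed_of_closure_subset fun r hr => ?_
    obtain ⟨d, hd0, hd⟩ := h.exists_local_quad r.2
    have hV : {r' : frontier K | ∀ᶠ x in nhdsWithin (r' : E3) (frontier K), quad d x = 0} ∈
        nhds r := preimage_coe_mem_nhds_subtype.2 (eventually_eventually_nhdsWithin.2 hd)
    obtain ⟨r', hr'd, hr'⟩ := mem_closure_iff_nhds.1 hr _ hV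
    filter_upwards [hd] with x hx
    exact h.quad_eq_zero_of_eventually_of_eventually r'.2 hd0 hr' hr'd hx
  have hu : W = Set.univ := IsClopen.eq_univ ⟨hclosed, hopen⟩ ⟨⟨p, hp⟩, hc⟩
  intro x hx
  have : (⟨x, hx⟩ : frontier K) ∈ W := hu ▸ Set.mem_univ _
  exact this.self_of_nhdsWithin hx

end DiametralBody

/-- A positive definite quadratic form is the square of the norm in suitable coordinates. -/
lemma exists_linearEquiv_norm_sq {c : Fin 10 → ℝ} (hP : ∀ v : E3, v ≠ 0 → 0 < quadPolar c v v / 2) :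
    ∃ M : E3 ≃ₗ[ℝ] E3, ∀ v, quadPolar c v v / 2 = ‖M v‖ ^ 2 := by
  have ha : 0 < c 0 := by
    have := hP !₂[1, 0, 0] (fun h0 => by simpa using congrArg (· 0) h0)
    simpa [quadPolar] using this
  obtain ⟨p, hp⟩ : ∃ p, 2 * c 0 * p = c 3 := ⟨c 3 / (2 * c 0), by field_simp⟩
  obtain ⟨q, hq⟩ : ∃ q, 2 * c 0 * q = c 4 := ⟨c 4 / (2 * c 0), by field_simp⟩
  obtain ⟨d, hd⟩ : ∃ d, d = c 1 - c 0 * p ^ 2 := ⟨_, rfl⟩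
  have hd0 : 0 < d := by
    have := hP !₂[-p, 1, 0] (fun h0 => by simpa using congrArg (· 1) h0)
    simp [quadPolar] at this
    rw [← hp] at this
    linarith
  obtain ⟨r, hr⟩ : ∃ r, 2 * d * r = c 5 - 2 * c 0 * p * q :=
    ⟨(c 5 - 2 * c 0 * p * q) / (2 * d), by field_simp⟩
  obtain ⟨e, he⟩ : ∃ e, e = c 2 - c 0 * q ^ 2 - d * r ^ 2 := ⟨_, rfl⟩
  have h5 : c 5 = 2 * d * r + 2 * c 0 * p * q := by linarith
  have h1 : c 1 = d + c 0 * p ^ 2 := by linarith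
  have h2 : c 2 = e + c 0 * q ^ 2 + d * r ^ 2 := by linarith
  have hsum : ∀ v : E3, quadPolar c v v / 2 =
      c 0 * (v 0 + p * v 1 + q * v 2) ^ 2 + d * (v 1 + r * v 2) ^ 2 + e * v 2 ^ 2 := by
    intro v
    rw [quadPolar, h5, h1, h2, ← hp, ← hq]
    ring
  have he0 : 0 < e := by
    have := hP !₂[p * r - q, -r, 1] (fun h0 => by simpa using congrArg (· 2) h0)
    rw [hsum] at this
    simp at this
    ring_nf at this
    simpa using this
  let M : E3 →ₗ[ℝ] E3 :=
    { toFun := fun v => !₂[√(c 0) * (v 0 + p * v 1 + q * v 2), √d * (v 1 + r * v 2), √e * v 2]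
      map_add' := by
        intro v w
        ext i
        fin_cases i <;> simp <;> ring
      map_smul' := by
        intro t v
        ext i
        fin_cases i <;> simp <;> ring }
  have hM : ∀ v, quadPolar c v v / 2 = ‖M v‖ ^ 2 := by
    intro v
    rw [hsum, EuclideanSpace.norm_sq_eq, Fin.sum_univ_three]
    simp [M, mul_pow, Real.sq_sqrt ha.le, Real.sq_sqrt hd0.le, Real.sq_sqrt he0.le]
  have hinj : Function.Injective M := by
    rw [injective_iff_map_eq_zero]
    intro v hv
    by_contra h0
    have := hP v h0
    rw [hM, hv] at this
    simp at this
  exact ⟨LinearEquiv.ofInjectiveEndo M hinj, hM⟩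

/-- The zero set of a quadratic polynomial with positive definite leading part and a
negative value is an ellipsoid. -/
lemma isEllipsoid_quad {c : Fin 10 → ℝ} {o : E3} (ho : quad c o < 0)
    (hP : ∀ v : E3, v ≠ 0 → 0 < quadPolar c v v / 2) : IsEllipsoid {x | quad c x = 0} := by
  obtain ⟨M, hM⟩ := exists_linearEquiv_norm_sq hP
  let D : E3 →ₗ[ℝ] ℝ :=
    { toFun := quadDeriv c o
      map_add' := fun v w => by simpa using quadDeriv_smul_add_smul c o v w 1 1
      map_smul' := fun t v => by simpa using quadDeriv_smul_add_smul c o v 0 t 0 }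
  let k : E3 := (1 / 2 : ℝ) •
    (InnerProductSpace.toDual ℝ E3).symm (D ∘ₗ M.symm.toLinearMap).toContinuousLinearMap
  have hk : ∀ v, quadDeriv c o v = 2 * ⟪k, M v⟫ := by
    intro v
    rw [real_inner_smul_left, InnerProductSpace.toDual_symm_apply]
    simp [D]
  have hquad : ∀ v, quad c (o + v) = ‖M v + k‖ ^ 2 - (‖k‖ ^ 2 - quad c o) := by
    intro v
    have := quad_add_smul c o v 1
    rw [one_smul, hk, hM] at this
    rw [this, norm_add_sq_real, real_inner_comm]
    ring
  have hR2 : 0 < ‖k‖ ^ 2 - quad c o := by linarith [sq_nonneg ‖k‖]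
  set R := √(‖k‖ ^ 2 - quad c o) with hR
  have hR0 : 0 < R := Real.sqrt_pos.2 hR2
  have hRsq : R ^ 2 = ‖k‖ ^ 2 - quad c o := Real.sq_sqrt hR2.le
  let f : E3 ≃ᵃ[ℝ] E3 := ((LinearEquiv.smulOfNeZero ℝ E3 R hR0.ne').trans M.symm).toAffineEquiv.trans
    (AffineEquiv.constVAdd ℝ E3 (o - M.symm k))
  have hf : ∀ y, f y = o + M.symm (R • y - k) := by
    intro y
    simp [f]
    abel
  refine ⟨f, ?_⟩
  have hzero : ∀ y, quad c (f y) = 0 ↔ ‖y‖ = 1 := by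
    intro y
    rw [hf, hquad, M.apply_symm_apply, sub_add_cancel, norm_smul, Real.norm_of_nonneg hR0.le,
      ← hRsq, mul_pow, sub_eq_zero, mul_eq_left₀ (pow_pos hR0 2).ne']
    exact pow_eq_one_iff_of_nonneg (norm_nonneg y) two_ne_zero
  ext x
  obtain ⟨y, rfl⟩ := f.surjective x
  rw [Set.mem_ofPred_eq, hzero, f.injective.mem_set_image, mem_sphere_zero_iff_norm]

namespace DiametralBody

variable {K : Set E3} {η A : E3 → E3}

lemma isEllipsoid (h : DiametralBody K η A) : IsEllipsoid (frontier K) := by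
  obtain ⟨d, hd0, hd⟩ := h.exists_quad
  obtain ⟨o, ho⟩ := h.body.2.2
  have hdo : quad d o ≠ 0 := by
    intro h0
    obtain ⟨y, hy⟩ := exists_quad_ne_zero hd0
    apply hy
    by_cases hyo : y = o
    · rw [hyo, h0]
    · simpa using h.quad_add_eq_zero ho (sub_ne_zero.2 hyo) h0 fun t ht => hd _ ht
  obtain ⟨c, hc, hco⟩ : ∃ c : Fin 10 → ℝ, (∀ x ∈ frontier K, quad c x = 0) ∧ quad c o = -1 := by
    refine ⟨(-(quad d o)⁻¹) • d - (0 : ℝ) • d, fun x hx => ?_, ?_⟩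
    · rw [quad_smul_sub_smul, hd x hx]
      ring
    · rw [quad_smul_sub_smul]
      field_simp
      ring
  have hline : ∀ v : E3, ∀ t : ℝ, o + t • v ∈ frontier K →
      -1 + t * quadDeriv c o v + t ^ 2 * (quadPolar c v v / 2) = 0 := by
    intro v t ht
    rw [← hco, ← quad_add_smul, hc _ ht]
  have hP : ∀ v : E3, v ≠ 0 → 0 < quadPolar c v v / 2 := by
    intro v hv
    obtain ⟨s, hs, hs'⟩ := h.exists_pos_mem_frontier ho hv
    obtain ⟨t, ht, ht'⟩ := h.exists_neg_mem_frontier ho hv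
    have h1 := hline v s hs'
    have h2 := hline v t ht'
    have h3 : (s - t) * (-(s * t) * (quadPolar c v v / 2) - 1) = 0 := by
      linear_combination -t * h1 + s * h2
    have h4 := (mul_eq_zero.1 h3).resolve_left (by linarith)
    have h5 : 0 < -(s * t) := by nlinarith
    exact pos_of_mul_pos_right (show 0 < -(s * t) * (quadPolar c v v / 2) by linarith) h5.le
  have hS : frontier K = {x | quad c x = 0} := by
    refine Set.Subset.antisymm hc fun x hx => ?_
    have hxo : x - o ≠ 0 := by
      intro h0
      rw [Set.mem_ofPred_eq, sub_eq_zero.1 h0, hco] at hx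
      norm_num at hx
    obtain ⟨s, hs, hs'⟩ := h.exists_pos_mem_frontier ho hxo
    have h1 := hline _ s hs'
    have h2 := quad_add_smul c o (x - o) 1
    rw [one_smul, add_sub_cancel, hco, hx] at h2
    have h3 : (s - 1) * (s * (quadPolar c (x - o) (x - o) / 2) + 1) = 0 := by
      linear_combination h1 + s * h2
    have h4 := (mul_eq_zero.1 h3).resolve_right (by
      have := mul_pos hs (hP _ hxo)
      linarith)
    rwa [sub_eq_zero.1 h4, one_smul, add_sub_cancel] at hs'
  rw [hS]
  exact isEllipsoid_quad (o := o) (by rw [hco]; norm_num) hP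

end DiametralBody

/-- If through every boundary point of a smooth strictly convex body
there are two elliptic diametral sections making an angle at least `α`, then the
boundary is an ellipsoid. -/
theorem two_diametral_elliptic_sections_ellipsoid (K : Set E3) (hK : IsConvexBody K)
    (hsm : IsSmoothBody K) (hsc : IsStrictlyConvexBody K)
    (η : E3 → E3) (hη : IsOuterNormal K η) (α : ℝ) (hα : 0 < α)
    (h : ∀ p ∈ frontier K, ∃ p' ∈ frontier K, p' ≠ p ∧ η p' = -η p ∧
      ∃ (H₁ H₂ : Set E3) (n₁ n₂ : E3),
        IsPlaneWithNormal H₁ n₁ ∧ IsPlaneWithNormal H₂ n₂ ∧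
        lineThrough p (p' - p) ⊆ H₁ ∧ lineThrough p (p' - p) ⊆ H₂ ∧
        α ≤ Real.arccos |⟪n₁, n₂⟫| ∧
        IsEllipse (frontier K ∩ H₁) ∧ IsEllipse (frontier K ∩ H₂)) :
    IsEllipsoid (frontier K) := by
  choose! A hA using h
  refine DiametralBody.isEllipsoid (η := η) (A := A) ⟨hK, hsm, hsc, hη, fun p hp => (hA p hp).1,
    fun p hp => (hA p hp).2.1, fun p hp => (hA p hp).2.2.1, fun p hp => ?_⟩
  obtain ⟨-, -, -, H₁, H₂, n₁, n₂, ⟨hn₁, b₁, rfl⟩, ⟨hn₂, b₂, rfl⟩, l₁, l₂, hang, E₁, E₂⟩ := hA p hp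
  have hl : ∀ {n : E3} {b : ℝ}, lineThrough p (A p - p) ⊆ {x | ⟪n, x⟫ = b} →
      b = ⟪n, p⟫ ∧ ⟪n, p - A p⟫ = 0 := by
    intro n b hl
    have h0 : ⟪n, p⟫ = b := hl ⟨0, by simp⟩
    have h1 : ⟪n, A p⟫ = b := hl ⟨1, by simp⟩
    exact ⟨h0.symm, by rw [inner_sub_right, h0, h1, sub_self]⟩
  obtain ⟨rfl, m₁⟩ := hl l₁
  obtain ⟨rfl, m₂⟩ := hl l₂
  refine ⟨n₁, n₂, hn₁, hn₂, fun h0 => ?_, m₁, m₂, E₁, E₂⟩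
  have h1 := inner_vcross_vcross n₁ n₂
  rw [h0, inner_zero_left, real_inner_self_eq_norm_sq, real_inner_self_eq_norm_sq, hn₁, hn₂] at h1
  have h2 : |⟪n₁, n₂⟫| = 1 := by
    rw [← sq_eq_sq₀ (abs_nonneg _) zero_le_one, sq_abs]
    linarith
  rw [h2, Real.arccos_one] at hang
  exact hang.not_gt hα
end

section
/- Let κ₁, κ₂, κ₁', κ₂', t₀ be real numbers and define f(θ) = κ₁ cos²θ + κ₂ sin²θ − κ₁' cos²(θ − t₀) − κ₂' sin²(θ − t₀). If f vanishes at three distinct values of θ in the interval [0, π), then f vanishes identically on ℝ. -/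
/-- A binary quadratic form with three pairwise non-proportional zeros over a domain is zero. -/
theorem binary_quadratic_coeffs_eq_zero {R : Type*} [CommRing R] [IsDomain R]
    {a b c x₁ y₁ x₂ y₂ x₃ y₃ : R}
    (h₁₂ : x₁ * y₂ - x₂ * y₁ ≠ 0) (h₁₃ : x₁ * y₃ - x₃ * y₁ ≠ 0) (h₂₃ : x₂ * y₃ - x₃ * y₂ ≠ 0)
    (h₁ : a * x₁ ^ 2 + b * (x₁ * y₁) + c * y₁ ^ 2 = 0)
    (h₂ : a * x₂ ^ 2 + b * (x₂ * y₂) + c * y₂ ^ 2 = 0)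
    (h₃ : a * x₃ ^ 2 + b * (x₃ * y₃) + c * y₃ ^ 2 = 0) :
    a = 0 ∧ b = 0 ∧ c = 0 := by
  have hdet := mul_ne_zero (mul_ne_zero h₁₂ h₁₃) h₂₃
  refine ⟨mul_right_cancel₀ hdet ?_, mul_right_cancel₀ hdet ?_, mul_right_cancel₀ hdet ?_⟩
  · linear_combination y₂ * y₃ * (x₂ * y₃ - x₃ * y₂) * h₁
      - y₁ * y₃ * (x₁ * y₃ - x₃ * y₁) * h₂ + y₁ * y₂ * (x₁ * y₂ - x₂ * y₁) * h₃
  · linear_combination -(x₂ * y₃ + x₃ * y₂) * (x₂ * y₃ - x₃ * y₂) * h₁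
      + (x₁ * y₃ + x₃ * y₁) * (x₁ * y₃ - x₃ * y₁) * h₂
      - (x₁ * y₂ + x₂ * y₁) * (x₁ * y₂ - x₂ * y₁) * h₃
  · linear_combination x₂ * x₃ * (x₂ * y₃ - x₃ * y₂) * h₁
      - x₁ * x₃ * (x₁ * y₃ - x₃ * y₁) * h₂ + x₁ * x₂ * (x₁ * y₂ - x₂ * y₁) * h₃

/-- Distinct angles in `[0, π)` determine non-proportional direction vectors. -/
theorem cos_mul_sin_sub_ne_zero_of_mem_Ico {α β : ℝ} (hα : α ∈ Set.Ico 0 Real.pi)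
    (hβ : β ∈ Set.Ico 0 Real.pi) (hne : α ≠ β) :
    Real.cos α * Real.sin β - Real.cos β * Real.sin α ≠ 0 := by
  have hsin : Real.sin (β - α) ≠ 0 := fun h => hne <| by
    have := (Real.sin_eq_zero_iff_of_lt_of_lt (by linarith [hα.2, hβ.1])
      (by linarith [hα.1, hβ.2])).1 h
    linarith
  rw [Real.sin_sub] at hsin
  convert hsin using 1
  ring

/-- Lemma 2, analytic form. If the difference of two Euler curvature
formulas vanishes at three distinct angles in `[0, π)`, it vanishes identically. -/
theorem euler_formula_three_zeros (κ₁ κ₂ κ₁' κ₂' t₀ : ℝ) (f : ℝ → ℝ)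
    (hf : ∀ θ : ℝ, f θ = κ₁ * Real.cos θ ^ 2 + κ₂ * Real.sin θ ^ 2
      - κ₁' * Real.cos (θ - t₀) ^ 2 - κ₂' * Real.sin (θ - t₀) ^ 2)
    (θ₁ θ₂ θ₃ : ℝ)
    (h₁ : θ₁ ∈ Set.Ico 0 Real.pi) (h₂ : θ₂ ∈ Set.Ico 0 Real.pi)
    (h₃ : θ₃ ∈ Set.Ico 0 Real.pi)
    (hne₁₂ : θ₁ ≠ θ₂) (hne₁₃ : θ₁ ≠ θ₃) (hne₂₃ : θ₂ ≠ θ₃)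
    (hz₁ : f θ₁ = 0) (hz₂ : f θ₂ = 0) (hz₃ : f θ₃ = 0) :
    ∀ θ : ℝ, f θ = 0 := by
  have hquad : ∀ θ : ℝ, f θ =
      (κ₁ - κ₁' * Real.cos t₀ ^ 2 - κ₂' * Real.sin t₀ ^ 2) * Real.cos θ ^ 2
      + 2 * (κ₂' - κ₁') * Real.cos t₀ * Real.sin t₀ * (Real.cos θ * Real.sin θ)
      + (κ₂ - κ₁' * Real.sin t₀ ^ 2 - κ₂' * Real.cos t₀ ^ 2) * Real.sin θ ^ 2 := by
    intro θ
    rw [hf, Real.cos_sub, Real.sin_sub]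
    ring
  rw [hquad] at hz₁ hz₂ hz₃
  obtain ⟨ha, hb, hc⟩ := binary_quadratic_coeffs_eq_zero
    (cos_mul_sin_sub_ne_zero_of_mem_Ico h₁ h₂ hne₁₂)
    (cos_mul_sin_sub_ne_zero_of_mem_Ico h₁ h₃ hne₁₃)
    (cos_mul_sin_sub_ne_zero_of_mem_Ico h₂ h₃ hne₂₃) hz₁ hz₂ hz₃
  intro θ
  rw [hquad, ha, hb, hc]
  ring
end

section
/- Let K ⊂ ℝ³ be a convex body whose boundary is a C¹ surface, so that the outer unit normal η(p) at each p ∈ bd K is well defined and η : bd K → S² is continuous. Then η is an outward function. -/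
open scoped RealInnerProductSpace
open MeasureTheory

section InnerProductSpace

variable {E : Type*} [NormedAddCommGroup E] [InnerProductSpace ℝ E]

/-- A nonzero linear functional attains no maximum over a set at an interior point. -/
lemma inner_lt_of_mem_interior_s9 {K : Set E} {n p z : E} (hn : n ≠ 0)
    (h : ∀ x ∈ K, ⟪n, x⟫ ≤ ⟪n, p⟫) (hz : z ∈ interior K) : ⟪n, z⟫ < ⟪n, p⟫ := by
  have hcont : Filter.Tendsto (fun t : ℝ => z + t • n) (nhdsWithin 0 (Set.Ioi 0)) (nhds z) := by
    have : Continuous fun t : ℝ => z + t • n := by fun_prop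
    simpa using (this.tendsto 0).mono_left nhdsWithin_le_nhds
  obtain ⟨t, htK, ht⟩ :=
    ((hcont.eventually (mem_interior_iff_mem_nhds.1 hz)).and self_mem_nhdsWithin).exists
  have h1 := h _ htK
  rw [inner_add_right, real_inner_smul_right] at h1
  have : 0 < t * ⟪n, n⟫ := mul_pos ht (real_inner_self_pos.2 hn)
  linarith

/-- An outer normal of `K` at the contact point with an inscribed ball points away from the
center of the ball. -/
lemma sub_eq_smul_of_closedBall_subset {K : Set E} {n x q : E} {r : ℝ} (hr : 0 ≤ r)
    (hball : Metric.closedBall x r ⊆ K) (hq : dist x q = r) (hn : ‖n‖ = 1)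
    (h : ∀ y ∈ K, ⟪n, y⟫ ≤ ⟪n, q⟫) : q - x = r • n := by
  have h1 := h (x + r • n) (hball (by simp [norm_smul, hn, abs_of_nonneg hr]))
  rw [inner_add_right, real_inner_smul_right, real_inner_self_eq_norm_sq, hn] at h1
  have h2 : ⟪q - x, r • n⟫ = r * (⟪n, q⟫ - ⟪n, x⟫) := by
    rw [real_inner_smul_right, real_inner_comm, inner_sub_right]
  have h3 : ‖q - x‖ = r := by rw [← dist_eq_norm, dist_comm, hq]
  have h4 : ‖q - x - r • n‖ ^ 2 ≤ 0 := by
    rw [norm_sub_sq_real, h2, h3, norm_smul, hn, Real.norm_of_nonneg hr]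
    nlinarith
  exact sub_eq_zero.1 (norm_eq_zero.1 (pow_eq_zero_iff two_ne_zero |>.1
    (le_antisymm h4 (sq_nonneg _))))

/-- If `K` lies in the closed ball around `x` whose boundary contains `q`, then `q - x` is an
outer normal of `K` at `q`. -/
lemma inner_le_of_forall_dist_le {K : Set E} {x q : E} (h : ∀ y ∈ K, dist x y ≤ dist x q) :
    ∀ y ∈ K, ⟪q - x, y⟫ ≤ ⟪q - x, q⟫ := by
  intro y hy
  have h1 : ⟪q - x, y - x⟫ ≤ ⟪q - x, q - x⟫ := by
    rw [real_inner_self_eq_norm_mul_norm]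
    refine (real_inner_le_norm _ _).trans (mul_le_mul_of_nonneg_left ?_ (norm_nonneg _))
    simpa [dist_comm x, dist_eq_norm] using h y hy
  rw [inner_sub_right, inner_sub_right (q - x) q x] at h1
  linarith

/-- Through a point of a convex body, a line with no interior point lies in a support plane. -/
lemma exists_normal_orthogonal {K : Set E} [CompleteSpace E] (hK : Convex ℝ K)
    (hint : (interior K).Nonempty) {p v : E} (h : ∀ t : ℝ, p + t • v ∉ interior K) :
    ∃ n : E, n ≠ 0 ∧ ⟪n, v⟫ = 0 ∧ ∀ x ∈ K, ⟪n, x⟫ ≤ ⟪n, p⟫ := by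
  have hconv : Convex ℝ (Set.range fun t : ℝ => p + t • v) := by
    have := (convex_univ (𝕜 := ℝ) (E := ℝ)).is_linear_image
      (IsLinearMap.isLinearMap_smul' v) |>.translate p
    convert this using 1
    rw [Set.image_univ, ← Set.range_comp]
    rfl
  obtain ⟨f, u, hf, hu⟩ := geometric_hahn_banach_open hK.interior isOpen_interior hconv
    (Set.disjoint_left.2 fun x hx ⟨t, ht⟩ => h t (by simpa [ht] using hx))
  have hline : ∀ t : ℝ, u ≤ f p + t * f v := fun t => by simpa using hu _ ⟨t, rfl⟩
  have hu0 : u ≤ f p := by simpa using hline 0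
  refine ⟨(InnerProductSpace.toDual ℝ E).symm f, ?_, ?_, fun x hx => ?_⟩
  · rintro h0
    obtain ⟨z, hz⟩ := hint
    have hf0 : f = 0 := by simpa using h0
    have := hf z hz
    simp only [hf0, zero_apply] at this hu0
    linarith
  · rw [InnerProductSpace.toDual_symm_apply]
    by_contra hv
    have := hline ((u - f p - 1) / f v)
    rw [div_mul_cancel₀ _ hv] at this
    linarith
  · simp only [InnerProductSpace.toDual_symm_apply]
    have hx' : x ∈ closure (interior K) := by
      rw [hK.closure_interior_eq_closure_of_nonempty_interior hint]
      exact subset_closure hx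
    exact closure_minimal (fun a ha => ((hf a ha).trans_le hu0).le)
      (isClosed_le f.continuous continuous_const) hx'

/-- A functional that is maximal at `p` over the zero set of a function `h` is a multiple of the
derivative of `h` at `p`. -/
lemma exists_smul_eq_of_isMaxOn_zeros [CompleteSpace E] {h : E → ℝ} {h' : StrongDual ℝ E}
    {S U : Set E} {p n : E} (hU : U ∈ nhds p) (hh : HasStrictFDerivAt h h' p) (hp : h p = 0)
    (hS : ∀ x ∈ U, h x = 0 → x ∈ S) (hmax : ∀ x ∈ S, ⟪n, x⟫ ≤ ⟪n, p⟫) (hn : n ≠ 0) :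
    ∃ a : ℝ, h' = a • innerSL ℝ n := by
  have hext : IsLocalExtrOn (innerSL ℝ n) {x | h x = h p} p := by
    refine Or.inr ?_
    filter_upwards [mem_nhdsWithin_of_mem_nhds hU, self_mem_nhdsWithin] with x hxU hx
    exact hmax x (hS x hxU (by rw [← hp]; exact hx))
  obtain ⟨a, b, hab, heq⟩ := hext.exists_multipliers_of_hasStrictFDerivAt_1d hh
    (innerSL ℝ n).hasStrictFDerivAt
  have ha : a ≠ 0 := by
    rintro rfl
    have hb : b ≠ 0 := fun hb => hab (by simp [hb])
    have := congrArg (fun f : StrongDual ℝ E => f n) heq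
    simp [hb, hn] at this
  refine ⟨-(a⁻¹ * b), ?_⟩
  rw [neg_smul, mul_smul, ← smul_neg, ← eq_neg_of_add_eq_zero_left heq, smul_smul,
    inv_mul_cancel₀ ha, one_smul]

end InnerProductSpace

/-- A surface that is locally a `C¹` graph is locally the zero set of a function with nonzero
strict derivative. -/
lemma HasContDiffBoundary.exists_defining_function {K : Set E3} (hC1 : HasContDiffBoundary K 1)
    {p : E3} (hp : p ∈ frontier K) :
    ∃ (h : E3 → ℝ) (h' : StrongDual ℝ E3) (U : Set E3), U ∈ nhds p ∧ HasStrictFDerivAt h h' p ∧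
      h' ≠ 0 ∧ h p = 0 ∧ ∀ x ∈ U, h x = 0 → x ∈ frontier K := by
  obtain ⟨e, g, U, hUo, hpU, hg, hgraph⟩ := hC1 p hp
  let h : E3 → ℝ := fun x => e x 2 - g (e x 0, e x 1)
  have he : ContDiff ℝ 1 e := e.toAffineIsometry.toContinuousAffineMap.contDiff
  have hh : ContDiff ℝ 1 h := by
    have hi : ∀ i : Fin 3, ContDiff ℝ 1 fun x => e x i := fun i => (contDiff_euclidean.1 he) i
    exact (hi 2).sub ((by exact_mod_cast hg : ContDiff ℝ 1 g).comp ((hi 0).prodMk (hi 1)))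
  have hstrict := hh.contDiffAt (x := p) |>.hasStrictFDerivAt one_ne_zero
  refine ⟨h, _, U, hUo.mem_nhds hpU, hstrict, fun h0 => ?_, ?_, fun x hxU hx => ?_⟩
  · let w : E3 := EuclideanSpace.single 2 1
    let v : E3 := e.linearIsometryEquiv.symm w
    have hline : ∀ t : ℝ, h (p + t • v) = h p + t := by
      intro t
      have : e (p + t • v) = e p + t • w := by
        have := e.map_vadd p (t • v)
        rw [vadd_eq_add, add_comm] at this
        rw [this, map_smul, LinearIsometryEquiv.apply_symm_apply, vadd_eq_add, add_comm]
      simp [h, this, w]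
      ring
    have hd : HasDerivAt (fun t : ℝ => h (p + t • v)) 0 0 := by
      have h1 : HasDerivAt (fun t : ℝ => p + t • v) v 0 := by
        simpa using ((hasDerivAt_id (0 : ℝ)).smul_const v).const_add p
      have h2 : HasFDerivAt h (0 : StrongDual ℝ E3) (p + (0 : ℝ) • v) := by
        simpa [h0] using hstrict.hasFDerivAt
      exact h2.comp_hasDerivAt 0 h1
    have hd' : HasDerivAt (fun t : ℝ => h (p + t • v)) 1 0 := by
      simp only [hline]
      exact (hasDerivAt_id (0 : ℝ)).const_add _
    exact zero_ne_one (hd.unique hd')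
  · have : p ∈ {x ∈ U | e x 2 = g (e x 0, e x 1)} := hgraph ▸ ⟨hp, hpU⟩
    exact sub_eq_zero.2 this.2
  · have : x ∈ frontier K ∩ U := hgraph ▸ ⟨hxU, sub_eq_zero.1 hx⟩
    exact this.1

/-- The outer normal of a convex body with `C¹` boundary is unique up to positive multiples. -/
lemma HasContDiffBoundary.exists_pos_smul_eq {K : Set E3} (hC1 : HasContDiffBoundary K 1)
    (hKc : IsClosed K) (hint : (interior K).Nonempty) {p m n : E3} (hp : p ∈ frontier K)
    (hm : m ≠ 0) (hmK : ∀ x ∈ K, ⟪m, x⟫ ≤ ⟪m, p⟫)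
    (hn : n ≠ 0) (hnK : ∀ x ∈ K, ⟪n, x⟫ ≤ ⟪n, p⟫) : ∃ c : ℝ, 0 < c ∧ n = c • m := by
  obtain ⟨h, h', U, hU, hh, hh0, hp0, hzero⟩ := hC1.exists_defining_function hp
  have hfr := hKc.frontier_subset
  obtain ⟨a, ha⟩ := exists_smul_eq_of_isMaxOn_zeros hU hh hp0 hzero
    (fun x hx => hmK x (hfr hx)) hm
  obtain ⟨b, hb⟩ := exists_smul_eq_of_isMaxOn_zeros hU hh hp0 hzero
    (fun x hx => hnK x (hfr hx)) hn
  have hb0 : b ≠ 0 := by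
    rintro rfl
    exact hh0 (by simpa using hb)
  have hnm : n = (b⁻¹ * a) • m := by
    have h1 : b • n = a • m := by
      refine ext_inner_right ℝ fun x => ?_
      have := congrArg (fun f : StrongDual ℝ E3 => f x) (hb.symm.trans ha)
      simpa [real_inner_smul_left] using this
    rw [mul_smul, ← h1, smul_smul, inv_mul_cancel₀ hb0, one_smul]
  refine ⟨b⁻¹ * a, ?_, hnm⟩
  obtain ⟨z, hz⟩ := hint
  have h1 := inner_lt_of_mem_interior_s9 hm hmK hz
  have h2 := inner_lt_of_mem_interior_s9 hn hnK hz
  rw [hnm, real_inner_smul_left, real_inner_smul_left] at h2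
  by_contra! hc
  nlinarith

/-- In a compact convex body the normal line at a boundary point `p` cuts out a nondegenerate
chord `[p, p - T • v]` whose relative interior is interior to the body. -/
lemma exists_chord {K : Set E3} (hKc : IsCompact K) (hK : Convex ℝ K) {p v : E3}
    (hp : p ∈ frontier K) (hv : ‖v‖ = 1) (hvK : ∀ x ∈ K, ⟪v, x⟫ ≤ ⟪v, p⟫)
    (hline : ∃ t : ℝ, p + t • v ∈ interior K) :
    ∃ T : ℝ, 0 < T ∧ p + (-T / 2) • v ∈ interior K ∧
      ∀ t : ℝ, p + t • v ∈ frontier K → t = 0 ∨ t = -T := by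
  have hvv : ⟪v, v⟫ = 1 := by rw [real_inner_self_eq_norm_sq, hv, one_pow]
  have hnonpos : ∀ t : ℝ, p + t • v ∈ K → t ≤ 0 := fun t ht => by
    have := hvK _ ht
    rw [inner_add_right, real_inner_smul_right, hvv] at this
    linarith
  have hpK : p ∈ K := hKc.isClosed.frontier_subset hp
  have hiso : Isometry fun t : ℝ => p + t • v := Isometry.of_dist_eq fun s t => by
    rw [dist_add_left, dist_eq_norm, ← sub_smul, norm_smul, hv, mul_one, dist_eq_norm]
  obtain ⟨s, hs⟩ := hline
  have hsK : p + s • v ∈ K := interior_subset hs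
  obtain ⟨m, hm, hmin⟩ := (hiso.isClosedEmbedding.isCompact_preimage hKc).exists_isLeast
    ⟨s, hsK⟩
  have hms : m ≤ s := hmin hsK
  have hs0 : s < 0 := (hnonpos s hsK).lt_of_ne fun h0 =>
    hp.2 (by simpa [h0] using hs)
  have hopen : ∀ t : ℝ, m < t → t < 0 → p + t • v ∈ interior K := by
    intro t hmt ht0
    rcases le_total t s with hts | hst
    · have h1 := hK.add_smul_sub_mem_interior (t := (t - m) / (s - m)) hm hs
        ⟨div_pos (by linarith) (by linarith), (div_le_one (by linarith)).2 (by linarith)⟩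
      convert h1 using 1
      rw [add_sub_add_left_eq_sub, ← sub_smul, smul_smul, div_mul_cancel₀ _ (by linarith), add_assoc,
        ← add_smul]
      ring_nf
    · have h1 := hK.add_smul_mem_interior (t := t / s) hpK hs
        ⟨div_pos_of_neg_of_neg ht0 hs0, (div_le_one_of_neg hs0).2 hst⟩
      rwa [smul_smul, div_mul_cancel₀ _ hs0.ne] at h1
  refine ⟨-m, by linarith, ?_, fun t ht => ?_⟩
  · exact hopen _ (by linarith) (by linarith)
  · have htK : p + t • v ∈ K := hKc.isClosed.frontier_subset ht
    have hmt : m ≤ t := hmin htK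
    rcases hmt.eq_or_lt with h1 | h1
    · exact Or.inr (by linarith)
    · rcases (hnonpos t htK).eq_or_lt with h2 | h2
      · exact Or.inl h2
      · exact absurd (hopen t h1 h2) ht.2

/-- The boundary of a convex body is not contained in a line. -/
lemma exists_mem_frontier_notMem_lineThrough {K : Set E3} (hK : IsCompact K) {p v : E3}
    (h : ∃ t : ℝ, p + t • v ∈ interior K) : ∃ q ∈ frontier K, q ∉ lineThrough p v := by
  obtain ⟨w, hw, hw0⟩ := Submodule.exists_mem_ne_zero_of_ne_bot
    ((innerSL ℝ v).toLinearMap.ker_ne_bot_of_finrank_lt (by simp))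
  have hwv : ⟪w, v⟫ = 0 := by
    rw [real_inner_comm]
    simpa using hw
  obtain ⟨t, ht⟩ := h
  obtain ⟨q, hqK, hq⟩ := hK.exists_isMaxOn (f := fun x => ⟪w, x⟫) ⟨_, interior_subset ht⟩
    (by fun_prop)
  have hqmax : ∀ x ∈ K, ⟪w, x⟫ ≤ ⟪w, q⟫ := fun x hx => hq hx
  refine ⟨q, ⟨subset_closure hqK, fun hqi => (inner_lt_of_mem_interior_s9 hw0 hqmax hqi).false⟩, ?_⟩
  rintro ⟨s, rfl⟩
  have := inner_lt_of_mem_interior_s9 hw0 hqmax ht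
  simp [inner_add_right, real_inner_smul_right, hwv] at this

/-- For a convex body with `C¹` boundary, the outer unit normal field
is an outward function. -/
theorem outer_normal_is_outward (K : Set E3) (hK : IsConvexBody K)
    (hC1 : HasContDiffBoundary K 1) (η : E3 → E3) (hη : IsOuterNormal K η)
    (hηc : ContinuousOn η (frontier K)) :
    IsOutwardFunction K η := by
  obtain ⟨hKc, hconv, hint⟩ := hK
  have hne : ∀ p ∈ frontier K, η p ≠ 0 := fun p hp =>
    norm_ne_zero_iff.1 (by simp [(hη p hp).1])
  refine ⟨hηc, fun p hp => ?_⟩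
  obtain ⟨hunit, hsupp⟩ := hη p hp
  have hline : ∃ t : ℝ, p + t • η p ∈ interior K := by
    by_contra! hcon
    obtain ⟨n, hn, hnη, hnK⟩ := exists_normal_orthogonal hconv hint hcon
    obtain ⟨c, hc, rfl⟩ := hC1.exists_pos_smul_eq hKc.isClosed hint hp (hne p hp) hsupp hn hnK
    rw [real_inner_smul_left, real_inner_self_eq_norm_sq, hunit] at hnη
    linarith
  refine ⟨hunit, ?_, fun t ht htK => ?_, ?_⟩
  · rintro ⟨-, hempty⟩
    obtain ⟨t, ht⟩ := hline
    exact Set.eq_empty_iff_forall_notMem.1 hempty _ ⟨⟨t, rfl⟩, ht⟩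
  · have := hsupp _ htK
    rw [inner_add_right, real_inner_smul_right, real_inner_self_eq_norm_sq, hunit] at this
    linarith
  obtain ⟨T, hT, hx, hends⟩ := exists_chord hKc hconv hp hunit hsupp hline
  set x := p + (-T / 2) • η p with hxdef
  have hdist : ∀ q ∈ frontier K, q ∈ lineThrough p (η p) → dist x q = T / 2 := by
    rintro _ hq ⟨t, rfl⟩
    rw [hxdef, dist_add_left, dist_eq_norm, ← sub_smul, norm_smul, hunit, mul_one, Real.norm_eq_abs]
    rcases hends t hq with rfl | rfl
    · rw [abs_of_neg] <;> linarith
    · rw [abs_of_pos] <;> linarith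
  by_contra! hcon
  have hmeet : ∀ q ∈ frontier K, ∀ c : ℝ, q - x = c • η q → q ∈ lineThrough p (η p) := by
    intro q hq c hqc
    by_contra hqL
    refine Set.eq_empty_iff_forall_notMem.1 (hcon q hq hqL) x ⟨⟨⟨_, hxdef⟩, ⟨-c, ?_⟩⟩, hx⟩
    rw [neg_smul, ← hqc]
    abel
  have hxK : x ∈ K := interior_subset hx
  have hKuniv : K ≠ Set.univ := by
    rintro rfl
    simp at hp
  obtain ⟨q₀, hq₀, hr⟩ := exists_mem_frontier_infDist_compl_eq_dist hxK hKuniv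
  have hball : Metric.closedBall x (Metric.infDist x Kᶜ) ⊆ K := by
    simpa [hKc.isClosed.closure_eq] using Metric.closedBall_infDist_compl_subset_closure hxK
  have hnear : ∀ q ∈ frontier K, dist x q = Metric.infDist x Kᶜ → q ∈ lineThrough p (η p) :=
    fun q hq hqr => hmeet q hq _ <| sub_eq_smul_of_closedBall_subset Metric.infDist_nonneg hball hqr
      (hη q hq).1 (hη q hq).2
  rw [hdist q₀ hq₀ (hnear q₀ hq₀ hr.symm)] at hr
  obtain ⟨q₁, hq₁, hfar⟩ := hKc.exists_isMaxOn (f := dist x) ⟨x, hxK⟩ (by fun_prop)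
  have hfar' : ∀ y ∈ K, dist x y ≤ dist x q₁ := fun y hy => hfar hy
  have hq₁0 : q₁ - x ≠ 0 := by
    intro h0
    have := hfar' p (hKc.isClosed.frontier_subset hp)
    rw [sub_eq_zero.1 h0, dist_self, hdist p hp ⟨0, by simp⟩] at this
    linarith
  have hnormal := inner_le_of_forall_dist_le hfar'
  have hq₁fr : q₁ ∈ frontier K :=
    ⟨subset_closure hq₁, fun hi => (inner_lt_of_mem_interior_s9 hq₁0 hnormal hi).false⟩
  obtain ⟨c, -, hc⟩ := hC1.exists_pos_smul_eq hKc.isClosed hint hq₁fr (hne q₁ hq₁fr)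
    (hη q₁ hq₁fr).2 hq₁0 hnormal
  have hR := hdist q₁ hq₁fr (hmeet q₁ hq₁fr c hc)
  obtain ⟨q, hq, hqL⟩ := exists_mem_frontier_notMem_lineThrough hKc hline
  refine hqL (hnear q hq (le_antisymm ?_ ?_))
  · rw [hr, ← hR]
    exact hfar' q (hKc.isClosed.frontier_subset hq)
  · rw [← Metric.infDist_closure]
    exact Metric.infDist_le_dist_of_mem (frontier_compl K ▸ hq : q ∈ frontier Kᶜ).1
end

section
/- Let K ⊂ ℝ³ be a convex body and let 𝓛 be a continuous system of lines in ℝ³ whose center is contained in the interior of K. Then every line of 𝓛 meets the interior of K, every point p ∈ bd K lies on exactly one line L_p of 𝓛, and the map Ψ : bd K → S² assigning to p the unique unit vector parallel to L_p such that the ray {p + tΨ(p) : t > 0} is disjoint from K is an outward function. -/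
open scoped RealInnerProductSpace
open MeasureTheory

/-- The upper unit hemisphere parametrised by the plane: the radial retraction onto the closed
unit disc followed by vertical projection onto the sphere. -/
noncomputable def hemisphere (w : ℂ) : E3 :=
  !₂[w.re / max 1 ‖w‖, w.im / max 1 ‖w‖, √(1 - (‖w‖ / max 1 ‖w‖) ^ 2)]

theorem continuous_hemisphere : Continuous hemisphere := by
  have hm : ∀ w : ℂ, max 1 ‖w‖ ≠ 0 := fun w => (lt_max_of_lt_left one_pos).ne'
  unfold hemisphere
  refine (PiLp.continuous_toLp 2 _).comp (continuous_pi fun i => ?_)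
  fin_cases i
  · exact Complex.continuous_re.div (continuous_const.max continuous_norm) hm
  · exact Complex.continuous_im.div (continuous_const.max continuous_norm) hm
  · exact (continuous_const.sub
      ((continuous_norm.div (continuous_const.max continuous_norm) hm).pow 2)).sqrt

theorem norm_hemisphere (w : ℂ) : ‖hemisphere w‖ = 1 := by
  have hm : 0 < max 1 ‖w‖ := lt_max_of_lt_left one_pos
  have h1 : ‖w‖ / max 1 ‖w‖ ≤ 1 := (div_le_one hm).2 (le_max_right _ _)
  have h2 : (‖w‖ / max 1 ‖w‖) ^ 2 ≤ 1 := pow_le_one₀ (by positivity) h1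
  rw [EuclideanSpace.norm_eq, Real.sqrt_eq_one]
  simp only [hemisphere, Fin.sum_univ_three, Real.norm_eq_abs, sq_abs]
  simp only [Matrix.cons_val]
  rw [Real.sq_sqrt (by linarith), div_pow, div_pow, div_pow, Complex.sq_norm, Complex.normSq_apply]
  ring

theorem hemisphere_two_nonneg (w : ℂ) : 0 ≤ hemisphere w 2 := by
  simp [hemisphere]

theorem hemisphere_neg {w : ℂ} (hw : ‖w‖ = 1) : hemisphere (-w) = -hemisphere w := by
  ext i
  fin_cases i <;> simp [hemisphere, hw]

/-- The tangent planes of the unit sphere away from the south pole, trivialised by rotating each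
point `u` to the north pole. -/
noncomputable def tangentCoord (u x : E3) : ℂ :=
  ⟨x 0 - x 2 / (1 + u 2) * u 0, x 1 - x 2 / (1 + u 2) * u 1⟩

theorem tangentCoord_ne_zero {u x : E3} (hu : ‖u‖ = 1) (hu2 : 0 ≤ u 2) (hx : ⟪u, x⟫ = 0)
    (hx0 : x ≠ 0) : tangentCoord u x ≠ 0 := by
  intro h
  apply hx0
  have h0 := congrArg Complex.re h
  have h1 := congrArg Complex.im h
  simp only [tangentCoord, Complex.zero_re, Complex.zero_im] at h0 h1
  have hd : 1 + u 2 ≠ 0 := by positivity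
  have hc : x 2 = x 2 / (1 + u 2) * (1 + u 2) := by field_simp
  generalize x 2 / (1 + u 2) = c at *
  have hn : u 0 ^ 2 + u 1 ^ 2 + u 2 ^ 2 = 1 := by
    simpa [EuclideanSpace.norm_eq, Fin.sum_univ_three] using hu
  simp only [PiLp.inner_apply, Fin.sum_univ_three, RCLike.inner_apply, conj_trivial] at hx
  have hc0 : c * (1 + u 2) = 0 := by
    linear_combination hx - u 0 * h0 - u 1 * h1 - u 2 * hc - c * hn
  have : c = 0 := (mul_eq_zero.1 hc0).resolve_right hd
  subst this
  ext i
  fin_cases i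
  · simpa using h0
  · simpa using h1
  · simpa using hc

theorem tangentCoord_neg_equator {w : ℂ} (hw : ‖w‖ = 1) {x : E3} (hx : ⟪hemisphere w, x⟫ = 0) :
    tangentCoord (-hemisphere w) x
      = -w ^ 2 * (starRingEnd ℂ) (tangentCoord (hemisphere w) x) := by
  have hn : w.re ^ 2 + w.im ^ 2 = 1 := by
    have := Complex.sq_norm w
    rw [hw, Complex.normSq_apply] at this
    linarith
  simp [hemisphere, PiLp.inner_apply, Fin.sum_univ_three, hw] at hx
  apply Complex.ext
  · simp [tangentCoord, hemisphere, hw, pow_two]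
    linear_combination (-x 0 - x 2 * w.re) * hn + 2 * w.re * hx
  · simp [tangentCoord, hemisphere, hw, pow_two]
    linear_combination (-x 1 - x 2 * w.im) * hn + 2 * w.im * hx

/-- A continuous function on `ℂ` without zeros cannot satisfy `f (-w) = -w² conj (f w)` on the
whole unit circle. -/
theorem exists_ne_of_continuous_ne_zero {f : ℂ → ℂ} (hf : Continuous f) (h0 : ∀ w, f w ≠ 0) :
    ∃ w : ℂ, ‖w‖ = 1 ∧ f (-w) ≠ -w ^ 2 * (starRingEnd ℂ) (f w) := by
  by_contra! hsymm
  obtain ⟨ψ, ⟨-, hψ⟩, -⟩ := Complex.isCoveringMapOn_exp.existsUnique_continuousMap_lifts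
    ⟨f, hf⟩ (a₀ := (0 : ℂ)) (e₀ := Complex.log (f 0)) (Complex.exp_log (h0 0)) h0
  have hexp : ∀ w, Complex.exp (ψ w) = f w := fun w => congrFun hψ w
  let k : ℝ → ℂ := fun θ =>
    ψ (-Complex.exp (θ * Complex.I)) - (starRingEnd ℂ) (ψ (Complex.exp (θ * Complex.I)))
      - 2 * (θ * Complex.I) - Real.pi * Complex.I
  have hk : ∀ θ, Complex.exp (k θ) = 1 := by
    intro θ
    have hs := hsymm (Complex.exp (θ * Complex.I)) (Complex.norm_exp_ofReal_mul_I θ)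
    simp only [k, Complex.exp_sub, hexp, Complex.exp_conj, Complex.exp_pi_mul_I, hs]
    have h2 : Complex.exp (2 * (θ * Complex.I)) = Complex.exp (θ * Complex.I) ^ 2 := by
      rw [← Complex.exp_nat_mul]; norm_num
    have h3 : (starRingEnd ℂ) (f (Complex.exp (θ * Complex.I))) ≠ 0 := by
      simpa using h0 _
    have h4 := Complex.exp_ne_zero (θ * Complex.I)
    rw [h2]
    field_simp
  have hcont : Continuous fun θ : ℝ => (k θ).im / (2 * Real.pi) := by
    simp only [k]
    fun_prop
  have hint : ∀ θ, (k θ).im / (2 * Real.pi) ∈ Set.range ((↑) : ℤ → ℝ) := by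
    intro θ
    obtain ⟨n, hn⟩ := Complex.exp_eq_one_iff.1 (hk θ)
    refine ⟨n, ?_⟩
    rw [hn]
    simp
  have hdisc : IsDiscrete (Set.range ((↑) : ℤ → ℝ)) :=
    Int.isClosedEmbedding_coe_real.isEmbedding.isDiscrete_range
  have hconst := isPreconnected_univ.constant_of_mapsTo hdisc hcont.continuousOn
    (fun θ _ => hint θ) (Set.mem_univ 0) (Set.mem_univ Real.pi)
  have hpi := Real.pi_pos
  rw [div_left_inj' (by positivity)] at hconst
  simp [k, Complex.exp_pi_mul_I] at hconst
  linarith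

/-- An even continuous tangent vector field on the unit sphere has a zero. -/
theorem exists_eq_zero_of_even_tangent {g : E3 → E3}
    (hg : ContinuousOn g (Metric.sphere (0 : E3) 1))
    (htan : ∀ u : E3, ‖u‖ = 1 → ⟪u, g u⟫ = 0) (heven : ∀ u : E3, ‖u‖ = 1 → g (-u) = g u) :
    ∃ u : E3, ‖u‖ = 1 ∧ g u = 0 := by
  by_contra! hne
  have hgc : Continuous fun w => g (hemisphere w) :=
    hg.comp_continuous continuous_hemisphere fun w => by simp [norm_hemisphere]
  have hu := continuous_hemisphere
  have hf : Continuous fun w => tangentCoord (hemisphere w) (g (hemisphere w)) := by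
    have hi : ∀ i, Continuous fun w => hemisphere w i := fun i =>
      (EuclideanSpace.proj (𝕜 := ℝ) i).continuous.comp hu
    have hgi : ∀ i, Continuous fun w => g (hemisphere w) i := fun i =>
      (EuclideanSpace.proj (𝕜 := ℝ) i).continuous.comp hgc
    have hd : ∀ w, 1 + hemisphere w 2 ≠ 0 := fun w => by
      have := hemisphere_two_nonneg w
      positivity
    have hc : Continuous fun w => g (hemisphere w) 2 / (1 + hemisphere w 2) :=
      (hgi 2).div (continuous_const.add (hi 2)) hd
    exact Complex.equivRealProdCLM.symm.continuous.comp
      (((hgi 0).sub (hc.mul (hi 0))).prodMk ((hgi 1).sub (hc.mul (hi 1))))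
  obtain ⟨w, hw, h⟩ := exists_ne_of_continuous_ne_zero hf fun w =>
    tangentCoord_ne_zero (norm_hemisphere w) (hemisphere_two_nonneg w)
      (htan _ (norm_hemisphere w)) (hne _ (norm_hemisphere w))
  apply h
  rw [hemisphere_neg hw, heven _ (norm_hemisphere w),
    tangentCoord_neg_equator hw (htan _ (norm_hemisphere w))]

theorem mem_lineThrough_self (p v : E3) : p ∈ lineThrough p v := ⟨0, by simp⟩

theorem add_smul_mem_lineThrough (p v : E3) (t : ℝ) : p + t • v ∈ lineThrough p v := ⟨t, rfl⟩

theorem lineThrough_eq_of_mem {p q v : E3} (h : q ∈ lineThrough p v) :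
    lineThrough q v = lineThrough p v := by
  obtain ⟨s, rfl⟩ := h
  ext x
  constructor
  · rintro ⟨t, rfl⟩
    exact ⟨s + t, by module⟩
  · rintro ⟨t, rfl⟩
    exact ⟨t - s, by module⟩

theorem lineThrough_smul {p v : E3} {c : ℝ} (hc : c ≠ 0) :
    lineThrough p (c • v) = lineThrough p v := by
  ext x
  constructor
  · rintro ⟨t, rfl⟩
    exact ⟨t * c, by module⟩
  · rintro ⟨t, rfl⟩
    exact ⟨t * c⁻¹, by rw [smul_smul, inv_mul_cancel_right₀ hc]⟩

theorem LineParallel.smul {L : Set E3} {u : E3} (h : LineParallel L u) {c : ℝ} (hc : c ≠ 0) :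
    LineParallel L (c • u) := by
  obtain ⟨p, rfl⟩ := h
  exact ⟨p, (lineThrough_smul hc).symm⟩

theorem LineParallel.neg {L : Set E3} {u : E3} (h : LineParallel L u) : LineParallel L (-u) := by
  simpa using h.smul (neg_ne_zero.2 one_ne_zero : (-1 : ℝ) ≠ 0)

theorem LineParallel.eq_lineThrough {L : Set E3} {u p : E3} (h : LineParallel L u) (hp : p ∈ L) :
    L = lineThrough p u := by
  obtain ⟨q, rfl⟩ := h
  exact (lineThrough_eq_of_mem hp).symm

theorem exists_smul_eq_of_lineThrough_eq {p q u v : E3} (h : lineThrough p u = lineThrough q v) :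
    ∃ c : ℝ, u = c • v := by
  obtain ⟨s, hs⟩ : p ∈ lineThrough q v := h ▸ mem_lineThrough_self p u
  obtain ⟨t, ht⟩ : p + (1 : ℝ) • u ∈ lineThrough q v := h ▸ add_smul_mem_lineThrough p u 1
  refine ⟨t - s, ?_⟩
  have : u = (p + (1 : ℝ) • u) - p := by module
  rw [this, ht, hs]
  module

theorem eq_or_eq_neg_of_lineThrough_eq {p q u v : E3} (hu : ‖u‖ = 1) (hv : ‖v‖ = 1)
    (h : lineThrough p u = lineThrough q v) : u = v ∨ u = -v := by
  obtain ⟨c, hc⟩ := exists_smul_eq_of_lineThrough_eq h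
  have habs : |c| = 1 := by
    rwa [hc, norm_smul, hv, mul_one] at hu
  rcases eq_or_eq_neg_of_abs_eq habs with rfl | rfl
  · exact Or.inl (by simpa using hc)
  · exact Or.inr (by simpa using hc)

theorem IsLine.exists_unit {L : Set E3} (h : IsLine L) : ∃ u : E3, ‖u‖ = 1 ∧ LineParallel L u := by
  obtain ⟨p, v, hv, rfl⟩ := h
  have hn : ‖v‖ ≠ 0 := norm_ne_zero_iff.2 hv
  refine ⟨‖v‖⁻¹ • v, ?_, p, (lineThrough_smul (inv_ne_zero hn)).symm⟩
  rw [norm_smul, norm_inv, norm_norm, inv_mul_cancel₀ hn]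

theorem inner_eq_zero_of_forall_norm_le {u d : E3} (hu : ‖u‖ = 1)
    (h : ∀ x ∈ lineThrough d u, ‖d‖ ≤ ‖x‖) : ⟪u, d⟫ = 0 := by
  have h1 := h _ (add_smul_mem_lineThrough d u (-⟪u, d⟫))
  have h2 := pow_le_pow_left₀ (norm_nonneg _) h1 2
  rw [norm_add_sq_real, norm_smul, inner_smul_right, real_inner_comm, hu, Real.norm_eq_abs,
    mul_one, sq_abs] at h2
  rw [real_inner_comm]
  exact pow_eq_zero_iff two_ne_zero |>.1 (le_antisymm (by linarith) (sq_nonneg _))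

/-- The foot point map of a system of lines: `δ u` is the point at which the line of the system
parallel to `u` meets the plane through the origin orthogonal to `u`. -/
structure IsFootMap (𝓛 : Set (Set E3)) (δ : E3 → E3) : Prop where
  continuousOn : ContinuousOn δ (Metric.sphere (0 : E3) 1)
  mem : ∀ u : E3, ‖u‖ = 1 → lineThrough (δ u) u ∈ 𝓛
  eq_of_parallel : ∀ u : E3, ‖u‖ = 1 → ∀ L ∈ 𝓛, LineParallel L u → L = lineThrough (δ u) u
  inner_eq_zero : ∀ u : E3, ‖u‖ = 1 → ⟪u, δ u⟫ = 0

theorem IsContinuousLineSystem.exists_isFootMap {𝓛 : Set (Set E3)}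
    (h : IsContinuousLineSystem 𝓛) : ∃ δ, IsFootMap 𝓛 δ := by
  obtain ⟨⟨-, hex⟩, δ, hδ, hmin⟩ := h
  have heq : ∀ u : E3, ‖u‖ = 1 → ∀ L ∈ 𝓛, LineParallel L u → L = lineThrough (δ u) u :=
    fun u hu L hL hp => hp.eq_lineThrough (hmin u hu L hL hp).1
  refine ⟨δ, hδ, fun u hu => ?_, heq, fun u hu => ?_⟩
  · obtain ⟨L, ⟨hL, hp⟩, -⟩ := hex u hu
    exact heq u hu L hL hp ▸ hL
  · obtain ⟨L, ⟨hL, hp⟩, -⟩ := hex u hu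
    have h2 := (hmin u hu L hL hp).2
    rw [heq u hu L hL hp] at h2
    exact inner_eq_zero_of_forall_norm_le hu h2

namespace IsFootMap

variable {𝓛 : Set (Set E3)} {δ : E3 → E3}

theorem apply_neg (h : IsFootMap 𝓛 δ) {u : E3} (hu : ‖u‖ = 1) : δ (-u) = δ u := by
  have hu' : ‖-u‖ = 1 := by rwa [norm_neg]
  have heq := h.eq_of_parallel (-u) hu' _ (h.mem u hu) (LineParallel.neg ⟨_, rfl⟩)
  obtain ⟨t, ht⟩ : δ (-u) ∈ lineThrough (δ u) u := heq ▸ mem_lineThrough_self _ _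
  have h1 := h.inner_eq_zero (-u) hu'
  rw [ht, inner_neg_left, inner_add_right, h.inner_eq_zero u hu, inner_smul_right,
    real_inner_self_eq_norm_sq, hu] at h1
  have : t = 0 := by linarith
  rw [ht, this, zero_smul, add_zero]

theorem eq_of_mem (h : IsFootMap 𝓛 δ) {u p : E3} (hu : ‖u‖ = 1)
    (hp : p ∈ lineThrough (δ u) u) : p = δ u + ⟪u, p⟫ • u := by
  obtain ⟨t, rfl⟩ := hp
  rw [inner_add_right, h.inner_eq_zero u hu, inner_smul_right, real_inner_self_eq_norm_sq, hu]
  module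

/-- Every point of space lies on a line of the system. -/
theorem exists_mem (h : IsFootMap 𝓛 δ) (p : E3) :
    ∃ u : E3, ‖u‖ = 1 ∧ p ∈ lineThrough (δ u) u := by
  obtain ⟨u, hu, hg⟩ := exists_eq_zero_of_even_tangent (g := fun u => δ u - p + ⟪u, p⟫ • u)
    ((h.continuousOn.sub continuousOn_const).add (by fun_prop))
    (fun u hu => by
      rw [inner_add_right, inner_sub_right, h.inner_eq_zero u hu, inner_smul_right,
        real_inner_self_eq_norm_sq, hu]
      ring)
    (fun u hu => by
      rw [h.apply_neg hu, inner_neg_left, neg_smul_neg])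
  refine ⟨u, hu, ⟪u, p⟫, ?_⟩
  rw [← sub_eq_zero, ← neg_eq_zero, ← hg]
  module

/-- Every line of the system meets an orthogonal line of the system. -/
theorem exists_orthogonal_inter (h : IsFootMap 𝓛 δ) {u : E3} (hu : ‖u‖ = 1) :
    ∃ v : E3, ‖v‖ = 1 ∧ ⟪u, v⟫ = 0 ∧
      (lineThrough (δ u) u ∩ lineThrough (δ v) v).Nonempty := by
  obtain ⟨b, hb⟩ := Orthonormal.exists_orthonormalBasis_extension_of_card_eq (𝕜 := ℝ)
    (ι := Fin 3) (E := E3) (by simp) (v := fun _ => u) (s := {0})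
    ⟨fun _ => hu, fun i j hij => (hij (Subsingleton.elim i j)).elim⟩
  have hb0 : b 0 = u := hb 0 rfl
  have hbn : ∀ i, ‖b i‖ = 1 := b.orthonormal.1
  have h12 : ⟪b 1, b 2⟫ = 0 := b.orthonormal.2 (by decide)
  have h01 : ⟪u, b 1⟫ = 0 := hb0 ▸ b.orthonormal.2 (by decide)
  have h02 : ⟪u, b 2⟫ = 0 := hb0 ▸ b.orthonormal.2 (by decide)
  let v : ℝ → E3 := fun θ => Real.cos θ • b 1 + Real.sin θ • b 2
  have hvn : ∀ θ, ‖v θ‖ = 1 := fun θ => by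
    rw [← sq_eq_sq₀ (norm_nonneg _) zero_le_one, norm_add_sq_real, norm_smul, norm_smul,
      inner_smul_left, inner_smul_right, h12, hbn, hbn]
    simp
  have hvc : Continuous v := by fun_prop
  have hvpi : v Real.pi = -v 0 := by simp [v]
  have hδv : Continuous fun θ => δ (v θ) :=
    h.continuousOn.comp_continuous hvc fun θ => by simp [hvn]
  let f : ℝ → ℝ := fun θ =>
    Real.cos θ * ⟪b 2, δ (v θ) - δ u⟫ - Real.sin θ * ⟪b 1, δ (v θ) - δ u⟫
  have hfc : Continuous f := by
    have hd : Continuous fun θ => δ (v θ) - δ u := hδv.sub continuous_const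
    exact (Real.continuous_cos.mul (continuous_const.inner hd)).sub
      (Real.continuous_sin.mul (continuous_const.inner hd))
  have hfpi : f Real.pi = -f 0 := by
    simp [f, hvpi, h.apply_neg (hvn 0)]
  obtain ⟨θ, -, hθ⟩ : (0 : ℝ) ∈ f '' Set.uIcc 0 Real.pi :=
    intermediate_value_uIcc hfc.continuousOn (by
      rw [hfpi, Set.mem_uIcc]
      rcases le_total (f 0) 0 with h0 | h0
      · exact Or.inl ⟨h0, by linarith⟩
      · exact Or.inr ⟨by linarith, h0⟩)
  refine ⟨v θ, hvn θ, by simp [v, inner_add_right, inner_smul_right, h01, h02], ?_⟩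
  have hsum := b.sum_repr' (δ (v θ) - δ u)
  rw [Fin.sum_univ_three, hb0] at hsum
  simp only [f] at hθ
  set α := ⟪b 1, δ (v θ) - δ u⟫
  set β := ⟪b 2, δ (v θ) - δ u⟫
  set γ := ⟪u, δ (v θ) - δ u⟫
  have hsc := Real.sin_sq_add_cos_sq θ
  have hα : (Real.cos θ * α + Real.sin θ * β) * Real.cos θ = α := by
    linear_combination Real.sin θ * hθ + α * hsc
  have hβ : (Real.cos θ * α + Real.sin θ * β) * Real.sin θ = β := by
    linear_combination -Real.cos θ * hθ + β * hsc
  refine ⟨δ u + γ • u, ⟨γ, rfl⟩, -(Real.cos θ * α + Real.sin θ * β), ?_⟩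
  have hv : (Real.cos θ * α + Real.sin θ * β) • v θ = α • b 1 + β • b 2 := by
    simp only [v]
    rw [smul_add, smul_smul, smul_smul, hα, hβ]
  rw [neg_smul, hv, ← sub_eq_zero]
  rw [← sub_eq_zero] at hsum
  rw [← hsum]
  module

end IsFootMap

theorem Convex.add_smul_notMem_of_mem_interior {K : Set E3} (hK : Convex ℝ K) {x p : E3}
    (hx : x ∈ interior K) (hp : p ∉ interior K) {t : ℝ} (ht : 0 < t) : p + t • (p - x) ∉ K := by
  intro hm
  apply hp
  have := hK.combo_interior_self_mem_interior hx hm (a := t / (1 + t)) (b := 1 / (1 + t))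
    (by positivity) (by positivity) (by field_simp; ring)
  convert this using 1
  rw [smul_add, smul_smul, smul_sub]
  have h1 : (1 / (1 + t)) * t = t / (1 + t) := by ring
  rw [h1]
  have h2 : p = (1 / (1 + t) + t / (1 + t)) • p := by
    rw [← add_div, div_self (by positivity), one_smul]
  nth_rewrite 1 [h2]
  module

theorem exists_add_smul_mem_frontier {K : Set E3} (hK : IsCompact K) {x v : E3}
    (hx : x ∈ K) (hv : v ≠ 0) : ∃ t : ℝ, x + t • v ∈ frontier K := by
  have hc : Continuous fun t : ℝ => x + t • v := by fun_prop
  have hne : (frontier ((fun t : ℝ => x + t • v) ⁻¹' K)).Nonempty := by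
    refine nonempty_frontier_iff.2 ⟨⟨0, by simpa using hx⟩, fun huniv => ?_⟩
    obtain ⟨R, hR⟩ := hK.isBounded.exists_norm_le
    have hvn : 0 < ‖v‖ := norm_pos_iff.2 hv
    have h1 : x + ((R + ‖x‖ + 1) / ‖v‖) • v ∈ K := by
      have := Set.mem_univ ((R + ‖x‖ + 1) / ‖v‖)
      rwa [← huniv] at this
    have h2 := hR _ h1
    have h3 := norm_sub_norm_le (((R + ‖x‖ + 1) / ‖v‖) • v) (-x)
    rw [sub_neg_eq_add, add_comm _ x, norm_neg, norm_smul, Real.norm_eq_abs] at h3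
    have h4 : R + ‖x‖ + 1 ≤ |(R + ‖x‖ + 1) / ‖v‖| * ‖v‖ := by
      refine le_trans (le_of_eq ?_) (mul_le_mul_of_nonneg_right (le_abs_self _) hvn.le)
      field_simp
    linarith
  obtain ⟨t, ht⟩ := hne
  exact ⟨t, hc.frontier_preimage_subset K ht⟩

theorem eq_of_mem_notMem_interior {K : Set E3} {𝓛 : Set (Set E3)}
    (hcenter : lineSystemCenter 𝓛 ⊆ interior K) {L₁ L₂ : Set E3} (h₁ : L₁ ∈ 𝓛) (h₂ : L₂ ∈ 𝓛)
    {p : E3} (hp : p ∉ interior K) (hp₁ : p ∈ L₁) (hp₂ : p ∈ L₂) : L₁ = L₂ := by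
  by_contra hne
  exact hp (hcenter ⟨L₁, h₁, L₂, h₂, hne, hp₁, hp₂⟩)

/-- A field of unit vectors along the lines of a system through the boundary points of a convex
body, pointing out of the body, is continuous provided that all lines meet the interior. -/
theorem IsFootMap.continuousOn_outward {K : Set E3} {𝓛 : Set (Set E3)} {δ : E3 → E3}
    (h : IsFootMap 𝓛 δ) (hcenter : lineSystemCenter 𝓛 ⊆ interior K)
    (hmeet : ∀ L ∈ 𝓛, (L ∩ interior K).Nonempty) {Ψ : E3 → E3}
    (hΨ : ∀ p ∈ frontier K, ‖Ψ p‖ = 1 ∧ (∃ L ∈ 𝓛, p ∈ L ∧ LineParallel L (Ψ p)) ∧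
      ∀ t : ℝ, 0 < t → p + t • Ψ p ∉ K) : ContinuousOn Ψ (frontier K) := by
  have hmem : ∀ p ∈ frontier K, p ∈ lineThrough (δ (Ψ p)) (Ψ p) := by
    intro p hp
    obtain ⟨hn, ⟨L, hL, hpL, hpar⟩, -⟩ := hΨ p hp
    exact h.eq_of_parallel _ hn L hL hpar ▸ hpL
  intro p hp
  rw [ContinuousWithinAt, Filter.tendsto_iff_ultrafilter]
  intro F hF
  have hFK : ∀ᶠ q in (F : Filter E3), q ∈ frontier K :=
    hF (self_mem_nhdsWithin)
  have hFp : Filter.Tendsto id (F : Filter E3) (nhds p) := hF.trans nhdsWithin_le_nhds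
  obtain ⟨v, hv, hlim⟩ := (isCompact_sphere (0 : E3) 1).ultrafilter_le_nhds (F.map Ψ) (by
    rw [Ultrafilter.coe_map, Filter.le_principal_iff, Filter.mem_map]
    filter_upwards [hFK] with q hq
    simpa using (hΨ q hq).1)
  have hlim : Filter.Tendsto Ψ (F : Filter E3) (nhds v) := hlim
  have hvn : ‖v‖ = 1 := by simpa using hv
  have hδlim : Filter.Tendsto (fun q => δ (Ψ q)) (F : Filter E3) (nhds (δ v)) := by
    refine (h.continuousOn v hv).tendsto.comp (tendsto_nhdsWithin_iff.2 ⟨hlim, ?_⟩)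
    filter_upwards [hFK] with q hq
    simpa using (hΨ q hq).1
  have hpv : p ∈ lineThrough (δ v) v := by
    refine ⟨⟪v, p⟫, tendsto_nhds_unique hFp ?_⟩
    refine (hδlim.add ((hlim.inner hFp).smul hlim)).congr' ?_
    filter_upwards [hFK] with q hq
    exact (h.eq_of_mem (hΨ q hq).1 (hmem q hq)).symm
  obtain ⟨hn, -, hout⟩ := hΨ p hp
  have hpK : p ∉ interior K := hp.2
  have hline := eq_of_mem_notMem_interior hcenter (h.mem v hvn) (h.mem _ hn) hpK hpv (hmem p hp)
  rcases eq_or_eq_neg_of_lineThrough_eq hvn hn hline with rfl | hneg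
  · exact hlim
  exfalso
  obtain ⟨x, hxL, hxK⟩ := hmeet _ (h.mem _ hn)
  rw [← lineThrough_eq_of_mem (hmem p hp)] at hxL
  obtain ⟨t, rfl⟩ := hxL
  have ht : t < 0 := by
    rcases lt_trichotomy t 0 with ht | rfl | ht
    · exact ht
    · simp [hpK] at hxK
    · exact (hout t ht (interior_subset hxK)).elim
  have hx : Filter.Tendsto (fun q => q + (-t) • Ψ q) (F : Filter E3) (nhds (p + t • Ψ p)) := by
    have := hFp.add (hlim.const_smul (-t))
    rwa [hneg, neg_smul_neg] at this
  obtain ⟨q, hq, hqK⟩ := ((hx.eventually (isOpen_interior.mem_nhds hxK)).and hFK).exists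
  exact (hΨ q hqK).2.2 (-t) (by linarith) (interior_subset hq)

/-- If the center of a continuous system of lines `𝓛` lies in the
interior of the convex body `K`, then every line of `𝓛` meets the interior of `K`,
every boundary point lies on exactly one line of `𝓛`, and the induced unit vector
field pointing outward along these lines is an outward function. -/
theorem line_system_induces_outward (K : Set E3) (hK : IsConvexBody K)
    (𝓛 : Set (Set E3)) (h𝓛 : IsContinuousLineSystem 𝓛)
    (hcenter : lineSystemCenter 𝓛 ⊆ interior K) :
    (∀ L ∈ 𝓛, (L ∩ interior K).Nonempty) ∧
    (∀ p ∈ frontier K, ∃! L, L ∈ 𝓛 ∧ p ∈ L) ∧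
    (∃ Ψ : E3 → E3, ∀ p ∈ frontier K, ‖Ψ p‖ = 1 ∧
      (∃ L ∈ 𝓛, p ∈ L ∧ LineParallel L (Ψ p)) ∧
      ∀ t : ℝ, 0 < t → p + t • Ψ p ∉ K) ∧
    (∀ Ψ : E3 → E3,
      (∀ p ∈ frontier K, ‖Ψ p‖ = 1 ∧
        (∃ L ∈ 𝓛, p ∈ L ∧ LineParallel L (Ψ p)) ∧
        ∀ t : ℝ, 0 < t → p + t • Ψ p ∉ K) →
      IsOutwardFunction K Ψ) := by
  obtain ⟨δ, h⟩ := h𝓛.exists_isFootMap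
  have hrepr : ∀ L ∈ 𝓛, ∃ u : E3, ‖u‖ = 1 ∧ L = lineThrough (δ u) u := by
    intro L hL
    obtain ⟨u, hu, hpar⟩ := (h𝓛.1.1 L hL).exists_unit
    exact ⟨u, hu, h.eq_of_parallel u hu L hL hpar⟩
  have hcross : ∀ u : E3, ‖u‖ = 1 → ∃ v : E3, ‖v‖ = 1 ∧
      lineThrough (δ u) u ≠ lineThrough (δ v) v ∧
      (lineThrough (δ u) u ∩ lineThrough (δ v) v ∩ interior K).Nonempty := by
    intro u hu
    obtain ⟨v, hv, huv, x, hxu, hxv⟩ := h.exists_orthogonal_inter hu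
    have hne : lineThrough (δ u) u ≠ lineThrough (δ v) v := by
      intro heq
      rcases eq_or_eq_neg_of_lineThrough_eq hu hv heq with rfl | rfl
      · simp [hu] at huv
      · simp [hv] at huv
    exact ⟨v, hv, hne, x, ⟨hxu, hxv⟩,
      hcenter ⟨_, h.mem u hu, _, h.mem v hv, hne, hxu, hxv⟩⟩
  have hmeet : ∀ L ∈ 𝓛, (L ∩ interior K).Nonempty := by
    intro L hL
    obtain ⟨u, hu, rfl⟩ := hrepr L hL
    obtain ⟨v, -, -, x, hx, hxK⟩ := hcross u hu
    exact ⟨x, hx.1, hxK⟩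
  refine ⟨hmeet, fun p hp => ?_, ?_, fun Ψ hΨ => ⟨h.continuousOn_outward hcenter hmeet hΨ, ?_⟩⟩
  · obtain ⟨u, hu, hpu⟩ := h.exists_mem p
    exact ⟨_, ⟨h.mem u hu, hpu⟩, fun L hL =>
      eq_of_mem_notMem_interior hcenter hL.1 (h.mem u hu) hp.2 hL.2 hpu⟩
  · have hex : ∀ p : E3, ∃ w : E3, p ∈ frontier K → ‖w‖ = 1 ∧
        (∃ L ∈ 𝓛, p ∈ L ∧ LineParallel L w) ∧ ∀ t : ℝ, 0 < t → p + t • w ∉ K := by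
      intro p
      by_cases hp : p ∈ frontier K
      swap
      · exact ⟨0, fun hp' => (hp hp').elim⟩
      obtain ⟨u, hu, hpu⟩ := h.exists_mem p
      obtain ⟨x, hxu, hxK⟩ := hmeet _ (h.mem u hu)
      have hxp : p - x ≠ 0 := by
        rw [sub_ne_zero]
        rintro rfl
        exact hp.2 hxK
      have hpos : 0 < ‖p - x‖ := norm_pos_iff.2 hxp
      refine ⟨‖p - x‖⁻¹ • (p - x), fun _ => ⟨?_, ⟨_, h.mem u hu, hpu, ?_⟩, fun t ht => ?_⟩⟩
      · rw [norm_smul, norm_inv, norm_norm, inv_mul_cancel₀ hpos.ne']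
      · rw [← lineThrough_eq_of_mem hxu] at hpu ⊢
        obtain ⟨s, rfl⟩ := hpu
        rw [add_sub_cancel_left] at hxp hpos ⊢
        have hs : s ≠ 0 := fun hs => hxp (by rw [hs, zero_smul])
        rw [smul_smul]
        exact LineParallel.smul ⟨x, rfl⟩ (mul_ne_zero (inv_ne_zero hpos.ne') hs)
      · rw [smul_smul]
        exact hK.2.1.add_smul_notMem_of_mem_interior hxK hp.2 (by positivity)
    choose Ψ hΨ using hex
    exact ⟨Ψ, hΨ⟩
  · have hline : ∀ p ∈ frontier K, lineThrough p (Ψ p) ∈ 𝓛 := by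
      intro p hp
      obtain ⟨-, ⟨L, hL, hpL, hpar⟩, -⟩ := hΨ p hp
      exact hpar.eq_lineThrough hpL ▸ hL
    intro p hp
    obtain ⟨hn, -, hout⟩ := hΨ p hp
    refine ⟨hn, fun htan => ?_, hout, ?_⟩
    · exact (hmeet _ (hline p hp)).ne_empty htan.2
    have hpL := h.eq_of_parallel _ hn _ (hline p hp) ⟨p, rfl⟩
    obtain ⟨v, hv, hne, x, ⟨hxu, hxv⟩, hxK⟩ := hcross _ hn
    obtain ⟨t, ht⟩ := exists_add_smul_mem_frontier hK.1 (interior_subset hxK)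
      (norm_ne_zero_iff.1 (hv ▸ one_ne_zero) : v ≠ 0)
    have hqv : x + t • v ∈ lineThrough (δ v) v :=
      lineThrough_eq_of_mem hxv ▸ add_smul_mem_lineThrough x v t
    have hqline := eq_of_mem_notMem_interior hcenter (hline _ ht) (h.mem v hv) ht.2
      (mem_lineThrough_self _ _) hqv
    refine ⟨x + t • v, ht, fun hq => ?_, x, ⟨hpL ▸ hxu, hqline ▸ hxv⟩, hxK⟩
    rw [hpL] at hq
    exact hne (eq_of_mem_notMem_interior hcenter (h.mem _ hn) (h.mem v hv) ht.2 hq hqv)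
end
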